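/- arXiv:1708.08576 — 2 statements merged into one kernel-verified Lean document; each statement's English description precedes it below -/
import Mathlib

section
/- Let M ≥ 1 and p ∈ (0,1)^M, and let (Y_n)_{n≥0} be a standard excited random walk with M cookies and cookie strength vector p. Then Y_n/n converges almost surely to a deterministic constant v(M,p); moreover v(M,p) > 0 if and only if δ(M,p) > 2, and v(M,p) = 0 if and only if −2 ≤ δ(M,p) ≤ 2. -/
open MeasureTheory ProbabilityTheory Filter Topology

/-- The success probability of the `j+1`-st visit to a site: `p (j+1)` while cookies
remain (`j < M`), and the bias parameter `p₀` afterwards. -/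
noncomputable def cookieSeq (M : ℕ) (p : Fin M → ℝ) (p₀ : ℝ) (j : ℕ) : ℝ :=
  if h : j < M then p ⟨j, h⟩ else p₀

/-- `IsEARW P M p p₀ X` : under the probability measure `P`, the process `X` is an
excited asymmetric random walk with `M` cookies of strengths `p ∈ (0,1)^M` and bias
parameter `p₀`: it starts at `0`, moves by `±1` steps, and conditionally on the path
`(X 0, …, X n)` it steps right with probability `p i` on the event
`#{m ≤ n : X m = X n} = i` for `1 ≤ i ≤ M`, and with probability `p₀` on the event
`#{m ≤ n : X m = X n} > M`. -/
structure IsEARW {Ω : Type*} [MeasurableSpace Ω] (P : Measure Ω)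
    (M : ℕ) (p : Fin M → ℝ) (p₀ : ℝ) (X : ℕ → Ω → ℤ) : Prop where
  measurable : ∀ n, Measurable (X n)
  init : ∀ ω, X 0 ω = 0
  steps : ∀ ω n, |X (n + 1) ω - X n ω| = 1
  cond : ∀ (n : ℕ) (w : Fin (n + 1) → ℤ),
    P ({ω | X (n + 1) ω = w (Fin.last n) + 1} ∩ {ω | ∀ m : Fin (n + 1), X m ω = w m})
      = ENNReal.ofReal
          (cookieSeq M p p₀
            ((Finset.univ.filter fun m : Fin (n + 1) => w m = w (Fin.last n)).card - 1))
        * P {ω | ∀ m : Fin (n + 1), X m ω = w m}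

namespace ExcitedWalk

open scoped ENNReal

/-! ### Arrow stacks -/

/-- The number of right arrows (`true`) among the first `j` arrows of the stack `b`. -/
def rights (b : ℕ → Bool) (j : ℕ) : ℕ := Nat.count (fun i => b i = true) j

/-- The number of left arrows (`false`) among the first `j` arrows of the stack `b`. -/
def lefts (b : ℕ → Bool) (j : ℕ) : ℕ := Nat.count (fun i => b i = false) j

/-- The number of left arrows preceding the `(z+1)`-st right arrow of the stack `b`. -/
noncomputable def leftsBefore (b : ℕ → Bool) (z : ℕ) : ℕ :=
  lefts b (Nat.nth (fun i => b i = true) z)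

/-- The stack `b` contains infinitely many right arrows. -/
def Good (b : ℕ → Bool) : Prop := {i | b i = true}.Infinite

lemma lefts_mono (b : ℕ → Bool) : Monotone (lefts b) := Nat.count_monotone _

lemma leftsBefore_mono {b : ℕ → Bool} (hb : Good b) : Monotone (leftsBefore b) :=
  fun _ _ h => lefts_mono b (Nat.nth_monotone hb h)

lemma lefts_succ_le_leftsBefore {b : ℕ → Bool} (hb : Good b) {j z : ℕ} (hj : b j = false)
    (hz : rights b j ≤ z) : lefts b j + 1 ≤ leftsBefore b z := by
  have h1 : j ≤ Nat.nth (fun i => b i = true) z := (Nat.count_le_iff_le_nth hb).1 hz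
  have h2 : j ≠ Nat.nth (fun i => b i = true) z := by
    intro h
    have := Nat.nth_mem_of_infinite hb z
    rw [← h, hj] at this
    exact Bool.false_ne_true this
  have h3 : lefts b (j + 1) ≤ leftsBefore b z := lefts_mono b (by omega)
  simpa [lefts, Nat.count_succ, hj] using h3

lemma leftsBefore_le_lefts {b : ℕ → Bool} {v z : ℕ} (h : z < rights b v) :
    leftsBefore b z ≤ lefts b v :=
  lefts_mono b (Nat.nth_lt_of_lt_count h).le

/-! ### The walk driven by arrow stacks -/

/-- The position of the walk in the arrow environment `e`, together with the number of earlier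
visits to every site. -/
def walkState (e : ℤ → ℕ → Bool) : ℕ → ℤ × (ℤ → ℕ)
  | 0 => (0, fun _ => 0)
  | t + 1 =>
    let s := walkState e t
    (s.1 + (if e s.1 (s.2 s.1) then 1 else -1), Function.update s.2 s.1 (s.2 s.1 + 1))

/-- The position at time `t`. -/
def pos (e : ℤ → ℕ → Bool) (t : ℕ) : ℤ := (walkState e t).1

/-- The number of visits to `x` before time `t`. -/
def visits (e : ℤ → ℕ → Bool) (t : ℕ) (x : ℤ) : ℕ := (walkState e t).2 x

/-- The number of right jumps from `x` before time `t`. -/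
def rightJumps (e : ℤ → ℕ → Bool) (t : ℕ) (x : ℤ) : ℕ := rights (e x) (visits e t x)

/-- The number of left jumps from `x` before time `t`. -/
def leftJumps (e : ℤ → ℕ → Bool) (t : ℕ) (x : ℤ) : ℕ := lefts (e x) (visits e t x)

variable {e : ℤ → ℕ → Bool}

@[simp] lemma pos_zero : pos e 0 = 0 := rfl

lemma pos_succ (t : ℕ) :
    pos e (t + 1) = pos e t + (if e (pos e t) (visits e t (pos e t)) then 1 else -1) := rfl

@[simp] lemma visits_zero (x : ℤ) : visits e 0 x = 0 := rfl

lemma visits_succ (t : ℕ) (x : ℤ) :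
    visits e (t + 1) x = visits e t x + (if pos e t = x then 1 else 0) := by
  change Function.update (walkState e t).2 (walkState e t).1
    ((walkState e t).2 (walkState e t).1 + 1) x = (walkState e t).2 x + _
  rw [Function.update_apply]
  by_cases h : x = (walkState e t).1
  · subst h; simp [pos]
  · rw [if_neg h, if_neg (show ¬pos e t = x from Ne.symm h), add_zero]

lemma visits_eq_count (t : ℕ) (x : ℤ) : visits e t x = Nat.count (fun m => pos e m = x) t := by
  induction t with
  | zero => simp
  | succ t ih => rw [visits_succ, ih, Nat.count_succ]

lemma rightJumps_succ (t : ℕ) (x : ℤ) :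
    rightJumps e (t + 1) x = rightJumps e t x +
      (if pos e t = x ∧ e x (visits e t x) = true then 1 else 0) := by
  unfold rightJumps
  rw [visits_succ]
  by_cases h : pos e t = x
  · simp [h, rights, Nat.count_succ]
  · simp [h]

lemma leftJumps_succ (t : ℕ) (x : ℤ) :
    leftJumps e (t + 1) x = leftJumps e t x +
      (if pos e t = x ∧ e x (visits e t x) = false then 1 else 0) := by
  unfold leftJumps
  rw [visits_succ]
  by_cases h : pos e t = x
  · simp [h, lefts, Nat.count_succ]
  · simp [h]

/-- Net number of crossings of the edge between `x` and `x + 1`. -/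
lemma crossing (t : ℕ) (x : ℤ) :
    (rightJumps e t x : ℤ) - leftJumps e t (x + 1) =
      (if x < pos e t then 1 else 0) - (if x < 0 then 1 else 0) := by
  induction t with
  | zero => rw [pos_zero, sub_self]; simp [rightJumps, leftJumps, rights, lefts]
  | succ t ih =>
    rw [rightJumps_succ, leftJumps_succ, pos_succ]
    push_cast
    by_cases h1 : pos e t = x
    · subst h1
      cases h : e (pos e t) (visits e t (pos e t)) <;> simp_all <;> omega
    · by_cases h2 : pos e t = x + 1
      · rw [← h2] at ih ⊢
        cases h : e (pos e t) (visits e t (pos e t)) <;> simp_all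
        split_ifs at * <;> omega
      · simp only [h1, h2, false_and, if_false]
        split_ifs at * <;> omega

lemma sum_leftJumps_succ (t : ℕ) (S : Finset ℤ) :
    ∑ x ∈ S, (leftJumps e (t + 1) x : ℤ) = ∑ x ∈ S, (leftJumps e t x : ℤ) +
      if pos e t ∈ S ∧ e (pos e t) (visits e t (pos e t)) = false then 1 else 0 := by
  have : ∑ x ∈ S, (leftJumps e (t + 1) x : ℤ) = ∑ x ∈ S, (leftJumps e t x : ℤ) +
      ∑ x ∈ S, if pos e t = x then
        (if e (pos e t) (visits e t (pos e t)) = false then (1 : ℤ) else 0) else 0 := by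
    rw [← Finset.sum_add_distrib]
    refine Finset.sum_congr rfl fun x _ => ?_
    rw [leftJumps_succ]
    by_cases h : pos e t = x
    · subst h; simp
    · simp [h]
  rw [this, Finset.sum_ite_eq, ← ite_and]

lemma pos_add_two_mul_sum_le (t : ℕ) (S : Finset ℤ) :
    pos e t + 2 * ∑ x ∈ S, (leftJumps e t x : ℤ) ≤ t := by
  induction t with
  | zero => simp [leftJumps, lefts]
  | succ t ih =>
    rw [sum_leftJumps_succ, pos_succ]
    push_cast
    cases h : e (pos e t) (visits e t (pos e t))
    · simp only [and_true, Bool.false_eq_true, if_false]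
      split_ifs <;> omega
    · simp only [Bool.true_eq_false, and_false, if_false, if_true]
      omega

lemma pos_add_two_mul_sum (t : ℕ) (S : Finset ℤ) (hS : ∀ s < t, pos e s ∈ S) :
    pos e t + 2 * ∑ x ∈ S, (leftJumps e t x : ℤ) = t := by
  induction t with
  | zero => simp [leftJumps, lefts]
  | succ t ih =>
    have ih := ih fun s hs => hS s (by omega)
    rw [sum_leftJumps_succ, pos_succ]
    push_cast
    cases h : e (pos e t) (visits e t (pos e t)) <;> simp [hS t (by omega)] <;> omega

/-- A super-solution of the branching recursion dominates the numbers of left jumps. -/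
lemma leftJumps_le_of_supersolution (he : ∀ x, Good (e x)) (D : ℤ → ℕ)
    (hD : ∀ x, leftsBefore (e x) (D (x + 1)) ≤ D x) (t : ℕ) (x : ℤ) : leftJumps e t x ≤ D x := by
  induction t generalizing x with
  | zero => simp [leftJumps, lefts]
  | succ t ih =>
    rw [leftJumps_succ]
    split_ifs with h
    · obtain ⟨rfl, h⟩ := h
      have h1 := crossing (e := e) t (pos e t)
      have h2 : rightJumps e t (pos e t) ≤ leftJumps e t (pos e t + 1) := by
        split_ifs at h1 <;> omega
      exact (lefts_succ_le_leftsBefore (he _) h (h2.trans (ih _))).trans (hD _)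
    · simpa using ih x

/-- If a super-solution vanishes at `x` then the walk never gets below `x`. -/
lemma le_pos_of_supersolution (he : ∀ x, Good (e x)) (D : ℤ → ℕ)
    (hD : ∀ x, leftsBefore (e x) (D (x + 1)) ≤ D x) {x : ℤ} (hx : x ≤ 0) (h0 : D x = 0) (t : ℕ) :
    x ≤ pos e t := by
  have h1 := leftJumps_le_of_supersolution he D hD t x
  have h2 := crossing (e := e) t (x - 1)
  rw [sub_add_cancel] at h2
  split_ifs at h2 <;> omega

/-- The branching process of left jumps, `K` generations, read at site `x`: the number of left
jumps from `x` before the walk, started at `x`, reaches `x + K`. -/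
noncomputable def branch (e : ℤ → ℕ → Bool) : ℕ → ℤ → ℕ
  | 0, _ => 0
  | K + 1, x => leftsBefore (e x) (branch e K (x + 1))

lemma branch_mono_succ (he : ∀ x, Good (e x)) (K : ℕ) (x : ℤ) :
    branch e K x ≤ branch e (K + 1) x := by
  induction K generalizing x with
  | zero => simp [branch]
  | succ K ih => exact leftsBefore_mono (he x) (ih (x + 1))

lemma branch_mono (he : ∀ x, Good (e x)) (x : ℤ) : Monotone fun K => branch e K x :=
  monotone_nat_of_le_succ fun K => branch_mono_succ he K x

lemma branch_le_leftJumps (he : ∀ x, Good (e x)) (t : ℕ) (K : ℕ) (x : ℤ) (hx : 0 ≤ x)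
    (h : x + K ≤ pos e t) : branch e K x ≤ leftJumps e t x := by
  induction K generalizing x with
  | zero => simp [branch]
  | succ K ih =>
    push_cast at h
    have h1 := ih (x + 1) (by omega) (by omega)
    have h2 := crossing (e := e) t x
    rw [if_pos (by omega), if_neg (by omega)] at h2
    calc branch e (K + 1) x ≤ leftsBefore (e x) (leftJumps e t (x + 1)) :=
          leftsBefore_mono (he x) h1
      _ ≤ leftJumps e t x := leftsBefore_le_lefts (by change _ < rightJumps e t x; omega)

end ExcitedWalk

namespace ExcitedWalk

variable {e : ℤ → ℕ → Bool}

/-- The sum of the left jumps predicted by the branching process on `[0, n)`. -/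
noncomputable def branchSum (e : ℤ → ℕ → Bool) (n : ℕ) : ℝ :=
  ∑ x ∈ Finset.range n, (branch e (n - x) x : ℝ)

lemma pos_add_two_mul_branchSum_le (he : ∀ x, Good (e x)) {t n : ℕ} (h : pos e t = n) :
    (n : ℝ) + 2 * branchSum e n ≤ t := by
  have h1 := pos_add_two_mul_sum_le (e := e) t ((Finset.range n).map Nat.castEmbedding)
  rw [Finset.sum_map, h] at h1
  have h2 : branchSum e n ≤ ∑ x ∈ Finset.range n, (leftJumps e t (x : ℤ) : ℝ) := by
    refine Finset.sum_le_sum fun x hx => ?_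
    rw [Finset.mem_range] at hx
    exact_mod_cast branch_le_leftJumps he t (n - x) x (by positivity) (by omega)
  have h3 : ((n : ℝ) + 2 * ∑ x ∈ Finset.range n, (leftJumps e t (x : ℤ) : ℝ)) ≤ t := by
    exact_mod_cast h1
  linarith

/-- If the branching sums grow faster than linearly, the walk has nonpositive upper speed. -/
lemma eventually_pos_div_le (he : ∀ x, Good (e x))
    (hS : ∀ A : ℝ, ∃ C : ℝ, ∀ n : ℕ, A * n - C ≤ branchSum e n) {ε : ℝ} (hε : 0 < ε) :
    ∀ᶠ t : ℕ in atTop, (pos e t : ℝ) / t ≤ ε := by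
  obtain ⟨C, hC⟩ := hS ε⁻¹
  filter_upwards [eventually_ge_atTop (max 1 ⌈2 * C⌉₊)] with t ht
  have ht1 : (1 : ℝ) ≤ t := by exact_mod_cast (le_max_left _ _).trans ht
  have ht2 : 2 * C ≤ t := (Nat.le_ceil _).trans (by exact_mod_cast (le_max_right _ _).trans ht)
  rw [div_le_iff₀ (by linarith)]
  rcases le_or_gt (pos e t) 0 with h | h
  · have : (pos e t : ℝ) ≤ 0 := by exact_mod_cast h
    exact this.trans (by positivity)
  · obtain ⟨n, hn⟩ := Int.eq_ofNat_of_zero_le h.le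
    have h1 := pos_add_two_mul_branchSum_le he hn
    have h2 := hC n
    rw [hn]
    have h3 : ε⁻¹ * n ≤ t := by
      have : (0 : ℝ) ≤ n := by positivity
      linarith
    rw [inv_mul_le_iff₀ hε] at h3
    exact_mod_cast h3

/-- If the branching sums have linear growth at rate `m`, the walk has speed `(1 + 2 * m)⁻¹`. -/
lemma tendsto_pos_div (he : ∀ x, Good (e x)) (D : ℤ → ℕ)
    (hD : ∀ x, leftsBefore (e x) (D (x + 1)) ≤ D x) {x₀ : ℤ} (hx : x₀ ≤ 0) (h0 : D x₀ = 0)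
    {m : ℝ} (hm : 0 ≤ m)
    (hS : ∀ ε > 0, ∃ C : ℝ, ∀ n : ℕ, (m - ε) * n - C ≤ branchSum e n)
    (hS' : ∀ ε > 0, ∃ C : ℝ, ∀ n : ℕ,
      ∑ x ∈ Finset.range n, (D x : ℝ) ≤ (m + ε) * n + C) :
    Tendsto (fun t : ℕ => (pos e t : ℝ) / t) atTop (𝓝 (1 + 2 * m)⁻¹) := by
  have upper : ∀ ε > 0, 0 < 1 + 2 * m - 2 * ε → ∃ C : ℝ, ∀ t : ℕ,
      (pos e t : ℝ) ≤ (t + C) / (1 + 2 * m - 2 * ε) := by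
    intro ε hε ha
    obtain ⟨C, hC⟩ := hS ε hε
    have hC0 : 0 ≤ C := by
      have := hC 0
      simp only [branchSum, Finset.range_zero, Finset.sum_empty] at this
      push_cast at this
      linarith
    refine ⟨2 * C, fun t => ?_⟩
    rw [le_div_iff₀ ha]
    rcases le_or_gt (pos e t) 0 with h | h
    · have : (pos e t : ℝ) ≤ 0 := by exact_mod_cast h
      have h1 : (pos e t : ℝ) * (1 + 2 * m - 2 * ε) ≤ 0 := mul_nonpos_of_nonpos_of_nonneg this ha.le
      have h2 : (0 : ℝ) ≤ t := by positivity
      linarith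
    · obtain ⟨n, hn⟩ := Int.eq_ofNat_of_zero_le h.le
      have h1 := pos_add_two_mul_branchSum_le he hn
      have h2 := hC n
      rw [hn]
      push_cast
      linarith
  have lower : ∀ ε > 0, 0 < 1 + 2 * m - 2 * ε → ∃ C : ℝ, ∀ᶠ t : ℕ in atTop,
      (t : ℝ) - 2 * (m + ε) / (1 + 2 * m - 2 * ε) * t - C ≤ pos e t := by
    intro ε hε ha
    obtain ⟨C, hC⟩ := upper ε hε ha
    obtain ⟨C', hC'⟩ := hS' ε hε
    refine ⟨2 * (∑ x ∈ Finset.Ico x₀ 0, (D x : ℝ)) + 2 * C' +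
      2 * (m + ε) * (C / (1 + 2 * m - 2 * ε) + 1), ?_⟩
    filter_upwards [eventually_ge_atTop ⌈-C⌉₊] with t ht
    have htC : 0 ≤ t + C := by
      have : -C ≤ t := (Nat.le_ceil _).trans (by exact_mod_cast ht)
      linarith
    set N : ℕ := ⌊(t + C) / (1 + 2 * m - 2 * ε)⌋₊ with hN
    have hNle : (N : ℝ) ≤ (t + C) / (1 + 2 * m - 2 * ε) := Nat.floor_le (by positivity)
    have hpath : ∀ s < t, pos e s ∈ Finset.Icc x₀ N := by
      intro s hs
      rw [Finset.mem_Icc]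
      refine ⟨le_pos_of_supersolution he D hD hx h0 s, ?_⟩
      have h1 : (pos e s : ℝ) ≤ (t + C) / (1 + 2 * m - 2 * ε) := by
        refine (hC s).trans ?_
        gcongr
      have h2 : pos e s ≤ ⌊(t + C) / (1 + 2 * m - 2 * ε)⌋ := Int.le_floor.2 h1
      rwa [hN, Int.natCast_floor_eq_floor (by positivity)]
    have h1 := pos_add_two_mul_sum t _ hpath
    have h2 : ∑ x ∈ Finset.Icc x₀ N, (leftJumps e t x : ℝ) ≤
        ∑ x ∈ Finset.Ico x₀ 0, (D x : ℝ) + ∑ x ∈ Finset.range (N + 1), (D x : ℝ) := by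
      have hsub : Finset.Icc x₀ (N : ℤ) ⊆
          Finset.Ico x₀ 0 ∪ (Finset.range (N + 1)).map Nat.castEmbedding := by
        intro x hx
        simp only [Finset.mem_Icc, Finset.mem_union, Finset.mem_Ico, Finset.mem_map,
          Finset.mem_range, Nat.castEmbedding_apply] at hx ⊢
        rcases lt_or_ge x 0 with h | h
        · exact Or.inl ⟨hx.1, h⟩
        · exact Or.inr ⟨x.toNat, by omega, by omega⟩
      calc ∑ x ∈ Finset.Icc x₀ N, (leftJumps e t x : ℝ)
          ≤ ∑ x ∈ Finset.Icc x₀ N, (D x : ℝ) := Finset.sum_le_sum fun x _ => by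
            exact_mod_cast leftJumps_le_of_supersolution he D hD t x
        _ ≤ ∑ x ∈ Finset.Ico x₀ 0 ∪ (Finset.range (N + 1)).map Nat.castEmbedding, (D x : ℝ) :=
            Finset.sum_le_sum_of_subset_of_nonneg hsub fun _ _ _ => by positivity
        _ ≤ ∑ x ∈ Finset.Ico x₀ 0, (D x : ℝ) +
            ∑ x ∈ (Finset.range (N + 1)).map Nat.castEmbedding, (D x : ℝ) := by
            rw [← Finset.sum_union_inter]
            exact le_add_of_nonneg_right (Finset.sum_nonneg fun _ _ => by positivity)
        _ = _ := by rw [Finset.sum_map]; rfl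
    have h3 := hC' (N + 1)
    have h4 : (pos e t : ℝ) + 2 * ∑ x ∈ Finset.Icc x₀ N, (leftJumps e t x : ℝ) = t := by
      exact_mod_cast h1
    have h5 : (m + ε) * ((N + 1 : ℕ) : ℝ) ≤
        (m + ε) * ((t + C) / (1 + 2 * m - 2 * ε) + 1) := by
      push_cast
      gcongr
    have h6 : (m + ε) * ((t + C) / (1 + 2 * m - 2 * ε) + 1) =
        (m + ε) / (1 + 2 * m - 2 * ε) * t + (m + ε) * (C / (1 + 2 * m - 2 * ε) + 1) := by
      field_simp
      ring
    have h7 : 2 * (m + ε) / (1 + 2 * m - 2 * ε) = 2 * ((m + ε) / (1 + 2 * m - 2 * ε)) := by ring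
    rw [h7]
    nlinarith
  have hconst : ∀ C : ℝ, Tendsto (fun t : ℕ => C / (t : ℝ)) atTop (𝓝 0) := fun C =>
    tendsto_const_div_atTop_nhds_zero_nat C
  have hpos : (1 + 2 * m) ≠ 0 := by positivity
  have small : ∀ᶠ ε : ℝ in 𝓝[>] 0, 0 < ε ∧ 0 < 1 + 2 * m - 2 * ε := by
    refine (eventually_mem_nhdsWithin).and ?_
    have : Tendsto (fun ε : ℝ => 1 + 2 * m - 2 * ε) (𝓝[>] 0) (𝓝 (1 + 2 * m - 2 * 0)) :=
      (Continuous.tendsto (by fun_prop) 0).mono_left nhdsWithin_le_nhds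
    exact this.eventually_const_lt (by linarith)
  rw [tendsto_order]
  constructor
  · intro l hl
    have h1 : Tendsto (fun ε : ℝ => 1 - 2 * (m + ε) / (1 + 2 * m - 2 * ε)) (𝓝[>] 0)
        (𝓝 (1 - 2 * (m + 0) / (1 + 2 * m - 2 * 0))) := by
      refine Tendsto.mono_left (ContinuousAt.tendsto ?_) nhdsWithin_le_nhds
      have : (1 + 2 * m - 2 * 0) ≠ 0 := by simpa using hpos
      fun_prop (disch := assumption)
    have h2 : (1 - 2 * (m + 0) / (1 + 2 * m - 2 * 0)) = (1 + 2 * m)⁻¹ := by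
      rw [add_zero, mul_zero, sub_zero]
      field_simp
      ring
    rw [h2] at h1
    obtain ⟨ε, ⟨hε, ha⟩, hlε⟩ := (small.and (h1.eventually_const_lt hl)).exists
    obtain ⟨C, hC⟩ := lower ε hε ha
    have h3 : Tendsto (fun t : ℕ => 1 - 2 * (m + ε) / (1 + 2 * m - 2 * ε) - C / (t : ℝ)) atTop
        (𝓝 (1 - 2 * (m + ε) / (1 + 2 * m - 2 * ε) - 0)) := tendsto_const_nhds.sub (hconst C)
    rw [sub_zero] at h3
    filter_upwards [hC, h3.eventually_const_lt hlε, eventually_gt_atTop 0] with t h4 h5 h6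
    refine h5.trans_le ?_
    have h6 : (0 : ℝ) < t := by exact_mod_cast h6
    rw [le_div_iff₀ h6]
    have : (1 - 2 * (m + ε) / (1 + 2 * m - 2 * ε) - C / (t : ℝ)) * t =
        (t : ℝ) - 2 * (m + ε) / (1 + 2 * m - 2 * ε) * t - C := by
      rw [sub_mul, sub_mul, div_mul_cancel₀ C h6.ne', one_mul]
    linarith
  · intro u hu
    have h1 : Tendsto (fun ε : ℝ => (1 + 2 * m - 2 * ε)⁻¹) (𝓝[>] 0)
        (𝓝 (1 + 2 * m - 2 * 0)⁻¹) := by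
      refine Tendsto.mono_left (ContinuousAt.tendsto ?_) nhdsWithin_le_nhds
      have : (1 + 2 * m - 2 * 0) ≠ 0 := by simpa using hpos
      fun_prop (disch := assumption)
    rw [mul_zero, sub_zero] at h1
    obtain ⟨ε, ⟨hε, ha⟩, hlε⟩ := (small.and (h1.eventually_lt_const hu)).exists
    obtain ⟨C, hC⟩ := upper ε hε ha
    have h3 : Tendsto (fun t : ℕ => (1 + 2 * m - 2 * ε)⁻¹ + C / (1 + 2 * m - 2 * ε) / (t : ℝ)) atTop
        (𝓝 ((1 + 2 * m - 2 * ε)⁻¹ + 0)) := tendsto_const_nhds.add (hconst _)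
    rw [add_zero] at h3
    filter_upwards [h3.eventually_lt_const hlε, eventually_gt_atTop 0] with t h5 h6
    refine lt_of_le_of_lt ?_ h5
    have h6 : (0 : ℝ) < t := by exact_mod_cast h6
    rw [div_le_iff₀ h6]
    refine (hC t).trans (le_of_eq ?_)
    field_simp

end ExcitedWalk

namespace ExcitedWalk

/-! ### The ergodic theorem -/

section Ergodic

variable {α : Type*}

/-- The maximum of the first Birkhoff sums of `g` (including the empty one). -/
noncomputable def maxSum (T : α → α) (g : α → ℝ) : ℕ → α → ℝ
  | 0, _ => 0
  | N + 1, x => max 0 (g x + maxSum T g N (T x))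

variable {T : α → α} {g : α → ℝ}

lemma maxSum_nonneg (N : ℕ) (x : α) : 0 ≤ maxSum T g N x := by
  cases N with
  | zero => exact le_rfl
  | succ N => exact le_max_left _ _

lemma maxSum_le_succ (N : ℕ) (x : α) : maxSum T g N x ≤ maxSum T g (N + 1) x := by
  induction N generalizing x with
  | zero => exact le_max_left _ _
  | succ N ih => exact max_le_max le_rfl (add_le_add le_rfl (ih (T x)))

lemma maxSum_mono (x : α) : Monotone fun N => maxSum T g N x :=
  monotone_nat_of_le_succ fun N => maxSum_le_succ N x

lemma birkhoffSum_le_maxSum (N : ℕ) (x : α) : birkhoffSum T g N x ≤ maxSum T g N x := by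
  induction N generalizing x with
  | zero => simp [maxSum]
  | succ N ih =>
    rw [birkhoffSum_succ']
    exact le_max_of_le_right (add_le_add le_rfl (ih (T x)))

variable [MeasurableSpace α] {μ : Measure α}

lemma integrable_maxSum (hT : MeasurePreserving T μ μ) (hg : Integrable g μ) (N : ℕ) :
    Integrable (maxSum T g N) μ := by
  induction N with
  | zero => exact integrable_zero _ _ _
  | succ N ih => exact (integrable_zero _ _ _).sup (hg.add (hT.integrable_comp_of_integrable ih))

lemma measurable_maxSum (hT : Measurable T) (hg : Measurable g) (N : ℕ) :
    Measurable (maxSum T g N) := by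
  induction N with
  | zero => exact measurable_const
  | succ N ih => exact measurable_const.max (hg.add (ih.comp hT))

/-- If `g` has negative mean, its Birkhoff sums are almost surely bounded above. -/
lemma ae_bddAbove_birkhoffSum [IsProbabilityMeasure μ] (hT : Ergodic T μ) (hm : Measurable g)
    (hg : Integrable g μ) (hneg : ∫ x, g x ∂μ < 0) :
    ∀ᵐ x ∂μ, ∃ C, ∀ n, birkhoffSum T g n x ≤ C := by
  set A : Set α := {x | ∀ C : ℕ, ∃ N, (C : ℝ) < maxSum T g N x} with hA
  have hAm : MeasurableSet A := by
    simp only [hA, Set.ofPred_forall, Set.ofPred_exists]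
    exact MeasurableSet.iInter fun C => MeasurableSet.iUnion fun N =>
      measurableSet_lt measurable_const (measurable_maxSum hT.measurable hm N)
  have hinv : T ⁻¹' A = A := by
    ext x
    simp only [hA, Set.mem_preimage, Set.mem_ofPred_eq]
    constructor
    · intro h C
      obtain ⟨N, hN⟩ := h ⌈C - g x⌉₊
      refine ⟨N + 1, lt_max_of_lt_right ?_⟩
      have := Nat.le_ceil (C - g x)
      linarith
    · intro h C
      obtain ⟨N, hN⟩ := h ⌈max 0 (g x + C)⌉₊
      refine ⟨N, ?_⟩
      have h1 := (Nat.le_ceil _).trans_lt (hN.trans_le (maxSum_le_succ N x))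
      have h2 : maxSum T g (N + 1) x = max 0 (g x + maxSum T g N (T x)) := rfl
      rw [h2] at h1
      by_contra h3
      exact absurd h1 (not_lt.2 (max_le_max le_rfl (by linarith [not_lt.1 h3])))
  rcases hT.ae_empty_or_univ_of_ae_le_preimage' hAm.nullMeasurableSet
    hinv.ge.eventuallyLE (measure_ne_top _ _) with h | h
  · have : ∀ᵐ x ∂μ, x ∉ A := by
      filter_upwards [h] with x hx
      intro hxA
      exact (hx.mp hxA : x ∈ (∅ : Set α))
    filter_upwards [this] with x hx
    simp only [hA, Set.mem_ofPred_eq, not_forall, not_exists, not_lt] at hx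
    obtain ⟨C, hC⟩ := hx
    exact ⟨C, fun n => (birkhoffSum_le_maxSum n x).trans (hC n)⟩
  · exfalso
    have hall : ∀ᵐ x ∂μ, x ∈ A := by
      filter_upwards [h] with x hx
      exact hx.mpr trivial
    have hlim : Tendsto (fun N => ∫ x, max (-maxSum T g N (T x)) (g x) ∂μ) atTop
        (𝓝 (∫ x, g x ∂μ)) := by
      refine tendsto_integral_of_dominated_convergence (fun x => |g x|) (fun N => ?_) hg.abs
        (fun N => ?_) ?_
      · exact (((measurable_maxSum hT.measurable hm N).comp hT.measurable).neg.max
          hm).aestronglyMeasurable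
      · refine Eventually.of_forall fun x => ?_
        rw [Real.norm_eq_abs, abs_le]
        exact ⟨(neg_abs_le _).trans (le_max_right _ _),
          max_le ((neg_nonpos.2 (maxSum_nonneg _ _)).trans (abs_nonneg _)) (le_abs_self _)⟩
      · filter_upwards [hall] with x hx
        rw [← hinv] at hx
        obtain ⟨N, hN⟩ := hx ⌈-g x⌉₊
        refine tendsto_const_nhds.congr' ?_
        filter_upwards [eventually_ge_atTop N] with n hn
        have h1 := maxSum_mono (T := T) (g := g) (T x) hn
        have h2 := Nat.le_ceil (-g x)
        rw [max_eq_right]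
        simp only at h1
        linarith
    have hge : ∀ N, 0 ≤ ∫ x, max (-maxSum T g N (T x)) (g x) ∂μ := by
      intro N
      have hi := integrable_maxSum hT.toMeasurePreserving hg
      have h1 : ∀ x, max (-maxSum T g N (T x)) (g x) =
          maxSum T g (N + 1) x - maxSum T g N (T x) := by
        intro x
        change _ = max 0 (g x + maxSum T g N (T x)) - _
        rw [← max_sub_sub_right]
        simp
      simp_rw [h1]
      have h3 : Integrable (fun x => maxSum T g N (T x)) μ :=
        hT.toMeasurePreserving.integrable_comp_of_integrable (hi N)
      rw [integral_sub (hi _) h3]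
      have h2 : ∫ x, maxSum T g N (T x) ∂μ = ∫ x, maxSum T g N x ∂μ := by
        rw [← integral_map hT.measurable.aemeasurable
          (by rw [hT.map_eq]; exact (hi N).aestronglyMeasurable), hT.map_eq]
      rw [h2, sub_nonneg]
      exact integral_mono (hi _) (hi _) fun x => maxSum_le_succ N x
    exact absurd (ge_of_tendsto' hlim hge) (not_le.2 hneg)

/-- Upper half of Birkhoff's ergodic theorem. -/
lemma ae_birkhoffSum_le [IsProbabilityMeasure μ] (hT : Ergodic T μ) (hm : Measurable g)
    (hg : Integrable g μ) :
    ∀ᵐ x ∂μ, ∀ ε > 0, ∃ C, ∀ n : ℕ, birkhoffSum T g n x ≤ (∫ x, g x ∂μ + ε) * n + C := by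
  have key : ∀ k : ℕ, ∀ᵐ x ∂μ, ∃ C, ∀ n : ℕ,
      birkhoffSum T g n x ≤ (∫ x, g x ∂μ + 1 / ((k : ℝ) + 1)) * n + C := by
    intro k
    have hk : (0 : ℝ) < 1 / ((k : ℝ) + 1) := by positivity
    have h1 := ae_bddAbove_birkhoffSum (g := fun x => g x - (∫ x, g x ∂μ + 1 / ((k : ℝ) + 1)))
      hT (hm.sub_const _) (hg.sub (integrable_const _))
      (by rw [integral_sub hg (integrable_const _)]; simp; positivity)
    filter_upwards [h1] with x ⟨C, hC⟩
    refine ⟨C, fun n => ?_⟩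
    have h2 := hC n
    simp only [birkhoffSum, Finset.sum_sub_distrib, Finset.sum_const, Finset.card_range,
      nsmul_eq_mul] at h2 ⊢
    linarith
  filter_upwards [ae_all_iff.2 key] with x hx ε hε
  obtain ⟨k, hk⟩ := exists_nat_one_div_lt hε
  obtain ⟨C, hC⟩ := hx k
  refine ⟨C, fun n => (hC n).trans ?_⟩
  gcongr

/-- Lower half of Birkhoff's ergodic theorem. -/
lemma ae_le_birkhoffSum [IsProbabilityMeasure μ] (hT : Ergodic T μ) (hm : Measurable g)
    (hg : Integrable g μ) :
    ∀ᵐ x ∂μ, ∀ ε > 0, ∃ C, ∀ n : ℕ, (∫ x, g x ∂μ - ε) * n - C ≤ birkhoffSum T g n x := by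
  filter_upwards [ae_birkhoffSum_le (g := fun x => -g x) hT hm.neg hg.neg] with x hx ε hε
  obtain ⟨C, hC⟩ := hx ε hε
  refine ⟨C, fun n => ?_⟩
  have h := hC n
  rw [integral_neg] at h
  simp only [birkhoffSum, Finset.sum_neg_distrib] at h ⊢
  linarith

end Ergodic

/-- The one-sided shift. -/
def shift {S : Type*} (ω : ℕ → S) : ℕ → S := fun n => ω (n + 1)

lemma shift_iterate {S : Type*} (n : ℕ) (ω : ℕ → S) (k : ℕ) : shift^[n] ω k = ω (k + n) := by
  induction n generalizing ω with
  | zero => rfl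
  | succ n ih => rw [Function.iterate_succ_apply, ih, shift, add_assoc]

lemma ergodic_shift {S : Type*} [MeasurableSpace S] (ν : Measure S) [IsProbabilityMeasure ν] :
    Ergodic (shift (S := S)) (Measure.infinitePi fun _ : ℕ => ν) := by
  have hmeas : Measurable (shift (S := S)) := by unfold shift; fun_prop
  refine ⟨⟨hmeas, ?_⟩, ⟨fun s hs hinv => ?_⟩⟩
  · exact Measure.map_infinitePi_infinitePi_of_inj (P := fun _ : ℕ => ν)
      (f := fun n : ℕ => n + 1) (fun a b h => Nat.succ_injective h)
  · have hindep : iIndepFun (fun (i : ℕ) (ω : ℕ → S) => ω i) (Measure.infinitePi fun _ : ℕ => ν) :=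
      iIndepFun_infinitePi (X := fun _ s => s) (fun _ => measurable_id)
    have h01 := measure_zero_or_one_of_measurableSet_limsup_atTop
      (s := fun i : ℕ => MeasurableSpace.comap (fun ω : ℕ → S => ω i) inferInstance)
      (fun i => (measurable_pi_apply i).comap_le) hindep (t := s) ?_
    · rcases h01 with h | h
      · exact eventuallyConst_set'.2 (Or.inl (ae_eq_empty.2 h))
      · refine eventuallyConst_set'.2 (Or.inr (ae_eq_univ.2 ?_))
        rwa [prob_compl_eq_zero_iff hs]
    · rw [limsup_eq_iInf_iSup_of_nat, MeasurableSpace.measurableSet_iInf]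
      intro n
      have hs' : s = shift^[n] ⁻¹' s := by
        induction n with
        | zero => rfl
        | succ n ih => rw [Function.iterate_succ', Set.preimage_comp, hinv, ← ih]
      rw [hs']
      have : Measurable[⨆ i, ⨆ (_ : i ≥ n),
          MeasurableSpace.comap (fun ω : ℕ → S => ω i) inferInstance] (shift (S := S))^[n] := by
        refine @measurable_pi_lambda _ _ _ (_) _ _ fun k => ?_
        simp_rw [shift_iterate]
        refine Measurable.of_comap_le ?_
        exact le_iSup₂_of_le (k + n) (Nat.le_add_left n k) le_rfl
      exact this hs

end ExcitedWalk

namespace ExcitedWalk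

open scoped ENNReal

/-! ### The law of a stack of independent arrows -/

/-- The law of a stack of independent arrows, the `j`-th one pointing right with probability
`q j`. -/
noncomputable def stackLaw (q : ℕ → unitInterval) : Measure (ℕ → Bool) :=
  Measure.infinitePi fun j => bernoulliMeasure true false (q j)

instance (q : ℕ → unitInterval) : IsProbabilityMeasure (stackLaw q) := by
  unfold stackLaw; infer_instance

/-- The stack with first arrow `a` followed by the stack `b`. -/
def cons (a : Bool) (b : ℕ → Bool) : ℕ → Bool
  | 0 => a
  | n + 1 => b n

lemma measurable_cons : Measurable fun x : Bool × (ℕ → Bool) => cons x.1 x.2 := by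
  refine measurable_pi_lambda _ fun n => ?_
  cases n with
  | zero => exact measurable_fst
  | succ n => exact (measurable_pi_apply n).comp measurable_snd

lemma map_cons (q : ℕ → unitInterval) :
    ((bernoulliMeasure true false (q 0)).prod (stackLaw (shift q))).map
      (fun x => cons x.1 x.2) = stackLaw q := by
  refine Measure.eq_infinitePi _ fun s t ht => ?_
  classical
  obtain ⟨n, hn⟩ : ∃ n, s ⊆ Finset.range (n + 1) :=
    ⟨s.sup id, fun i hi => Finset.mem_range_succ_iff.2 (Finset.le_sup (f := id) hi)⟩
  set t' : ℕ → Set Bool := fun i => if i ∈ s then t i else Set.univ with ht'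
  have h1 : (s : Set ℕ).pi t = (Finset.range (n + 1) : Set ℕ).pi t' := by
    ext b
    simp only [Set.mem_pi, Finset.mem_coe, ht']
    constructor
    · intro h i _
      split_ifs with his
      · exact h i his
      · trivial
    · intro h i hi
      have := h i (hn hi)
      rwa [if_pos hi] at this
  have h2 : ∏ i ∈ s, bernoulliMeasure true false (q i) (t i) =
      ∏ i ∈ Finset.range (n + 1), bernoulliMeasure true false (q i) (t' i) := by
    rw [← Finset.prod_subset hn]
    · exact Finset.prod_congr rfl fun i hi => by simp [ht', hi]
    · intro i _ hi
      simp [ht', hi]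
  have h3 : (fun x : Bool × (ℕ → Bool) => cons x.1 x.2) ⁻¹'
      ((Finset.range (n + 1) : Set ℕ).pi t') =
      t' 0 ×ˢ (Finset.range n : Set ℕ).pi fun i => t' (i + 1) := by
    ext ⟨a, b⟩
    simp only [Set.mem_preimage, Set.mem_pi, Finset.mem_coe, Finset.mem_range, Set.mem_prod]
    constructor
    · intro h
      exact ⟨h 0 (by omega), fun i hi => h (i + 1) (by omega)⟩
    · rintro ⟨h, h'⟩ i hi
      cases i with
      | zero => exact h
      | succ i => exact h' i (by omega)
  have hm : MeasurableSet ((Finset.range (n + 1) : Set ℕ).pi t') :=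
    MeasurableSet.pi (Finset.countable_toSet _) fun i _ => MeasurableSet.of_discrete
  rw [h1, h2, Measure.map_apply measurable_cons hm, h3, Measure.prod_prod, stackLaw,
    Measure.infinitePi_pi _ fun i _ => MeasurableSet.of_discrete, Finset.prod_range_succ', mul_comm]
  rfl

lemma lintegral_stackLaw (q : ℕ → unitInterval) {f : (ℕ → Bool) → ℝ≥0∞} (hf : Measurable f) :
    ∫⁻ b, f b ∂stackLaw q =
      ENNReal.ofReal (q 0) * ∫⁻ b, f (cons true b) ∂stackLaw (shift q) +
      ENNReal.ofReal (1 - q 0) * ∫⁻ b, f (cons false b) ∂stackLaw (shift q) := by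
  have h : Measurable fun x : Bool × (ℕ → Bool) => f (cons x.1 x.2) := hf.comp measurable_cons
  rw [← map_cons, lintegral_map hf measurable_cons, lintegral_prod _ h.aemeasurable]
  rw [bernoulliMeasure_def, lintegral_add_measure, lintegral_smul_measure, lintegral_smul_measure,
    lintegral_dirac, lintegral_dirac]
  congr 1
  · congr 1
    exact (Real.toNNReal_of_nonneg (q 0).2.1).symm
  · congr 1
    exact (Real.toNNReal_of_nonneg (unitInterval.symm (q 0)).2.1).symm

lemma ae_infinite_stackLaw {q : ℕ → unitInterval} {M : ℕ} (hq : ∀ j ≥ M, (q j : ℝ) = 1 / 2) :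
    ∀ᵐ b ∂stackLaw q, Good b := by
  have hb : ∀ n, Measurable fun b : ℕ → Bool => b n := measurable_pi_apply
  have hm : ∀ n, MeasurableSet {b : ℕ → Bool | b n = true} := fun n =>
    hb n (measurableSet_singleton true)
  have hval : ∀ n, stackLaw q {b | b n = true} = bernoulliMeasure true false (q n) {true} := by
    intro n
    have h2 := Measure.infinitePi_pi (fun j => bernoulliMeasure true false (q j)) (s := {n})
      (t := fun _ => {true}) (fun _ _ => measurableSet_singleton _)
    rw [Finset.prod_singleton] at h2
    rw [← h2, stackLaw]
    congr 1
    ext b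
    simp
  have hset : iIndepSet (fun n => {b : ℕ → Bool | b n = true}) (stackLaw q) := by
    rw [iIndepSet_iff_meas_biInter hm]
    intro s
    simp_rw [hval]
    rw [← Measure.infinitePi_pi (fun j => bernoulliMeasure true false (q j)) (s := s)
      (t := fun _ => {true}) (fun _ _ => measurableSet_singleton _), stackLaw]
    congr 1
    ext b
    simp
  have hsum : ∑' n, stackLaw q {b | b n = true} = ∞ := by
    refine top_unique ?_
    calc (∞ : ℝ≥0∞) = ∑' _ : ℕ, ENNReal.ofReal (1 / 2) := by
          rw [ENNReal.tsum_const_eq_top_of_ne_zero (by simp)]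
      _ ≤ ∑' n, stackLaw q {b | b (n + M) = true} := by
          refine ENNReal.tsum_le_tsum fun n => ?_
          rw [hval, bernoulliMeasure_apply_of_mem_of_notMem _ (measurableSet_singleton _) (by simp)
            (by simp), ← hq (n + M) (by omega)]
          exact (congrArg _ (Real.toNNReal_of_nonneg (q (n + M)).2.1)).le
      _ ≤ _ := ENNReal.tsum_comp_le_tsum_of_injective (add_left_injective M) _
  have h := measure_limsup_eq_one hm hset hsum
  have h' : ∀ᵐ b ∂stackLaw q, b ∈ limsup (fun n => {b : ℕ → Bool | b n = true}) atTop := by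
    refine (mem_ae_iff_prob_eq_one ?_).2 h
    exact MeasurableSet.measurableSet_limsup hm
  filter_upwards [h'] with b hb
  rw [mem_limsup_iff_frequently_mem] at hb
  exact Nat.frequently_atTop_iff_infinite.1 hb

/-- The number of left arrows preceding the `r`-th right arrow of the stack `b`
(`0` if `r = 0`). -/
noncomputable def leftsTo (b : ℕ → Bool) : ℕ → ℕ
  | 0 => 0
  | r + 1 => leftsBefore b r

lemma leftsBefore_eq {b : ℕ → Bool} {k z : ℕ} (hk : b k = true) (hz : rights b k = z) :
    leftsBefore b z = lefts b k := by
  subst hz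
  unfold leftsBefore rights
  rw [Nat.nth_count (p := fun i => b i = true) hk]

lemma rights_cons (a : Bool) (b : ℕ → Bool) (k : ℕ) :
    rights (cons a b) (k + 1) = rights b k + if a then 1 else 0 :=
  Nat.count_succ' _ k

lemma lefts_cons (a : Bool) (b : ℕ → Bool) (k : ℕ) :
    lefts (cons a b) (k + 1) = lefts b k + if a = false then 1 else 0 :=
  Nat.count_succ' _ k

lemma leftsTo_cons_true {b : ℕ → Bool} (hb : Good b) (r : ℕ) :
    leftsTo (cons true b) (r + 1) = leftsTo b r := by
  cases r with
  | zero => exact leftsBefore_eq (k := 0) rfl rfl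
  | succ r =>
    have h1 : b (Nat.nth (fun i => b i = true) r) = true := Nat.nth_mem_of_infinite hb r
    have h2 : rights b (Nat.nth (fun i => b i = true) r) = r := Nat.count_nth_of_infinite hb r
    refine (leftsBefore_eq (k := Nat.nth (fun i => b i = true) r + 1) h1 ?_).trans ?_
    · simp [rights_cons, h2]
    · simp [lefts_cons, leftsTo, leftsBefore]

lemma leftsTo_cons_false {b : ℕ → Bool} (hb : Good b) (r : ℕ) :
    leftsTo (cons false b) (r + 1) = leftsTo b (r + 1) + 1 := by
  have h1 : b (Nat.nth (fun i => b i = true) r) = true := Nat.nth_mem_of_infinite hb r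
  have h2 : rights b (Nat.nth (fun i => b i = true) r) = r := Nat.count_nth_of_infinite hb r
  refine (leftsBefore_eq (k := Nat.nth (fun i => b i = true) r + 1) h1 ?_).trans ?_
  · simp [rights_cons, h2]
  · simp [lefts_cons, leftsTo, leftsBefore]

lemma measurable_leftsBefore (z : ℕ) : Measurable fun b => leftsBefore b z := by
  have hb : ∀ n, Measurable fun b : ℕ → Bool => b n := measurable_pi_apply
  have hc : ∀ k, Measurable fun b => rights b k := by
    intro k
    unfold rights
    simp_rw [Nat.count_eq_card_filter_range, Finset.card_filter]
    refine Finset.measurable_sum _ fun i _ => Measurable.ite ?_ measurable_const measurable_const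
    exact hb i (measurableSet_singleton true)
  have hl : ∀ k, Measurable fun b => lefts b k := by
    intro k
    unfold lefts
    simp_rw [Nat.count_eq_card_filter_range, Finset.card_filter]
    refine Finset.measurable_sum _ fun i _ => Measurable.ite ?_ measurable_const measurable_const
    exact hb i (measurableSet_singleton false)
  have hE : ∀ k, MeasurableSet {b : ℕ → Bool | b k = true ∧ rights b k = z} := fun k =>
    (hb k (measurableSet_singleton true)).inter (hc k (measurableSet_singleton z))
  refine measurable_to_countable' fun n => ?_
  have : (fun b => leftsBefore b z) ⁻¹' {n} =
      (⋃ k, {b | b k = true ∧ rights b k = z} ∩ {b | lefts b k = n}) ∪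
      ((⋂ k, {b | b k = true ∧ rights b k = z}ᶜ) ∩ {_b | n = 0}) := by
    ext b
    simp only [Set.mem_preimage, Set.mem_singleton_iff, Set.mem_union, Set.mem_iUnion,
      Set.mem_inter_iff, Set.mem_iInter, Set.mem_compl_iff, Set.mem_ofPred_eq]
    by_cases h : ∃ k, b k = true ∧ rights b k = z
    · obtain ⟨k, hk, hk'⟩ := h
      constructor
      · intro h
        exact Or.inl ⟨k, ⟨hk, hk'⟩, by rw [← leftsBefore_eq hk hk', h]⟩
      · rintro (⟨j, ⟨hj, hj'⟩, h⟩ | ⟨h, -⟩)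
        · rw [leftsBefore_eq hj hj', h]
        · exact absurd ⟨hk, hk'⟩ (h k)
    · have h0 : Nat.nth (fun i => b i = true) z = 0 := by
        by_contra hne
        refine h ⟨Nat.nth (fun i => b i = true) z, ?_, ?_⟩
        · exact Nat.nth_mem z fun hf => by
            by_contra hlt
            exact hne (Nat.nth_of_card_le hf (not_lt.1 hlt))
        · exact Nat.count_nth fun hf => by
            by_contra hlt
            exact hne (Nat.nth_of_card_le hf (not_lt.1 hlt))
      have h1 : leftsBefore b z = 0 := by unfold leftsBefore; rw [h0]; rfl
      rw [h1]
      push Not at h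
      constructor
      · intro h2
        exact Or.inr ⟨fun k hk => h k hk.1 hk.2, h2.symm⟩
      · rintro (⟨j, ⟨hj, hj'⟩, -⟩ | ⟨-, h2⟩)
        · exact absurd hj' (h j hj)
        · exact h2.symm
  rw [this]
  refine MeasurableSet.union (MeasurableSet.iUnion fun k => (hE k).inter
    (hl k (measurableSet_singleton n))) ((MeasurableSet.iInter fun k => (hE k).compl).inter
    (MeasurableSet.const _))

lemma measurable_leftsTo (r : ℕ) : Measurable fun b => leftsTo b r := by
  cases r with
  | zero => exact measurable_const
  | succ r => exact measurable_leftsBefore r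

/-- The law of the number of left arrows preceding the `r`-th right arrow. -/
noncomputable def leftsLaw (q : ℕ → unitInterval) (r : ℕ) : Measure ℕ :=
  (stackLaw q).map fun b => leftsTo b r

instance (q : ℕ → unitInterval) (r : ℕ) : IsProbabilityMeasure (leftsLaw q r) :=
  Measure.isProbabilityMeasure_map (measurable_leftsTo r).aemeasurable

lemma leftsLaw_zero (q : ℕ → unitInterval) : leftsLaw q 0 = Measure.dirac 0 := by
  simp [leftsLaw, leftsTo, Measure.map_const]

lemma lintegral_leftsLaw_succ {q : ℕ → unitInterval} {M : ℕ} (hq : ∀ j ≥ M, (q j : ℝ) = 1 / 2)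
    (r : ℕ) (φ : ℕ → ℝ≥0∞) :
    ∫⁻ n, φ n ∂leftsLaw q (r + 1) =
      ENNReal.ofReal (q 0) * ∫⁻ n, φ n ∂leftsLaw (shift q) r +
      ENNReal.ofReal (1 - q 0) * ∫⁻ n, φ (n + 1) ∂leftsLaw (shift q) (r + 1) := by
  have hφ : ∀ ψ : ℕ → ℝ≥0∞, Measurable ψ := fun _ => measurable_of_countable _
  have hgood : ∀ᵐ b ∂stackLaw (shift q), Good b :=
    ae_infinite_stackLaw (M := M) fun j hj => hq (j + 1) (by omega)
  simp only [leftsLaw]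
  rw [lintegral_map (hφ _) (measurable_leftsTo _), lintegral_map (hφ _) (measurable_leftsTo _),
    lintegral_map (hφ fun n => φ (n + 1)) (measurable_leftsTo _),
    lintegral_stackLaw q (f := fun b => φ (leftsTo b (r + 1)))
      ((hφ φ).comp (measurable_leftsTo (r + 1)))]
  congr 2
  · refine lintegral_congr_ae ?_
    filter_upwards [hgood] with b hb
    simp only [leftsTo_cons_true hb]
  · refine lintegral_congr_ae ?_
    filter_upwards [hgood] with b hb
    simp only [leftsTo_cons_false hb]

end ExcitedWalk

namespace ExcitedWalk

open scoped ENNReal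

/-! ### Moments of the number of left arrows before the `r`-th right arrow -/

variable {q : ℕ → unitInterval} {M : ℕ}

lemma shift_eq_self (hq : ∀ j ≥ 0, (q j : ℝ) = 1 / 2) : shift q = q := by
  funext j
  exact Subtype.ext ((hq (j + 1) (by omega)).trans (hq j (by omega)).symm)

lemma lintegral_truncated_exp_le (hq : ∀ j ≥ 0, (q j : ℝ) = 1 / 2) (N r : ℕ) :
    ∫⁻ n, (3 / 2) ^ min n N ∂leftsLaw q r ≤ (2 : ℝ≥0∞) ^ r := by
  induction r with
  | zero => rw [leftsLaw_zero, lintegral_dirac]; simp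
  | succ r ih =>
    have h := lintegral_leftsLaw_succ hq r fun n => (3 / 2 : ℝ≥0∞) ^ min n N
    have h12 : (1 : ℝ≥0∞) ≤ 3 / 2 := by
      rw [ENNReal.le_div_iff_mul_le (by simp) (by simp)]; norm_num
    have htop : (3 / 2 : ℝ≥0∞) ≠ ∞ := ENNReal.div_ne_top (by simp) (by simp)
    have hle : ∫⁻ n, (3 / 2 : ℝ≥0∞) ^ min (n + 1) N ∂leftsLaw q (r + 1) ≤
        3 / 2 * ∫⁻ n, (3 / 2 : ℝ≥0∞) ^ min n N ∂leftsLaw q (r + 1) := by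
      rw [← lintegral_const_mul _ (measurable_of_countable _)]
      refine lintegral_mono fun n => ?_
      rw [← pow_succ']
      exact pow_le_pow_right₀ h12 (by omega)
    have hfin : ∫⁻ n, (3 / 2 : ℝ≥0∞) ^ min n N ∂leftsLaw q (r + 1) ≠ ∞ := by
      refine ne_top_of_le_ne_top (ENNReal.pow_ne_top htop (n := N)) ?_
      calc _ ≤ ∫⁻ _, (3 / 2 : ℝ≥0∞) ^ N ∂leftsLaw q (r + 1) :=
            lintegral_mono fun n => pow_le_pow_right₀ h12 (min_le_right _ _)
        _ = _ := by simp
    rw [shift_eq_self hq, hq 0 le_rfl] at h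
    set u := ∫⁻ n, (3 / 2 : ℝ≥0∞) ^ min n N ∂leftsLaw q (r + 1) with hu
    have h1 : u ≤ ENNReal.ofReal (1 / 2) * 2 ^ r + ENNReal.ofReal (1 - 1 / 2) * (3 / 2 * u) := by
      calc u = _ := h
        _ ≤ _ := by gcongr
    clear_value u
    lift u to NNReal using hfin
    have h32 : (3 / 2 : ℝ≥0∞) = ENNReal.ofReal (3 / 2) := by
      rw [ENNReal.ofReal_div_of_pos (by norm_num)]; norm_num
    have h2 : (2 : ℝ≥0∞) ^ r = ENNReal.ofReal (2 ^ r) := by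
      rw [ENNReal.ofReal_pow (by norm_num)]; norm_num
    have h3 : (u : ℝ≥0∞) = ENNReal.ofReal u := by simp
    have h2' : (2 : ℝ≥0∞) ^ (r + 1) = ENNReal.ofReal (2 ^ (r + 1)) := by
      rw [ENNReal.ofReal_pow (by norm_num)]; norm_num
    rw [h32, h2, h3, ← ENNReal.ofReal_mul (by norm_num), ← ENNReal.ofReal_mul (by norm_num),
      ← ENNReal.ofReal_mul (by norm_num), ← ENNReal.ofReal_add (by positivity) (by positivity),
      ENNReal.ofReal_le_ofReal_iff (by positivity)] at h1
    rw [h3, h2', ENNReal.ofReal_le_ofReal_iff (by positivity), pow_succ]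
    linarith

lemma lintegral_exp_ne_top (hq : ∀ j ≥ M, (q j : ℝ) = 1 / 2) (r : ℕ) :
    ∫⁻ n, (3 / 2 : ℝ≥0∞) ^ n ∂leftsLaw q r ≠ ∞ := by
  have h12 : (1 : ℝ≥0∞) ≤ 3 / 2 := by
    rw [ENNReal.le_div_iff_mul_le (by simp) (by simp)]; norm_num
  induction M generalizing q r with
  | zero =>
    have h : ∀ n, (3 / 2 : ℝ≥0∞) ^ n = ⨆ N, (3 / 2 : ℝ≥0∞) ^ min n N := by
      intro n
      refine le_antisymm (le_iSup_of_le n (by simp)) (iSup_le fun N => ?_)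
      exact pow_le_pow_right₀ h12 (min_le_left _ _)
    rw [lintegral_congr h, lintegral_iSup (f := fun N n : ℕ => (3 / 2 : ℝ≥0∞) ^ min n N)
      (fun _ => measurable_of_countable _)
      (fun a b hab n => pow_le_pow_right₀ h12 (min_le_min_left _ hab))]
    exact ne_top_of_le_ne_top (ENNReal.pow_ne_top (n := r) ENNReal.ofNat_ne_top)
      (iSup_le fun N => lintegral_truncated_exp_le hq N r)
  | succ M ih =>
    have hq' : ∀ j ≥ M, ((shift q j : unitInterval) : ℝ) = 1 / 2 :=
      fun j hj => hq (j + 1) (by omega)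
    cases r with
    | zero => rw [leftsLaw_zero, lintegral_dirac]; simp
    | succ r =>
      rw [lintegral_leftsLaw_succ hq r]
      simp_rw [pow_succ]
      rw [lintegral_mul_const _ (measurable_of_countable _)]
      exact ENNReal.add_ne_top.2 ⟨ENNReal.mul_ne_top ENNReal.ofReal_ne_top (ih hq' r),
        ENNReal.mul_ne_top ENNReal.ofReal_ne_top (ENNReal.mul_ne_top (ih hq' (r + 1))
          (ENNReal.div_ne_top (by simp) (by simp)))⟩

lemma integrable_cube_leftsLaw (hq : ∀ j ≥ M, (q j : ℝ) = 1 / 2) (r : ℕ) :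
    Integrable (fun n : ℕ => (n : ℝ) ^ 3) (leftsLaw q r) := by
  have h1 : Integrable (fun n : ℕ => (3 / 2 : ℝ) ^ n) (leftsLaw q r) := by
    refine ⟨(measurable_of_countable _).aestronglyMeasurable, ?_⟩
    rw [hasFiniteIntegral_iff_ofReal (ae_of_all _ fun n => by positivity)]
    refine lt_of_le_of_lt (le_of_eq ?_) (lintegral_exp_ne_top hq r).lt_top
    refine lintegral_congr fun n => ?_
    rw [ENNReal.ofReal_pow (by norm_num), ENNReal.ofReal_div_of_pos (by norm_num)]
    norm_num
  obtain ⟨C, hC⟩ := (tendsto_pow_const_div_const_pow_of_one_lt 3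
    (show (1 : ℝ) < 3 / 2 by norm_num)).bddAbove_range
  refine (h1.const_mul C).mono' (measurable_of_countable _).aestronglyMeasurable
    (ae_of_all _ fun n => ?_)
  have h2 := hC ⟨n, rfl⟩
  rw [Real.norm_of_nonneg (by positivity)]
  simp only at h2
  rwa [div_le_iff₀ (by positivity)] at h2

/-- A function on `ℕ` with at most cubic growth is integrable against every measure with finite
third moment. -/
lemma integrable_of_cubic {μ : Measure ℕ} [IsFiniteMeasure μ]
    (hμ : Integrable (fun n : ℕ => (n : ℝ) ^ 3) μ) {φ : ℕ → ℝ} (C : ℝ)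
    (hφ : ∀ n : ℕ, |φ n| ≤ C * ((n : ℝ) ^ 3 + 1)) : Integrable φ μ :=
  ((hμ.add (integrable_const 1)).const_mul C).mono' (measurable_of_countable _).aestronglyMeasurable
    (ae_of_all _ fun n => by simpa using hφ n)

lemma integrable_pow_of_cubic {μ : Measure ℕ} [IsFiniteMeasure μ]
    (hμ : Integrable (fun n : ℕ => (n : ℝ) ^ 3) μ) {k : ℕ} (hk : k ≤ 3) :
    Integrable (fun n : ℕ => (n : ℝ) ^ k) μ := by
  refine integrable_of_cubic hμ 1 fun n => ?_
  rw [abs_of_nonneg (by positivity), one_mul]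
  rcases Nat.eq_zero_or_pos n with rfl | hn
  · rcases Nat.eq_zero_or_pos k with rfl | hk
    · simp
    · simp [hk.ne']
  · have : (1 : ℝ) ≤ n := by exact_mod_cast hn
    linarith [pow_le_pow_right₀ this hk]

lemma leftsLaw_succ (hq : ∀ j ≥ M, (q j : ℝ) = 1 / 2) (r : ℕ) :
    leftsLaw q (r + 1) = ENNReal.ofReal (q 0) • leftsLaw (shift q) r +
      ENNReal.ofReal (1 - q 0) • (leftsLaw (shift q) (r + 1)).map (· + 1) := by
  refine Measure.ext_of_lintegral _ fun φ hφ => ?_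
  rw [lintegral_leftsLaw_succ hq, lintegral_add_measure, lintegral_smul_measure,
    lintegral_smul_measure, lintegral_map hφ (measurable_of_countable _)]
  rfl

lemma integral_leftsLaw_succ (hq : ∀ j ≥ M, (q j : ℝ) = 1 / 2) (r : ℕ) {φ : ℕ → ℝ}
    (h1 : Integrable φ (leftsLaw (shift q) r))
    (h2 : Integrable (fun n => φ (n + 1)) (leftsLaw (shift q) (r + 1))) :
    ∫ n, φ n ∂leftsLaw q (r + 1) = q 0 * ∫ n, φ n ∂leftsLaw (shift q) r +
      (1 - q 0) * ∫ n, φ (n + 1) ∂leftsLaw (shift q) (r + 1) := by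
  have hm : Measurable fun n : ℕ => n + 1 := measurable_of_countable _
  have hφ : ∀ μ : Measure ℕ, AEStronglyMeasurable φ μ := fun _ =>
    (measurable_of_countable _).aestronglyMeasurable
  rw [leftsLaw_succ hq, integral_add_measure (h1.smul_measure ENNReal.ofReal_ne_top)
    (((integrable_map_measure (hφ _) hm.aemeasurable).2 h2).smul_measure ENNReal.ofReal_ne_top),
    integral_smul_measure, integral_smul_measure, integral_map hm.aemeasurable (hφ _),
    ENNReal.toReal_ofReal (q 0).2.1, ENNReal.toReal_ofReal (by linarith [(q 0).2.2])]
  rfl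

lemma moment_leftsLaw_zero {k : ℕ} (hk : k ≠ 0) :
    ∫ n : ℕ, (n : ℝ) ^ k ∂leftsLaw q 0 = 0 := by
  rw [leftsLaw_zero, integral_dirac]; simp [hk]

lemma first_moment_leftsLaw_succ (hq : ∀ j ≥ M, (q j : ℝ) = 1 / 2) (r : ℕ) :
    ∫ n : ℕ, (n : ℝ) ^ 1 ∂leftsLaw q (r + 1) = q 0 * ∫ n : ℕ, (n : ℝ) ^ 1 ∂leftsLaw (shift q) r +
      (1 - q 0) * (∫ n : ℕ, (n : ℝ) ^ 1 ∂leftsLaw (shift q) (r + 1) + 1) := by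
  have hI : ∀ r, ∀ k ≤ 3, Integrable (fun n : ℕ => (n : ℝ) ^ k) (leftsLaw (shift q) r) :=
    fun r k hk => integrable_pow_of_cubic
      (integrable_cube_leftsLaw (M := M) (fun j hj => hq (j + 1) (by omega)) r) hk
  have hexp : (fun n : ℕ => (((n + 1 : ℕ) : ℝ)) ^ 1) = fun n : ℕ => (n : ℝ) ^ 1 + 1 := by
    funext n; push_cast; ring
  have h2 := (hI (r + 1) 1 (by norm_num)).add (integrable_const (1 : ℝ))
  rw [integral_leftsLaw_succ hq r (hI r 1 (by norm_num)) (by rw [hexp]; exact h2), hexp,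
    integral_add (hI (r + 1) 1 (by norm_num)) (integrable_const _)]
  simp

lemma second_moment_leftsLaw_succ (hq : ∀ j ≥ M, (q j : ℝ) = 1 / 2) (r : ℕ) :
    ∫ n : ℕ, (n : ℝ) ^ 2 ∂leftsLaw q (r + 1) = q 0 * ∫ n : ℕ, (n : ℝ) ^ 2 ∂leftsLaw (shift q) r +
      (1 - q 0) * (∫ n : ℕ, (n : ℝ) ^ 2 ∂leftsLaw (shift q) (r + 1) +
        2 * ∫ n : ℕ, (n : ℝ) ^ 1 ∂leftsLaw (shift q) (r + 1) + 1) := by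
  have hI : ∀ r, ∀ k ≤ 3, Integrable (fun n : ℕ => (n : ℝ) ^ k) (leftsLaw (shift q) r) :=
    fun r k hk => integrable_pow_of_cubic
      (integrable_cube_leftsLaw (M := M) (fun j hj => hq (j + 1) (by omega)) r) hk
  have hexp : (fun n : ℕ => (((n + 1 : ℕ) : ℝ)) ^ 2) =
      fun n : ℕ => ((n : ℝ) ^ 2 + 2 * (n : ℝ) ^ 1) + 1 := by
    funext n; push_cast; ring
  have h2 := (hI (r + 1) 2 (by norm_num)).add ((hI (r + 1) 1 (by norm_num)).const_mul 2)
  have h3 := h2.add (integrable_const (1 : ℝ))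
  rw [integral_leftsLaw_succ hq r (hI r 2 (by norm_num)) (by rw [hexp]; exact h3), hexp,
    integral_add (by exact h2) (integrable_const _),
    integral_add (hI (r + 1) 2 (by norm_num)) ((hI (r + 1) 1 (by norm_num)).const_mul 2),
    integral_const_mul]
  simp

lemma third_moment_leftsLaw_succ (hq : ∀ j ≥ M, (q j : ℝ) = 1 / 2) (r : ℕ) :
    ∫ n : ℕ, (n : ℝ) ^ 3 ∂leftsLaw q (r + 1) = q 0 * ∫ n : ℕ, (n : ℝ) ^ 3 ∂leftsLaw (shift q) r +
      (1 - q 0) * (∫ n : ℕ, (n : ℝ) ^ 3 ∂leftsLaw (shift q) (r + 1) +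
        3 * ∫ n : ℕ, (n : ℝ) ^ 2 ∂leftsLaw (shift q) (r + 1) +
        3 * ∫ n : ℕ, (n : ℝ) ^ 1 ∂leftsLaw (shift q) (r + 1) + 1) := by
  have hI : ∀ r, ∀ k ≤ 3, Integrable (fun n : ℕ => (n : ℝ) ^ k) (leftsLaw (shift q) r) :=
    fun r k hk => integrable_pow_of_cubic
      (integrable_cube_leftsLaw (M := M) (fun j hj => hq (j + 1) (by omega)) r) hk
  have hexp : (fun n : ℕ => (((n + 1 : ℕ) : ℝ)) ^ 3) =
      fun n : ℕ => (((n : ℝ) ^ 3 + 3 * (n : ℝ) ^ 2) + 3 * (n : ℝ) ^ 1) + 1 := by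
    funext n; push_cast; ring
  have h1 := (hI (r + 1) 3 (by norm_num)).add ((hI (r + 1) 2 (by norm_num)).const_mul 3)
  have h2 := h1.add ((hI (r + 1) 1 (by norm_num)).const_mul 3)
  have h3 := h2.add (integrable_const (1 : ℝ))
  rw [integral_leftsLaw_succ hq r (hI r 3 (by norm_num)) (by rw [hexp]; exact h3), hexp,
    integral_add (by exact h2) (integrable_const _),
    integral_add (by exact h1) ((hI (r + 1) 1 (by norm_num)).const_mul 3),
    integral_add (hI (r + 1) 3 (by norm_num)) ((hI (r + 1) 2 (by norm_num)).const_mul 3),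
    integral_const_mul, integral_const_mul]
  simp

lemma first_moment_leftsLaw (hq : ∀ j ≥ M, (q j : ℝ) = 1 / 2) {r : ℕ} (hr : M ≤ r) :
    ∫ n : ℕ, (n : ℝ) ^ 1 ∂leftsLaw q r = r - ∑ j ∈ Finset.range M, (2 * (q j : ℝ) - 1) := by
  induction M generalizing q r with
  | zero =>
    induction r with
    | zero => rw [moment_leftsLaw_zero one_ne_zero]; simp
    | succ r ih =>
      have h := first_moment_leftsLaw_succ hq r
      rw [shift_eq_self hq, hq 0 le_rfl, ih (by omega)] at h
      push_cast
      simp only [Finset.range_zero, Finset.sum_empty] at h ⊢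
      linarith
  | succ M ih =>
    have hq' : ∀ j ≥ M, ((shift q j : unitInterval) : ℝ) = 1 / 2 :=
      fun j hj => hq (j + 1) (by omega)
    obtain ⟨s, rfl⟩ : ∃ s, r = s + 1 := ⟨r - 1, by omega⟩
    rw [first_moment_leftsLaw_succ hq, ih hq' (by omega), ih hq' (by omega),
      Finset.sum_range_succ']
    simp only [shift]
    push_cast
    ring

lemma second_moment_leftsLaw (hq : ∀ j ≥ M, (q j : ℝ) = 1 / 2) :
    ∃ c : ℝ, ∀ r ≥ M, ∫ n : ℕ, (n : ℝ) ^ 2 ∂leftsLaw q r =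
      (r : ℝ) ^ 2 + (2 - 2 * ∑ j ∈ Finset.range M, (2 * (q j : ℝ) - 1)) * r + c := by
  induction M generalizing q with
  | zero =>
    refine ⟨0, fun r _ => ?_⟩
    induction r with
    | zero => rw [moment_leftsLaw_zero two_ne_zero]; simp
    | succ r ih =>
      have h := second_moment_leftsLaw_succ hq r
      rw [shift_eq_self hq, hq 0 le_rfl, ih (by omega), first_moment_leftsLaw hq (by omega)] at h
      push_cast at h ⊢
      simp only [Finset.range_zero, Finset.sum_empty] at h ⊢
      linarith
  | succ M ih =>
    have hq' : ∀ j ≥ M, ((shift q j : unitInterval) : ℝ) = 1 / 2 :=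
      fun j hj => hq (j + 1) (by omega)
    obtain ⟨c, hc⟩ := ih hq'
    set Δ := ∑ j ∈ Finset.range M, (2 * ((shift q j : unitInterval) : ℝ) - 1) with hΔ
    refine ⟨c + (1 - q 0) * (6 - 4 * Δ) - 1 + 2 * Δ - 4 * (1 - q 0), fun r hr => ?_⟩
    obtain ⟨s, rfl⟩ : ∃ s, r = s + 1 := ⟨r - 1, by omega⟩
    have hsum : ∑ j ∈ Finset.range (M + 1), (2 * (q j : ℝ) - 1) = Δ + (2 * q 0 - 1) :=
      Finset.sum_range_succ' _ _
    rw [second_moment_leftsLaw_succ hq, hc _ (by omega), hc _ (by omega),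
      first_moment_leftsLaw hq' (by omega), hsum, ← hΔ]
    push_cast
    ring

lemma third_moment_leftsLaw (hq : ∀ j ≥ M, (q j : ℝ) = 1 / 2) :
    ∃ α β γ : ℝ, ∀ r ≥ M, ∫ n : ℕ, (n : ℝ) ^ 3 ∂leftsLaw q r =
      (r : ℝ) ^ 3 + α * (r : ℝ) ^ 2 + β * r + γ := by
  induction M generalizing q with
  | zero =>
    refine ⟨6, 6, 0, fun r _ => ?_⟩
    induction r with
    | zero => rw [moment_leftsLaw_zero three_ne_zero]; simp
    | succ r ih =>
      have h := third_moment_leftsLaw_succ hq r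
      have h2 : ∀ r : ℕ, ∫ n : ℕ, (n : ℝ) ^ 2 ∂leftsLaw q r = (r : ℝ) ^ 2 + 2 * r := by
        obtain ⟨c, hc⟩ := second_moment_leftsLaw hq
        have h0 := hc 0 le_rfl
        rw [moment_leftsLaw_zero two_ne_zero] at h0
        intro r
        rw [hc r (by omega)]
        simp only [Finset.range_zero, Finset.sum_empty] at h0 ⊢
        push_cast at h0
        linarith
      rw [shift_eq_self hq, hq 0 le_rfl, ih (by omega), first_moment_leftsLaw hq (by omega),
        h2] at h
      push_cast at h ⊢
      simp only [Finset.range_zero, Finset.sum_empty] at h ⊢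
      linarith
  | succ M ih =>
    have hq' : ∀ j ≥ M, ((shift q j : unitInterval) : ℝ) = 1 / 2 :=
      fun j hj => hq (j + 1) (by omega)
    obtain ⟨α, β, γ, h3⟩ := ih hq'
    obtain ⟨c, hc⟩ := second_moment_leftsLaw hq'
    set Δ := ∑ j ∈ Finset.range M, (2 * ((shift q j : unitInterval) : ℝ) - 1) with hΔ
    refine ⟨α - 3 * q 0 + 3 * (1 - q 0),
      q 0 * (3 - 2 * α + β) + (1 - q 0) * (β + 9 - 6 * Δ),
      q 0 * (-1 + α - β + γ) + (1 - q 0) * (γ + 3 * c - 3 * Δ + 1), fun r hr => ?_⟩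
    obtain ⟨s, rfl⟩ : ∃ s, r = s + 1 := ⟨r - 1, by omega⟩
    rw [third_moment_leftsLaw_succ hq, hc _ (by omega), h3 _ (by omega), h3 _ (by omega),
      first_moment_leftsLaw hq' (by omega), ← hΔ]
    push_cast
    ring

end ExcitedWalk

namespace ExcitedWalk

open scoped ENNReal

/-! ### The random environment and the law of the branching process -/

variable {q : ℕ → unitInterval} {M : ℕ}

/-- The law of the environment: independent stacks at all sites. -/
noncomputable def envLaw (q : ℕ → unitInterval) : Measure (ℤ → ℕ → Bool) :=
  Measure.infinitePi fun _ => stackLaw q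

instance (q : ℕ → unitInterval) : IsProbabilityMeasure (envLaw q) := by
  unfold envLaw; infer_instance

lemma map_envLaw {ι : Type*} {f : ι → ℤ} (hf : Function.Injective f) :
    (envLaw q).map (fun e i => e (f i)) = Measure.infinitePi fun _ => stackLaw q :=
  Measure.map_infinitePi_infinitePi_of_inj (P := fun _ : ℤ => stackLaw q) hf

lemma measurePreserving_translate (q : ℕ → unitInterval) (x : ℤ) :
    MeasurePreserving (fun (e : ℤ → ℕ → Bool) y => e (y + x)) (envLaw q) (envLaw q) :=
  ⟨by fun_prop, map_envLaw (add_left_injective x)⟩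

lemma measurable_update_fst {ι S : Type*} [DecidableEq ι] [MeasurableSpace S] (x : ι) :
    Measurable fun u : S × (ι → S) => Function.update u.2 x u.1 := by
  refine measurable_pi_lambda _ fun y => ?_
  by_cases h : y = x
  · subst h; simpa using measurable_fst
  · simp only [Function.update_of_ne h]
    fun_prop

/-- Resampling one coordinate does not change the law of an independent family. -/
lemma map_update_infinitePi {ι S : Type*} [DecidableEq ι] [MeasurableSpace S] (μ : ι → Measure S)
    [∀ i, IsProbabilityMeasure (μ i)] (x : ι) :
    ((μ x).prod (Measure.infinitePi μ)).map (fun u => Function.update u.2 x u.1) =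
      Measure.infinitePi μ := by
  refine Measure.eq_infinitePi _ fun s t ht => ?_
  have hm : MeasurableSet ((s : Set ι).pi t) :=
    MeasurableSet.pi (Finset.countable_toSet _) fun i _ => ht i
  rw [Measure.map_apply (measurable_update_fst x) hm]
  by_cases hx : x ∈ s
  · have h : (fun u : S × (ι → S) => Function.update u.2 x u.1) ⁻¹' (s : Set ι).pi t
        = t x ×ˢ ((s.erase x : Finset ι) : Set ι).pi t := by
      ext ⟨b, e⟩
      simp only [Set.mem_preimage, Set.mem_pi, Finset.mem_coe, Set.mem_prod, Finset.mem_erase]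
      constructor
      · intro h
        refine ⟨by simpa using h x hx, fun y hy => by simpa [hy.1] using h y hy.2⟩
      · rintro ⟨h1, h2⟩ y hy
        by_cases hyx : y = x
        · subst hyx; simpa using h1
        · simpa [hyx] using h2 y ⟨hyx, hy⟩
    rw [h, Measure.prod_prod, Measure.infinitePi_pi _ fun i _ => ht i,
      Finset.mul_prod_erase s (fun i => μ i (t i)) hx]
  · have h : (fun u : S × (ι → S) => Function.update u.2 x u.1) ⁻¹' (s : Set ι).pi t
        = Set.univ ×ˢ (s : Set ι).pi t := by
      ext ⟨b, e⟩
      simp only [Set.mem_preimage, Set.mem_pi, Finset.mem_coe, Set.mem_prod, Set.mem_univ, true_and]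
      refine forall₂_congr fun y hy => ?_
      have hyx : y ≠ x := by rintro rfl; exact hx hy
      rw [Function.update_of_ne hyx]
    rw [h, Measure.prod_prod, measure_univ, one_mul, Measure.infinitePi_pi _ fun i _ => ht i]

lemma map_update_envLaw (q : ℕ → unitInterval) (x : ℤ) :
    ((stackLaw q).prod (envLaw q)).map (fun u => Function.update u.2 x u.1) = envLaw q :=
  map_update_infinitePi (fun _ : ℤ => stackLaw q) x

lemma ae_good_envLaw (hq : ∀ j ≥ M, (q j : ℝ) = 1 / 2) :
    ∀ᵐ e ∂envLaw q, ∀ x, Good (e x) := by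
  rw [ae_all_iff]
  intro x
  exact (measurePreserving_eval_infinitePi (fun _ : ℤ => stackLaw q) x).quasiMeasurePreserving.ae
    (ae_infinite_stackLaw hq)

lemma measurable_leftsBefore_uncurry :
    Measurable fun u : (ℕ → Bool) × ℕ => leftsBefore u.1 u.2 :=
  measurable_from_prod_countable_left measurable_leftsBefore

lemma measurable_branch (K : ℕ) (x : ℤ) : Measurable fun e => branch e K x := by
  induction K generalizing x with
  | zero => exact measurable_const
  | succ K ih => exact measurable_leftsBefore_uncurry.comp ((measurable_pi_apply x).prodMk (ih _))

lemma branch_congr {e e' : ℤ → ℕ → Bool} {x : ℤ} (h : ∀ y ≥ x, e y = e' y) (K : ℕ) :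
    branch e K x = branch e' K x := by
  induction K generalizing x with
  | zero => rfl
  | succ K ih =>
    simp only [branch]
    rw [h x le_rfl, ih fun y hy => h y (by omega)]

lemma branch_translate (e : ℤ → ℕ → Bool) (K : ℕ) (x y : ℤ) :
    branch (fun z => e (z + y)) K x = branch e K (x + y) := by
  induction K generalizing x with
  | zero => rfl
  | succ K ih => simp only [branch]; rw [ih, add_right_comm]

/-- The law of the branching process after `K` generations. -/
noncomputable def branchLaw (q : ℕ → unitInterval) (K : ℕ) : Measure ℕ :=
  (envLaw q).map fun e => branch e K 0

instance (q : ℕ → unitInterval) (K : ℕ) : IsProbabilityMeasure (branchLaw q K) :=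
  Measure.isProbabilityMeasure_map (measurable_branch K 0).aemeasurable

lemma branchLaw_zero (q : ℕ → unitInterval) : branchLaw q 0 = Measure.dirac 0 := by
  simp [branchLaw, branch, Measure.map_const]

lemma map_branch (q : ℕ → unitInterval) (K : ℕ) (x : ℤ) :
    (envLaw q).map (fun e => branch e K x) = branchLaw q K := by
  rw [branchLaw]
  conv_lhs => rw [← zero_add x]
  simp_rw [← branch_translate]
  conv_rhs => rw [← (measurePreserving_translate q x).map_eq]
  rw [Measure.map_map (measurable_branch K 0) (by fun_prop)]
  rfl

lemma branchLaw_succ (q : ℕ → unitInterval) (K : ℕ) :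
    branchLaw q (K + 1) =
      ((stackLaw q).prod (branchLaw q K)).map fun u => leftsBefore u.1 u.2 := by
  rw [← map_branch q K (0 + 1)]
  conv_rhs => rw [← Measure.map_id (μ := stackLaw q)]
  rw [Measure.map_prod_map _ _ measurable_id (measurable_branch _ _),
    Measure.map_map measurable_leftsBefore_uncurry
      (measurable_id.prodMap (measurable_branch _ _)), branchLaw]
  conv_lhs => rw [← map_update_envLaw q 0]
  rw [Measure.map_map (measurable_branch _ _) (measurable_update_fst 0)]
  congr 1
  funext u
  simp only [Function.comp, Prod.map, branch, id]
  rw [branch_congr (e := Function.update u.2 0 u.1) (e' := u.2), Function.update_self]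
  intro y hy
  rw [Function.update_of_ne (by omega)]

lemma lintegral_branchLaw_succ (q : ℕ → unitInterval) (K : ℕ) (φ : ℕ → ℝ≥0∞) :
    ∫⁻ n, φ n ∂branchLaw q (K + 1) = ∫⁻ z, ∫⁻ n, φ n ∂leftsLaw q (z + 1) ∂branchLaw q K := by
  have hφ : Measurable φ := measurable_of_countable _
  rw [branchLaw_succ, lintegral_map hφ measurable_leftsBefore_uncurry, lintegral_prod_symm
    (fun u : (ℕ → Bool) × ℕ => φ (leftsBefore u.1 u.2))
    (hφ.comp measurable_leftsBefore_uncurry).aemeasurable]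
  refine lintegral_congr fun z => ?_
  rw [leftsLaw, lintegral_map hφ (measurable_leftsTo _)]
  rfl

lemma integral_branchLaw_succ (q : ℕ → unitInterval) (K : ℕ) {φ : ℕ → ℝ}
    (hφ : Integrable φ (branchLaw q (K + 1))) :
    ∫ n, φ n ∂branchLaw q (K + 1) = ∫ z, ∫ n, φ n ∂leftsLaw q (z + 1) ∂branchLaw q K := by
  have hm : ∀ μ : Measure ℕ, AEStronglyMeasurable φ μ := fun _ =>
    (measurable_of_countable _).aestronglyMeasurable
  rw [branchLaw_succ] at hφ ⊢
  rw [integral_map measurable_leftsBefore_uncurry.aemeasurable (hm _), integral_prod_symm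
    (fun u : (ℕ → Bool) × ℕ => φ (leftsBefore u.1 u.2))
    ((integrable_map_measure (hm _) measurable_leftsBefore_uncurry.aemeasurable).1 hφ)]
  refine integral_congr_ae (ae_of_all _ fun z => ?_)
  simp only [leftsLaw]
  rw [integral_map (measurable_leftsTo _).aemeasurable (hm _)]
  rfl

/-- A sequence that is eventually dominated by `g ≥ 0` is dominated by `g + C`. -/
lemma exists_forall_le_add {f g : ℕ → ℝ} {N : ℕ} (hg : ∀ n, 0 ≤ g n) (h : ∀ n ≥ N, f n ≤ g n) :
    ∃ C ≥ 0, ∀ n, f n ≤ g n + C := by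
  refine ⟨∑ n ∈ Finset.range N, |f n|, by positivity, fun n => ?_⟩
  by_cases hn : n < N
  · have := Finset.single_le_sum (f := fun n => |f n|) (fun i _ => abs_nonneg _)
      (Finset.mem_range.2 hn)
    linarith [le_abs_self (f n), hg n]
  · have : 0 ≤ ∑ n ∈ Finset.range N, |f n| := by positivity
    linarith [h n (not_lt.1 hn)]

lemma exists_second_moment_le (hq : ∀ j ≥ M, (q j : ℝ) = 1 / 2) :
    ∃ C ≥ 0, ∀ z : ℕ, ∫ n : ℕ, (n : ℝ) ^ 2 ∂leftsLaw q (z + 1) ≤ (z : ℝ) ^ 2 + C * (z + 1) := by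
  obtain ⟨c, hc⟩ := second_moment_leftsLaw hq
  set Δ := ∑ j ∈ Finset.range M, (2 * (q j : ℝ) - 1)
  obtain ⟨C, hC, h⟩ := exists_forall_le_add (N := M)
    (f := fun z => ∫ n : ℕ, (n : ℝ) ^ 2 ∂leftsLaw q (z + 1))
    (g := fun z => (z : ℝ) ^ 2 + (4 + 2 * |Δ| + |c|) * (z + 1)) (fun z => by positivity) (by
      intro z hz
      rw [hc (z + 1) (by omega)]
      push_cast
      have hz0 : (0 : ℝ) ≤ z := by positivity
      nlinarith [neg_abs_le Δ, le_abs_self c, abs_nonneg c, mul_nonneg (abs_nonneg c) hz0,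
        mul_le_mul_of_nonneg_right (neg_abs_le Δ) hz0])
  refine ⟨4 + 2 * |Δ| + |c| + C, by positivity, fun z => (h z).trans ?_⟩
  have hz0 : (0 : ℝ) ≤ z := by positivity
  nlinarith [mul_nonneg hC hz0]

lemma exists_third_moment_le (hq : ∀ j ≥ M, (q j : ℝ) = 1 / 2) :
    ∃ C ≥ 0, ∀ z : ℕ,
      ∫ n : ℕ, (n : ℝ) ^ 3 ∂leftsLaw q (z + 1) ≤ (z : ℝ) ^ 3 + C * ((z : ℝ) ^ 2 + 1) := by
  obtain ⟨α, β, γ, hc⟩ := third_moment_leftsLaw hq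
  obtain ⟨C, hC, h⟩ := exists_forall_le_add (N := M)
    (f := fun z => ∫ n : ℕ, (n : ℝ) ^ 3 ∂leftsLaw q (z + 1))
    (g := fun z => (z : ℝ) ^ 3 + (3 + |α| + |3 + 2 * α + β| + |1 + α + β + γ|) * ((z : ℝ) ^ 2 + 1))
    (fun z => by positivity) (by
      intro z hz
      rw [hc (z + 1) (by omega)]
      push_cast
      have hz0 : (0 : ℝ) ≤ (z : ℝ) ^ 2 := by positivity
      have h1 : (3 + 2 * α + β) * z ≤ |3 + 2 * α + β| * ((z : ℝ) ^ 2 + 1) := by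
        have h2 : (z : ℝ) ≤ (z : ℝ) ^ 2 + 1 := by nlinarith [sq_nonneg ((z : ℝ) - 1)]
        calc _ ≤ |3 + 2 * α + β| * z :=
              mul_le_mul_of_nonneg_right (le_abs_self _) (Nat.cast_nonneg z)
          _ ≤ _ := mul_le_mul_of_nonneg_left h2 (abs_nonneg _)
      nlinarith [mul_le_mul_of_nonneg_right (le_abs_self α) hz0, abs_nonneg α,
        le_abs_self (1 + α + β + γ), mul_nonneg (abs_nonneg (1 + α + β + γ)) hz0])
  refine ⟨3 + |α| + |3 + 2 * α + β| + |1 + α + β + γ| + C, by positivity, fun z => (h z).trans ?_⟩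
  have hz0 : (0 : ℝ) ≤ (z : ℝ) ^ 2 := by positivity
  nlinarith [mul_nonneg hC hz0]

lemma integrable_cube_branchLaw (hq : ∀ j ≥ M, (q j : ℝ) = 1 / 2) (K : ℕ) :
    Integrable (fun n : ℕ => (n : ℝ) ^ 3) (branchLaw q K) := by
  induction K with
  | zero => rw [branchLaw_zero]; exact integrable_dirac (by simp)
  | succ K ih =>
    obtain ⟨C, hC, h⟩ := exists_third_moment_le hq
    refine ⟨(measurable_of_countable _).aestronglyMeasurable, ?_⟩
    rw [hasFiniteIntegral_iff_ofReal (ae_of_all _ fun n => by positivity),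
      lintegral_branchLaw_succ]
    have hI : Integrable (fun z : ℕ => (z : ℝ) ^ 3 + C * ((z : ℝ) ^ 2 + 1)) (branchLaw q K) :=
      ih.add (((integrable_pow_of_cubic ih (by norm_num)).add (integrable_const 1)).const_mul C)
    have hfin := hI.2
    rw [hasFiniteIntegral_iff_ofReal (ae_of_all _ fun n => by positivity)] at hfin
    refine lt_of_le_of_lt (lintegral_mono fun z => ?_) hfin
    rw [← ofReal_integral_eq_lintegral_ofReal (integrable_cube_leftsLaw hq _)
      (ae_of_all _ fun n => by positivity)]
    exact ENNReal.ofReal_le_ofReal (h z)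

/-- The law of the branching process is stochastically increasing. -/
lemma integral_branchLaw_mono (hq : ∀ j ≥ M, (q j : ℝ) = 1 / 2) {φ : ℕ → ℝ} (hφ : Monotone φ)
    (hI : ∀ K, Integrable φ (branchLaw q K)) :
    Monotone fun K => ∫ n, φ n ∂branchLaw q K := by
  intro K L hKL
  have hm : ∀ μ : Measure ℕ, AEStronglyMeasurable φ μ := fun _ =>
    (measurable_of_countable _).aestronglyMeasurable
  have hI' : ∀ K, Integrable (fun e => φ (branch e K 0)) (envLaw q) := fun K =>
    (integrable_map_measure (hm _) (measurable_branch K 0).aemeasurable).1 (hI K)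
  simp only [branchLaw]
  rw [integral_map (measurable_branch _ _).aemeasurable (hm _),
    integral_map (measurable_branch _ _).aemeasurable (hm _)]
  refine integral_mono_ae (hI' K) (hI' L) ?_
  filter_upwards [ae_good_envLaw hq] with e he
  exact hφ (branch_mono he 0 hKL)

end ExcitedWalk

namespace ExcitedWalk

open scoped ENNReal

/-! ### Boundedness of the mean of the branching process -/

variable {q : ℕ → unitInterval} {M : ℕ}

/-- The mean of the branching process after `K` generations. -/
noncomputable def branchMean (q : ℕ → unitInterval) (K : ℕ) : ℝ := ∫ n : ℕ, (n : ℝ) ∂branchLaw q K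

lemma integrable_pow_branchLaw (hq : ∀ j ≥ M, (q j : ℝ) = 1 / 2) (K : ℕ) {k : ℕ} (hk : k ≤ 3) :
    Integrable (fun n : ℕ => (n : ℝ) ^ k) (branchLaw q K) :=
  integrable_pow_of_cubic (integrable_cube_branchLaw hq K) hk

lemma integrable_branchLaw (hq : ∀ j ≥ M, (q j : ℝ) = 1 / 2) (K : ℕ) :
    Integrable (fun n : ℕ => (n : ℝ)) (branchLaw q K) := by
  simpa using integrable_pow_branchLaw hq K (k := 1) (by norm_num)

lemma integrable_pow_leftsLaw (hq : ∀ j ≥ M, (q j : ℝ) = 1 / 2) (r : ℕ) {k : ℕ} (hk : k ≤ 3) :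
    Integrable (fun n : ℕ => (n : ℝ) ^ k) (leftsLaw q r) :=
  integrable_pow_of_cubic (integrable_cube_leftsLaw hq r) hk

lemma branchMean_mono (hq : ∀ j ≥ M, (q j : ℝ) = 1 / 2) : Monotone (branchMean q) :=
  integral_branchLaw_mono hq Nat.mono_cast (integrable_branchLaw hq)

lemma branchMean_nonneg (K : ℕ) : 0 ≤ branchMean q K :=
  integral_nonneg fun n => Nat.cast_nonneg n

/-- A one-step inequality for the branching mechanism integrates to an inequality between
expectations of consecutive generations. -/
lemma integral_branchLaw_succ_le {K : ℕ} {φ ψ : ℕ → ℝ} (hφ : Integrable φ (branchLaw q (K + 1)))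
    (hφ0 : ∀ n, 0 ≤ φ n) (hψ : Integrable ψ (branchLaw q K))
    (h : ∀ z, ∫ n, φ n ∂leftsLaw q (z + 1) ≤ ψ z) :
    ∫ n, φ n ∂branchLaw q (K + 1) ≤ ∫ z, ψ z ∂branchLaw q K := by
  rw [integral_branchLaw_succ q K hφ]
  exact integral_mono_of_nonneg (ae_of_all _ fun z => integral_nonneg hφ0) hψ (ae_of_all _ h)

lemma integral_pow_two_branchLaw_zero : ∫ n : ℕ, (n : ℝ) ^ 2 ∂branchLaw q 0 = 0 := by
  rw [branchLaw_zero, integral_dirac]; simp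

lemma exists_branchMean_le (hq : ∀ j ≥ M, (q j : ℝ) = 1 / 2)
    (hδ : 2 < ∑ j ∈ Finset.range M, (2 * (q j : ℝ) - 1)) : ∃ B, ∀ K, branchMean q K ≤ B := by
  obtain ⟨c, hc⟩ := second_moment_leftsLaw hq
  set δ := ∑ j ∈ Finset.range M, (2 * (q j : ℝ) - 1)
  obtain ⟨C, hC, h⟩ := exists_forall_le_add (N := M)
    (f := fun z => ∫ n : ℕ, (n : ℝ) ^ 2 ∂leftsLaw q (z + 1) + (2 * δ - 4) * z - (z : ℝ) ^ 2)
    (g := fun _ => |3 - 2 * δ + c|) (fun z => abs_nonneg _) (by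
      intro z hz
      rw [hc (z + 1) (by omega)]
      push_cast
      linarith [le_abs_self (3 - 2 * δ + c)])
  set C' := |3 - 2 * δ + c| + C with hC'
  have hC0 : 0 ≤ C' := by positivity
  have hstep : ∀ K, ∫ n : ℕ, (n : ℝ) ^ 2 ∂branchLaw q (K + 1) + (2 * δ - 4) * branchMean q K ≤
      ∫ n : ℕ, (n : ℝ) ^ 2 ∂branchLaw q K + C' := by
    intro K
    have h2 := integrable_pow_branchLaw hq K (k := 2) (by norm_num)
    have h1 := (integrable_branchLaw hq K).const_mul (2 * δ - 4)
    have := integral_branchLaw_succ_le (K := K) (φ := fun n : ℕ => (n : ℝ) ^ 2)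
      (ψ := fun z : ℕ => (z : ℝ) ^ 2 - (2 * δ - 4) * z + C')
      (integrable_pow_branchLaw hq (K + 1) (by norm_num)) (fun n => by positivity)
      ((h2.sub h1).add (integrable_const _)) (fun z => by linarith [h z])
    rw [integral_add (by exact h2.sub h1) (integrable_const _), integral_sub h2 h1,
      integral_const_mul] at this
    simp only [integral_const, probReal_univ, smul_eq_mul, one_mul] at this
    unfold branchMean
    linarith
  have hsum : ∀ K : ℕ, ∫ n : ℕ, (n : ℝ) ^ 2 ∂branchLaw q K +
      (2 * δ - 4) * ∑ k ∈ Finset.range K, branchMean q k ≤ C' * K := by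
    intro K
    induction K with
    | zero => rw [integral_pow_two_branchLaw_zero]; simp
    | succ K ih =>
      rw [Finset.sum_range_succ, mul_add]
      push_cast
      linarith [hstep K]
  refine ⟨2 * C' / (2 * δ - 4), fun K => ?_⟩
  rw [le_div_iff₀ (by linarith)]
  rcases Nat.eq_zero_or_pos K with rfl | hK
  · have : branchMean q 0 = 0 := by unfold branchMean; rw [branchLaw_zero, integral_dirac]; simp
    rw [this]; linarith
  have h3 : (K : ℝ) * branchMean q K ≤ ∑ k ∈ Finset.range (K + K), branchMean q k := by
    rw [Finset.sum_range_add]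
    have h4 : (K : ℝ) * branchMean q K ≤ ∑ k ∈ Finset.range K, branchMean q (K + k) := by
      calc (K : ℝ) * branchMean q K = ∑ k ∈ Finset.range K, branchMean q K := by simp
        _ ≤ _ := Finset.sum_le_sum fun k _ => branchMean_mono hq (Nat.le_add_right K k)
    have h5 : 0 ≤ ∑ k ∈ Finset.range K, branchMean q k :=
      Finset.sum_nonneg fun k _ => branchMean_nonneg k
    linarith
  have h4 := hsum (K + K)
  have h5 : 0 ≤ ∫ n : ℕ, (n : ℝ) ^ 2 ∂branchLaw q (K + K) := integral_nonneg fun n => by positivity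
  have hKpos : (0 : ℝ) < K := by exact_mod_cast hK
  push_cast at h4
  have h6 : (2 * δ - 4) * ((K : ℝ) * branchMean q K) ≤ C' * (K + K) :=
    le_trans (mul_le_mul_of_nonneg_left h3 (by linarith)) (by linarith)
  refine le_of_mul_le_mul_left (a := (K : ℝ)) ?_ hKpos
  linarith

lemma leftsLaw_Ici_pos (hq : ∀ j ≥ M, (q j : ℝ) = 1 / 2) (hq1 : ∀ j, (q j : ℝ) < 1) (r N : ℕ) :
    0 < leftsLaw q (r + 1) (Set.Ici N) := by
  induction N generalizing q with
  | zero => simp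
  | succ N ih =>
    have h := ih (q := shift q) (fun j hj => hq (j + 1) (by omega)) fun j => hq1 (j + 1)
    rw [leftsLaw_succ hq, Measure.add_apply, Measure.smul_apply, Measure.smul_apply,
      Measure.map_apply (measurable_of_countable _) measurableSet_Ici]
    have h2 : (fun n => n + 1) ⁻¹' Set.Ici (N + 1) = Set.Ici N := by ext n; simp
    rw [h2]
    refine lt_of_lt_of_le (ENNReal.mul_pos ?_ h.ne') le_add_self
    simpa using hq1 0

lemma leftsLaw_zero_pos (hq : ∀ j ≥ M, (q j : ℝ) = 1 / 2) (hq0 : ∀ j, 0 < (q j : ℝ)) (r : ℕ) :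
    0 < leftsLaw q r {0} := by
  induction r generalizing q with
  | zero => rw [leftsLaw_zero]; simp
  | succ r ih =>
    have h := ih (q := shift q) (fun j hj => hq (j + 1) (by omega)) fun j => hq0 (j + 1)
    rw [leftsLaw_succ hq, Measure.add_apply, Measure.smul_apply]
    refine lt_of_lt_of_le (ENNReal.mul_pos ?_ h.ne') le_self_add
    simpa using hq0 0

lemma branchLaw_one (q : ℕ → unitInterval) : branchLaw q 1 = leftsLaw q 1 := by
  refine Measure.ext_of_lintegral _ fun φ hφ => ?_
  rw [← zero_add 1, lintegral_branchLaw_succ, branchLaw_zero, lintegral_dirac]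

/-- If `δ ≤ 2`, the second moment of the branching process grows at least linearly. -/
lemma exists_mul_le_second_moment (hq : ∀ j ≥ M, (q j : ℝ) = 1 / 2) (hq1 : ∀ j, (q j : ℝ) < 1)
    (hδ : ∑ j ∈ Finset.range M, (2 * (q j : ℝ) - 1) ≤ 2) :
    ∃ a > 0, ∀ K : ℕ, a * K ≤ ∫ n : ℕ, (n : ℝ) ^ 2 ∂branchLaw q (K + 1) := by
  obtain ⟨c, hc⟩ := second_moment_leftsLaw hq
  have hfirst : ∀ r ≥ M, _ := fun r hr => first_moment_leftsLaw hq (r := r) hr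
  set δ := ∑ j ∈ Finset.range M, (2 * (q j : ℝ) - 1)
  obtain ⟨κ, hκ⟩ : ∃ κ : ℕ, (M : ℝ) + |3 - 2 * δ + c| + 1 ≤ κ := exists_nat_ge _
  set f : ℕ → ℝ := fun n => max ((n : ℝ) ^ 2 - κ * n) 0 with hf
  set g : ℕ → ℝ := (Set.Ici κ).indicator 1 with hg
  have hfle : ∀ n, f n ≤ (n : ℝ) ^ 2 := fun n =>
    max_le (by have : (0 : ℝ) ≤ κ * n := by positivity
               linarith) (by positivity)
  have hf0 : ∀ n, 0 ≤ f n := fun n => le_max_right _ _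
  have hfI : ∀ K, Integrable f (branchLaw q K) := fun K =>
    (integrable_pow_branchLaw hq K (k := 2) (by norm_num)).mono'
      (measurable_of_countable _).aestronglyMeasurable
      (ae_of_all _ fun n => by rw [Real.norm_of_nonneg (hf0 n)]; exact hfle n)
  have hgI : ∀ μ : Measure ℕ, IsFiniteMeasure μ → Integrable g μ := fun μ _ =>
    (integrable_const 1).indicator measurableSet_Ici
  have hgm : Monotone g := by
    intro m n hmn
    by_cases h : κ ≤ m
    · simp [hg, h, h.trans hmn]
    · simp only [hg, Set.indicator, Set.mem_Ici, h, if_false]; split_ifs <;> simp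
  have hdrift : ∀ z, f z + g z ≤ ∫ n, f n ∂leftsLaw q (z + 1) := by
    intro z
    by_cases hz : κ ≤ z
    · have hz' : (κ : ℝ) ≤ z := by exact_mod_cast hz
      have hMz : M ≤ z + 1 := by
        have : (M : ℝ) ≤ z := by linarith [abs_nonneg (3 - 2 * δ + c)]
        have : M ≤ z := by exact_mod_cast this
        omega
      have h2 := integrable_pow_leftsLaw hq (z + 1) (k := 2) (by norm_num)
      have h1 := (integrable_pow_leftsLaw hq (z + 1) (k := 1) (by norm_num)).const_mul (κ : ℝ)
      have hlow : ∫ n : ℕ, ((n : ℝ) ^ 2 - κ * (n : ℝ) ^ 1) ∂leftsLaw q (z + 1) ≤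
          ∫ n, f n ∂leftsLaw q (z + 1) := by
        refine integral_mono (h2.sub h1) (h2.mono' (measurable_of_countable _).aestronglyMeasurable
          (ae_of_all _ fun n => by rw [Real.norm_of_nonneg (hf0 n)]; exact hfle n)) fun n => ?_
        simp only [pow_one]
        exact le_max_left _ _
      rw [integral_sub h2 h1, integral_const_mul, hc _ hMz, hfirst _ hMz] at hlow
      have hgz : g z = 1 := by simp [hg, hz]
      have hfz : f z = (z : ℝ) ^ 2 - κ * z := max_eq_left (by nlinarith)
      rw [hgz, hfz]
      refine le_trans ?_ hlow
      push_cast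
      have h5 : (0 : ℝ) ≤ (2 - δ) * (z - κ) := mul_nonneg (by linarith) (by linarith)
      have h6 : (0 : ℝ) ≤ (2 - δ) * κ := mul_nonneg (by linarith) (by positivity)
      have h7 : (0 : ℝ) ≤ M := by positivity
      nlinarith [neg_abs_le (3 - 2 * δ + c)]
    · have hz' : (z : ℝ) < κ := by exact_mod_cast not_le.1 hz
      have hgz : g z = 0 := by simp [hg, hz]
      have hfz : f z = 0 := max_eq_right (by nlinarith [(Nat.cast_nonneg z : (0 : ℝ) ≤ z)])
      rw [hgz, hfz, add_zero]
      exact integral_nonneg hf0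
  set a := ∫ n, g n ∂branchLaw q 1 with ha
  have hapos : 0 < a := by
    rw [ha, hg, integral_indicator_one measurableSet_Ici, branchLaw_one]
    exact ENNReal.toReal_pos (leftsLaw_Ici_pos hq hq1 0 κ).ne' (measure_ne_top _ _)
  refine ⟨a, hapos, fun K => ?_⟩
  have key : ∀ K : ℕ, a * K ≤ ∫ n, f n ∂branchLaw q (K + 1) := by
    intro K
    induction K with
    | zero => simpa using integral_nonneg hf0
    | succ K ih =>
      have h1 : a ≤ ∫ n, g n ∂branchLaw q (K + 1) :=
        integral_branchLaw_mono hq hgm (fun K => hgI _ inferInstance) (by omega : 1 ≤ K + 1)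
      have h2 : ∫ n, f n ∂branchLaw q (K + 1) + ∫ n, g n ∂branchLaw q (K + 1) ≤
          ∫ n, f n ∂branchLaw q (K + 1 + 1) := by
        rw [← integral_add (hfI _) (hgI _ inferInstance), integral_branchLaw_succ q _ (hfI _)]
        refine integral_mono_of_nonneg (ae_of_all _ fun z => ?_) ?_ (ae_of_all _ hdrift)
        · exact add_nonneg (hf0 z) (Set.indicator_nonneg (fun _ _ => zero_le_one) _)
        · obtain ⟨C, hC, hC'⟩ := exists_second_moment_le hq
          refine integrable_of_cubic (integrable_cube_branchLaw hq (K + 1)) (1 + 2 * C) fun z => ?_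
          rw [abs_of_nonneg (integral_nonneg hf0)]
          have h3 : ∫ n, f n ∂leftsLaw q (z + 1) ≤ ∫ n : ℕ, (n : ℝ) ^ 2 ∂leftsLaw q (z + 1) :=
            integral_mono_of_nonneg (ae_of_all _ hf0)
              (integrable_pow_leftsLaw hq _ (by norm_num)) (ae_of_all _ hfle)
          have h4 : (z : ℝ) ^ 2 ≤ (z : ℝ) ^ 3 + 1 := by
            have : (0 : ℝ) ≤ z := by positivity
            nlinarith [sq_nonneg ((z : ℝ) - 1), mul_nonneg this (sq_nonneg ((z : ℝ) - 1))]
          have h5 : (z : ℝ) + 1 ≤ 2 * ((z : ℝ) ^ 3 + 1) := by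
            have : (0 : ℝ) ≤ z := by positivity
            nlinarith [sq_nonneg ((z : ℝ) - 1), mul_nonneg this (sq_nonneg ((z : ℝ) - 1))]
          nlinarith [hC' z, mul_le_mul_of_nonneg_left h5 hC]
      push_cast
      linarith
  exact (key K).trans (integral_mono (hfI _) (integrable_pow_branchLaw hq _ (by norm_num)) hfle)

end ExcitedWalk

namespace ExcitedWalk

variable {q : ℕ → unitInterval} {M : ℕ}

lemma integral_pow_branchLaw_le_of_bounded (hq : ∀ j ≥ M, (q j : ℝ) = 1 / 2) {B : ℝ}
    (hB : ∀ K, branchMean q K ≤ B) :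
    ∃ C ≥ 0, ∀ K : ℕ, ∫ n : ℕ, (n : ℝ) ^ 2 ∂branchLaw q K ≤ C * K ∧
      ∫ n : ℕ, (n : ℝ) ^ 3 ∂branchLaw q K ≤ C * (K : ℝ) ^ 2 := by
  obtain ⟨C, hC, h⟩ := exists_second_moment_le hq
  obtain ⟨C', hC', h'⟩ := exists_third_moment_le hq
  have hB0 : 0 ≤ B := (branchMean_nonneg 0).trans (hB 0)
  have h2 : ∀ K : ℕ, ∫ n : ℕ, (n : ℝ) ^ 2 ∂branchLaw q K ≤ C * (B + 1) * K := by
    intro K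
    induction K with
    | zero => rw [integral_pow_two_branchLaw_zero]; simp
    | succ K ih =>
      have i2 := integrable_pow_branchLaw hq K (k := 2) (by norm_num)
      have i1 : Integrable (fun z : ℕ => C * ((z : ℝ) + 1)) (branchLaw q K) :=
        ((integrable_branchLaw hq K).add (integrable_const 1)).const_mul C
      have := integral_branchLaw_succ_le (K := K)
        (ψ := fun z : ℕ => (z : ℝ) ^ 2 + C * ((z : ℝ) + 1))
        (integrable_pow_branchLaw hq (K + 1) (k := 2) (by norm_num))
        (fun n => by positivity) (i2.add i1) h
      rw [integral_add (by exact i2) (by exact i1), integral_const_mul,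
        integral_add (integrable_branchLaw hq K) (integrable_const 1)] at this
      simp only [integral_const, probReal_univ, smul_eq_mul, one_mul] at this
      have h3 := mul_le_mul_of_nonneg_left (hB K) hC
      unfold branchMean at h3
      push_cast
      linarith
  refine ⟨C * (B + 1) + C' * (C * (B + 1) + 1), by positivity, fun K => ⟨?_, ?_⟩⟩
  · refine (h2 K).trans (mul_le_mul_of_nonneg_right ?_ (Nat.cast_nonneg K))
    exact le_add_of_nonneg_right (by positivity)
  · have h3 : ∫ n : ℕ, (n : ℝ) ^ 3 ∂branchLaw q K ≤ C' * (C * (B + 1) + 1) * (K : ℝ) ^ 2 := by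
      induction K with
      | zero => rw [branchLaw_zero, integral_dirac]; simp
      | succ K ih =>
        have i2 := integrable_pow_branchLaw hq K (k := 3) (by norm_num)
        have i1 : Integrable (fun z : ℕ => C' * ((z : ℝ) ^ 2 + 1)) (branchLaw q K) :=
          ((integrable_pow_branchLaw hq K (by norm_num)).add (integrable_const 1)).const_mul C'
        have := integral_branchLaw_succ_le (K := K)
          (ψ := fun z : ℕ => (z : ℝ) ^ 3 + C' * ((z : ℝ) ^ 2 + 1))
          (integrable_pow_branchLaw hq (K + 1) (k := 3) (by norm_num))
          (fun n => by positivity) (i2.add i1) h'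
        rw [integral_add (by exact i2) (by exact i1), integral_const_mul,
          integral_add (integrable_pow_branchLaw hq K (by norm_num)) (integrable_const 1)] at this
        simp only [integral_const, probReal_univ, smul_eq_mul, one_mul] at this
        have h4 := mul_le_mul_of_nonneg_left (h2 K) hC'
        have h5 : 0 ≤ C' * (C * (B + 1)) * K := by positivity
        have h6 : 0 ≤ C' * K := by positivity
        have h7 : 0 ≤ C' * (C * (B + 1)) := by positivity
        push_cast
        nlinarith
    refine h3.trans (mul_le_mul_of_nonneg_right ?_ (by positivity))
    exact le_add_of_nonneg_left (by positivity)

/-- A bounded sequence of means forces uniform integrability, by monotonicity. -/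
lemma exists_truncation (hq : ∀ j ≥ M, (q j : ℝ) = 1 / 2) {B η : ℝ} (hη : 0 < η)
    (hB : ∀ K, branchMean q K ≤ B) :
    ∃ L K₀ : ℕ, ∀ K ≥ K₀, ∫ n : ℕ, ((n : ℝ) - (min n L : ℕ)) ∂branchLaw q K ≤ η := by
  have hbdd : BddAbove (Set.range (branchMean q)) := ⟨B, by rintro _ ⟨K, rfl⟩; exact hB K⟩
  obtain ⟨K₀, hK₀⟩ := exists_lt_of_lt_ciSup (sub_lt_self (⨆ K, branchMean q K) (half_pos hη))
  have hI : ∀ L K : ℕ, Integrable (fun n : ℕ => ((min n L : ℕ) : ℝ)) (branchLaw q K) :=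
    fun L K => (integrable_branchLaw hq K).mono' (measurable_of_countable _).aestronglyMeasurable
      (ae_of_all _ fun n => by
        rw [Real.norm_of_nonneg (Nat.cast_nonneg _)]; exact_mod_cast min_le_left n L)
  have hlim : Tendsto (fun L : ℕ => ∫ n : ℕ, ((min n L : ℕ) : ℝ) ∂branchLaw q K₀) atTop
      (𝓝 (∫ n : ℕ, (n : ℝ) ∂branchLaw q K₀)) := by
    refine tendsto_integral_of_dominated_convergence (fun n : ℕ => (n : ℝ))
      (fun L => (measurable_of_countable _).aestronglyMeasurable) (integrable_branchLaw hq K₀)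
      (fun L => ae_of_all _ fun n => ?_) (ae_of_all _ fun n => ?_)
    · rw [Real.norm_of_nonneg (Nat.cast_nonneg _)]; exact_mod_cast min_le_left n L
    · refine tendsto_const_nhds.congr' ?_
      filter_upwards [eventually_ge_atTop n] with L hL
      rw [min_eq_left hL]
  obtain ⟨L, hL⟩ := (hlim.eventually (lt_mem_nhds (sub_lt_self _ (half_pos hη)))).exists
  refine ⟨L, K₀, fun K hK => ?_⟩
  have h1 : ∫ n : ℕ, ((min n L : ℕ) : ℝ) ∂branchLaw q K₀ ≤
      ∫ n : ℕ, ((min n L : ℕ) : ℝ) ∂branchLaw q K :=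
    integral_branchLaw_mono hq (fun a b hab => by
      exact_mod_cast min_le_min_right L hab) (hI L) hK
  have h2 := le_ciSup hbdd K
  rw [integral_sub (integrable_branchLaw hq K) (hI L K)]
  unfold branchMean at *
  linarith

theorem exists_lt_branchMean (hq : ∀ j ≥ M, (q j : ℝ) = 1 / 2) (hq1 : ∀ j, (q j : ℝ) < 1)
    (hδ : ∑ j ∈ Finset.range M, (2 * (q j : ℝ) - 1) ≤ 2) (B : ℝ) : ∃ K, B < branchMean q K := by
  by_contra! hB
  have hB0 : 0 ≤ B := (branchMean_nonneg 0).trans (hB 0)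
  obtain ⟨a, ha, hlow⟩ := exists_mul_le_second_moment hq hq1 hδ
  obtain ⟨C, hC, hup⟩ := integral_pow_branchLaw_le_of_bounded hq hB
  set Λ := 4 * (C + 1) / a with hΛ
  have hΛ0 : 0 < Λ := by positivity
  have hη : 0 < a / (8 * Λ) := by positivity
  obtain ⟨L, K₀, hL⟩ := exists_truncation hq hη hB
  have key : ∀ n : ℕ, K₀ ≤ n → 0 < n → a * ((n : ℝ) - 1) ≤ 2 * L * B + a / 2 * n := by
    intro n hn hn0
    have hn0' : (0 : ℝ) < n := by exact_mod_cast hn0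
    have hlown := hlow (n - 1)
    rw [Nat.sub_add_cancel hn0, Nat.cast_pred hn0] at hlown
    have i1 := (integrable_branchLaw hq n).const_mul (2 * L : ℝ)
    have hIm : Integrable (fun n : ℕ => ((min n L : ℕ) : ℝ)) (branchLaw q n) :=
      (integrable_branchLaw hq n).mono' (measurable_of_countable _).aestronglyMeasurable
      (ae_of_all _ fun n => by
        rw [Real.norm_of_nonneg (Nat.cast_nonneg _)]; exact_mod_cast min_le_left n L)
    have i2 : Integrable (fun z : ℕ => 2 * (Λ * n) * ((z : ℝ) - (min z L : ℕ))) (branchLaw q n) :=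
      ((integrable_branchLaw hq n).sub hIm).const_mul _
    have i3 := (integrable_pow_branchLaw hq n (k := 3) (by norm_num)).const_mul (Λ * n)⁻¹
    have hpt : ∀ z : ℕ, (z : ℝ) ^ 2 ≤ 2 * L * z + 2 * (Λ * n) * ((z : ℝ) - (min z L : ℕ)) +
        (Λ * n)⁻¹ * (z : ℝ) ^ 3 := by
      intro z
      have hR : 0 < Λ * n := by positivity
      have hz0 : (0 : ℝ) ≤ z := Nat.cast_nonneg z
      have hm0 : (0 : ℝ) ≤ (z : ℝ) - (min z L : ℕ) := by
        rw [sub_nonneg]; exact_mod_cast min_le_left z L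
      have h3 : 0 ≤ (Λ * n)⁻¹ * (z : ℝ) ^ 3 := by positivity
      by_cases h1 : (z : ℝ) ≤ 2 * L
      · nlinarith [mul_nonneg hR.le hm0]
      push Not at h1
      have hLz : L ≤ z := by
        have : (L : ℝ) ≤ z := by linarith [(Nat.cast_nonneg L : (0 : ℝ) ≤ L)]
        exact_mod_cast this
      rw [min_eq_right hLz] at hm0 ⊢
      by_cases h2 : (z : ℝ) ≤ Λ * n
      · have hL0 : (0 : ℝ) ≤ L := Nat.cast_nonneg L
        nlinarith [mul_le_mul_of_nonneg_left h2 hz0,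
          mul_le_mul_of_nonneg_left (show (z : ℝ) ≤ 2 * (z - L) by linarith) hR.le,
          mul_nonneg hL0 hz0]
      · push Not at h2
        have h4 : (z : ℝ) ^ 2 ≤ (Λ * n)⁻¹ * (z : ℝ) ^ 3 := by
          rw [inv_mul_eq_div, le_div_iff₀ hR]
          nlinarith [sq_nonneg (z : ℝ)]
        have h5 : (0 : ℝ) ≤ 2 * L * z := by positivity
        nlinarith [mul_nonneg hR.le hm0]
    have hmoment := integral_mono (g := fun z : ℕ => 2 * L * (z : ℝ) +
        2 * (Λ * n) * ((z : ℝ) - (min z L : ℕ)) + (Λ * n)⁻¹ * (z : ℝ) ^ 3)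
      (integrable_pow_branchLaw hq n (k := 2) (by norm_num)) ((i1.add i2).add i3) hpt
    rw [integral_add (by exact i1.add i2) (by exact i3), integral_add (by exact i1) (by exact i2),
      integral_const_mul, integral_const_mul, integral_const_mul] at hmoment
    have e1 : 2 * (L : ℝ) * ∫ z : ℕ, (z : ℝ) ∂branchLaw q n ≤ 2 * L * B :=
      mul_le_mul_of_nonneg_left (hB n) (by positivity)
    have e2 : 2 * (Λ * n) * ∫ z : ℕ, ((z : ℝ) - (min z L : ℕ)) ∂branchLaw q n ≤ a / 4 * n := by
      refine (mul_le_mul_of_nonneg_left (hL n hn) (by positivity)).trans (le_of_eq ?_)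
      field_simp
      ring
    have e3 : (Λ * n)⁻¹ * ∫ z : ℕ, (z : ℝ) ^ 3 ∂branchLaw q n ≤ a / 4 * n := by
      refine (mul_le_mul_of_nonneg_left (hup n).2 (by positivity)).trans ?_
      have : (Λ * n)⁻¹ * (C * (n : ℝ) ^ 2) = a / 4 * n * (C / (C + 1)) := by
        rw [hΛ]; field_simp
      rw [this]
      refine mul_le_of_le_one_right (by positivity) ?_
      rw [div_le_one (by positivity)]
      linarith
    exact hlown.trans (hmoment.trans (by linarith))
  obtain ⟨n, hn⟩ := exists_nat_gt ((2 * L * B + a) / (a / 2))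
  have h1 := key (n + K₀ + 1) (by omega) (by omega)
  rw [div_lt_iff₀ (by positivity)] at hn
  push_cast at h1
  nlinarith [mul_nonneg ha.le (Nat.cast_nonneg K₀ : (0 : ℝ) ≤ K₀)]

end ExcitedWalk

namespace ExcitedWalk

open scoped ENNReal

/-! ### Ergodic averages along the environment -/

variable {q : ℕ → unitInterval} {M : ℕ}

/-- The pointwise ergodic theorem along `ℕ` for functionals of the environment to the right of
the origin, as a pair of one-sided bounds. -/
lemma ae_ergodic_average {f : (ℤ → ℕ → Bool) → ℝ} (hf : Measurable f)
    (hI : Integrable f (envLaw q)) (hloc : ∀ e e', (∀ y ≥ 0, e y = e' y) → f e = f e') :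
    ∀ᵐ e ∂envLaw q, ∀ ε > 0, ∃ C, ∀ n : ℕ,
      ((∫ e, f e ∂envLaw q) - ε) * n - C ≤ ∑ x ∈ Finset.range n, f (fun y => e (y + (x : ℕ))) ∧
      ∑ x ∈ Finset.range n, f (fun y => e (y + (x : ℕ))) ≤
        ((∫ e, f e ∂envLaw q) + ε) * n + C := by
  set ν := Measure.infinitePi fun _ : ℕ => stackLaw q
  have hrm : Measurable fun (e : ℤ → ℕ → Bool) (n : ℕ) => e n := by fun_prop
  have hr : MeasurePreserving (fun (e : ℤ → ℕ → Bool) (n : ℕ) => e n) (envLaw q) ν :=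
    ⟨hrm, map_envLaw Nat.cast_injective⟩
  set g : (ℕ → ℕ → Bool) → ℝ := fun ω => f fun y : ℤ => ω y.toNat with hg
  have hgm : Measurable g := hf.comp (by fun_prop)
  have hfg : ∀ e, g (fun n : ℕ => e n) = f e := fun e =>
    hloc _ _ fun y hy => by simp [Int.toNat_of_nonneg hy]
  have hgI : Integrable g ν := by
    rw [← hr.integrable_comp hgm.aestronglyMeasurable]
    exact hI.congr (ae_of_all _ fun e => (hfg e).symm)
  have hmoment : ∫ ω, g ω ∂ν = ∫ e, f e ∂envLaw q := by
    rw [← hr.map_eq, integral_map hrm.aemeasurable hgm.aestronglyMeasurable]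
    exact integral_congr_ae (ae_of_all _ hfg)
  have hsum : ∀ (e : ℤ → ℕ → Bool) (n : ℕ), birkhoffSum shift g n (fun n : ℕ => e n) =
      ∑ x ∈ Finset.range n, f (fun y => e (y + (x : ℕ))) := by
    intro e n
    refine Finset.sum_congr rfl fun x _ => ?_
    have h : shift^[x] (fun n : ℕ => e n) = fun n : ℕ => e ((n : ℤ) + (x : ℕ)) := by
      funext k
      rw [shift_iterate]
      push_cast
      rfl
    rw [h]
    exact hfg fun y => e (y + (x : ℕ))
  filter_upwards [hr.quasiMeasurePreserving.ae (ae_birkhoffSum_le (ergodic_shift _) hgm hgI),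
    hr.quasiMeasurePreserving.ae (ae_le_birkhoffSum (ergodic_shift _) hgm hgI)] with e h1 h2 ε hε
  obtain ⟨C₁, hC₁⟩ := h1 ε hε
  obtain ⟨C₂, hC₂⟩ := h2 ε hε
  refine ⟨max C₁ C₂, fun n => ?_⟩
  have a1 := hC₁ n
  have a2 := hC₂ n
  rw [hsum, hmoment] at a1 a2
  exact ⟨by linarith [le_max_right C₁ C₂], by linarith [le_max_left C₁ C₂]⟩

lemma integrable_branch (hq : ∀ j ≥ M, (q j : ℝ) = 1 / 2) (K : ℕ) :
    Integrable (fun e => (branch e K 0 : ℝ)) (envLaw q) :=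
  (integrable_map_measure (g := fun n : ℕ => (n : ℝ))
    (measurable_of_countable _).aestronglyMeasurable
    (measurable_branch K 0).aemeasurable).1 (integrable_branchLaw hq K)

lemma integral_branch (K : ℕ) : ∫ e, (branch e K 0 : ℝ) ∂envLaw q = branchMean q K :=
  (integral_map (measurable_branch K 0).aemeasurable
    (measurable_of_countable fun n : ℕ => (n : ℝ)).aestronglyMeasurable).symm

lemma ae_le_branchSum (hq : ∀ j ≥ M, (q j : ℝ) = 1 / 2) :
    ∀ᵐ e ∂envLaw q, ∀ K, ∀ ε > 0, ∃ C, ∀ n : ℕ, (branchMean q K - ε) * n - C ≤ branchSum e n := by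
  rw [ae_all_iff]
  intro K
  filter_upwards [ae_good_envLaw hq, ae_ergodic_average
    ((measurable_of_countable fun n : ℕ => (n : ℝ)).comp (measurable_branch K 0))
    (integrable_branch hq K)
    (fun e e' h => by simp only [Function.comp]; rw [branch_congr h])] with e he h ε hε
  obtain ⟨C, hC⟩ := h ε hε
  refine ⟨C + |branchMean q K - ε| * K, fun n => ?_⟩
  have h1 := (hC (n - K)).1
  simp only [Function.comp_def, branch_translate, zero_add, integral_branch] at h1
  have h2 : ∑ x ∈ Finset.range (n - K), (branch e K x : ℝ) ≤ branchSum e n := by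
    refine le_trans (Finset.sum_le_sum fun x hx => ?_) (Finset.sum_le_sum_of_subset_of_nonneg
      (Finset.range_mono (Nat.sub_le n K)) fun _ _ _ => Nat.cast_nonneg _)
    rw [Finset.mem_range] at hx
    exact_mod_cast branch_mono he x (by omega)
  have h3 : (n : ℝ) - (n - K : ℕ) ≤ K := by
    have : (n : ℝ) ≤ K + (n - K : ℕ) := by exact_mod_cast (by omega : n ≤ K + (n - K))
    linarith
  have h4 : (0 : ℝ) ≤ n - (n - K : ℕ) := by
    have : ((n - K : ℕ) : ℝ) ≤ n := by exact_mod_cast Nat.sub_le n K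
    linarith
  have h5 : (branchMean q K - ε) * (n - (n - K : ℕ)) ≤ |branchMean q K - ε| * K :=
    (mul_le_mul_of_nonneg_right (le_abs_self _) h4).trans
      (mul_le_mul_of_nonneg_left h3 (abs_nonneg _))
  linarith

lemma ae_eventually_pos_div_le (hq : ∀ j ≥ M, (q j : ℝ) = 1 / 2) (hq1 : ∀ j, (q j : ℝ) < 1)
    (hδ : ∑ j ∈ Finset.range M, (2 * (q j : ℝ) - 1) ≤ 2) :
    ∀ᵐ e ∂envLaw q, ∀ ε > 0, ∀ᶠ t : ℕ in atTop, (pos e t : ℝ) / t ≤ ε := by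
  filter_upwards [ae_good_envLaw hq, ae_le_branchSum hq] with e he h ε hε
  refine eventually_pos_div_le he (fun A => ?_) hε
  obtain ⟨K, hK⟩ := exists_lt_branchMean hq hq1 hδ (A + 1)
  obtain ⟨C, hC⟩ := h K 1 one_pos
  refine ⟨C, fun n => le_trans ?_ (hC n)⟩
  have : A * n ≤ (branchMean q K - 1) * n :=
    mul_le_mul_of_nonneg_right (by linarith) (Nat.cast_nonneg n)
  linarith

/-! ### The stationary branching process when `δ > 2` -/

/-- The limit of the branching processes started far to the right. -/
noncomputable def limitBranch (e : ℤ → ℕ → Bool) (x : ℤ) : ℕ := ⨆ K, branch e K x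

lemma measurable_limitBranch (x : ℤ) : Measurable fun e => limitBranch e x :=
  Measurable.iSup fun K => measurable_branch K x

lemma limitBranch_congr {e e' : ℤ → ℕ → Bool} {x : ℤ} (h : ∀ y ≥ x, e y = e' y) :
    limitBranch e x = limitBranch e' x := by
  simp only [limitBranch, branch_congr h]

lemma limitBranch_translate (e : ℤ → ℕ → Bool) (x y : ℤ) :
    limitBranch (fun z => e (z + y)) x = limitBranch e (x + y) := by
  simp only [limitBranch, branch_translate]

lemma ae_bddAbove_branch (hq : ∀ j ≥ M, (q j : ℝ) = 1 / 2) {B : ℝ}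
    (hB : ∀ K, branchMean q K ≤ B) :
    (∀ᵐ e ∂envLaw q, BddAbove (Set.range fun K => branch e K 0)) ∧
      Integrable (fun e => (limitBranch e 0 : ℝ)) (envLaw q) := by
  have hm : ∀ K, Measurable fun e => (branch e K 0 : ℝ≥0∞) := fun K =>
    (measurable_of_countable fun n : ℕ => (n : ℝ≥0∞)).comp (measurable_branch K 0)
  have hle : ∫⁻ e, ⨆ K, (branch e K 0 : ℝ≥0∞) ∂envLaw q ≤ ENNReal.ofReal B := by
    rw [lintegral_iSup' (fun K => (hm K).aemeasurable)]
    · refine iSup_le fun K => ?_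
      have h1 := ofReal_integral_eq_lintegral_ofReal (integrable_branch hq K)
        (ae_of_all _ fun e => Nat.cast_nonneg (branch e K 0))
      simp only [ENNReal.ofReal_natCast] at h1
      rw [← h1, integral_branch]
      exact ENNReal.ofReal_le_ofReal (hB K)
    · filter_upwards [ae_good_envLaw hq] with e he K L hKL
      exact Nat.cast_le.2 (branch_mono he 0 hKL)
  have hbdd : ∀ᵐ e ∂envLaw q, BddAbove (Set.range fun K => branch e K 0) := by
    filter_upwards [ae_lt_top (Measurable.iSup hm) (hle.trans_lt ENNReal.ofReal_lt_top).ne]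
      with e he
    obtain ⟨n, hn⟩ := ENNReal.exists_nat_gt he.ne
    refine ⟨n, ?_⟩
    rintro _ ⟨K, rfl⟩
    exact_mod_cast (le_iSup (fun K => (branch e K 0 : ℝ≥0∞)) K).trans hn.le
  refine ⟨hbdd, ⟨((measurable_of_countable fun n : ℕ => (n : ℝ)).comp
    (measurable_limitBranch 0)).aestronglyMeasurable, ?_⟩⟩
  rw [hasFiniteIntegral_iff_norm]
  refine lt_of_le_of_lt ((lintegral_mono_ae ?_).trans hle) ENNReal.ofReal_lt_top
  filter_upwards [hbdd] with e he
  obtain ⟨K, hK⟩ := Nat.sSup_mem (Set.range_nonempty _) he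
  rw [Real.norm_of_nonneg (Nat.cast_nonneg _), ENNReal.ofReal_natCast]
  have : limitBranch e 0 = branch e K 0 := hK.symm
  rw [this]
  exact le_iSup (fun K => (branch e K 0 : ℝ≥0∞)) K

lemma ae_forall_bddAbove_branch (hq : ∀ j ≥ M, (q j : ℝ) = 1 / 2) {B : ℝ}
    (hB : ∀ K, branchMean q K ≤ B) :
    ∀ᵐ e ∂envLaw q, ∀ x, BddAbove (Set.range fun K => branch e K x) := by
  rw [ae_all_iff]
  intro x
  have := (measurePreserving_translate q x).quasiMeasurePreserving.ae (ae_bddAbove_branch hq hB).1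
  simpa only [branch_translate, zero_add] using this

lemma leftsBefore_limitBranch_le {e : ℤ → ℕ → Bool} {x : ℤ}
    (h : ∀ x, BddAbove (Set.range fun K => branch e K x)) :
    leftsBefore (e x) (limitBranch e (x + 1)) ≤ limitBranch e x := by
  obtain ⟨K, hK⟩ := Nat.sSup_mem (Set.range_nonempty _) (h (x + 1))
  have : limitBranch e (x + 1) = branch e K (x + 1) := hK.symm
  rw [this]
  exact le_ciSup (h x) (K + 1)

lemma tendsto_branchMean (hq : ∀ j ≥ M, (q j : ℝ) = 1 / 2) {B : ℝ}
    (hB : ∀ K, branchMean q K ≤ B) :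
    Tendsto (branchMean q) atTop (𝓝 (∫ e, (limitBranch e 0 : ℝ) ∂envLaw q)) := by
  obtain ⟨hbdd, hI⟩ := ae_bddAbove_branch hq hB
  have := integral_tendsto_of_tendsto_of_monotone (fun K => integrable_branch hq K) hI
    (by
      filter_upwards [ae_good_envLaw hq] with e he K L hKL
      exact Nat.cast_le.2 (branch_mono he 0 hKL))
    (by
      filter_upwards [ae_good_envLaw hq, hbdd] with e he hb
      exact (continuous_of_discreteTopology.tendsto _).comp
        (tendsto_atTop_ciSup (branch_mono he 0) hb))
  simpa only [integral_branch] using this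

lemma envLaw_limitBranch_eq_zero_pos (hq : ∀ j ≥ M, (q j : ℝ) = 1 / 2)
    (hq0 : ∀ j, 0 < (q j : ℝ)) {B : ℝ} (hB : ∀ K, branchMean q K ≤ B) :
    0 < envLaw q {e | limitBranch e 0 = 0} := by
  have hpos : envLaw q {e | leftsBefore (e 0) (limitBranch e 1) = 0} ≠ 0 := by
    intro h0
    have hms : MeasurableSet {u : (ℕ → Bool) × (ℤ → ℕ → Bool) |
        leftsBefore u.1 (limitBranch u.2 1) = 0} :=
      (measurable_leftsBefore_uncurry.comp (measurable_fst.prodMk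
        ((measurable_limitBranch 1).comp measurable_snd))) (measurableSet_singleton 0)
    have hms' : MeasurableSet {e : ℤ → ℕ → Bool | leftsBefore (e 0) (limitBranch e 1) = 0} :=
      (measurable_leftsBefore_uncurry.comp ((measurable_pi_apply 0).prodMk
        (measurable_limitBranch 1))) (measurableSet_singleton 0)
    rw [← map_update_envLaw q 0, Measure.map_apply (measurable_update_fst 0) hms'] at h0
    have hset : (fun u : (ℕ → Bool) × (ℤ → ℕ → Bool) => Function.update u.2 0 u.1) ⁻¹'
        {e | leftsBefore (e 0) (limitBranch e 1) = 0} =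
        {u | leftsBefore u.1 (limitBranch u.2 1) = 0} := by
      ext u
      simp only [Set.mem_preimage, Set.mem_ofPred_eq, Function.update_self]
      rw [limitBranch_congr (e := Function.update u.2 0 u.1) (e' := u.2)
        fun y hy => Function.update_of_ne (by omega) _ _]
    rw [hset, Measure.prod_apply_symm hms, lintegral_eq_zero_iff
      (measurable_measure_prodMk_right hms)] at h0
    obtain ⟨e, he⟩ := h0.exists
    have h1 := leftsLaw_zero_pos hq hq0 (limitBranch e 1 + 1)
    rw [leftsLaw, Measure.map_apply (measurable_leftsTo _) (measurableSet_singleton 0)] at h1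
    exact h1.ne' he
  refine lt_of_lt_of_le (pos_iff_ne_zero.2 hpos) (measure_mono_ae ?_)
  filter_upwards [ae_good_envLaw hq, ae_forall_bddAbove_branch hq hB] with e he hb h
  refine Nat.eq_zero_of_le_zero (ciSup_le fun K => (branch_mono_succ he K 0).trans ?_)
  have h : leftsBefore (e 0) (limitBranch e 1) = 0 := h
  rw [← h]
  exact leftsBefore_mono (he 0) (le_ciSup (hb 1) K)

lemma ae_exists_nonneg_limitBranch_eq_zero (hq : ∀ j ≥ M, (q j : ℝ) = 1 / 2)
    (hq0 : ∀ j, 0 < (q j : ℝ)) {B : ℝ} (hB : ∀ K, branchMean q K ≤ B) :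
    ∀ᵐ e ∂envLaw q, ∃ x : ℕ, limitBranch e x = 0 := by
  have hms : MeasurableSet {e : ℤ → ℕ → Bool | limitBranch e 0 = 0} :=
    measurable_limitBranch 0 (measurableSet_singleton 0)
  have hpos : 0 < (envLaw q).real {e | limitBranch e 0 = 0} :=
    ENNReal.toReal_pos (envLaw_limitBranch_eq_zero_pos hq hq0 hB).ne' (measure_ne_top _ _)
  filter_upwards [ae_ergodic_average
    (f := Set.indicator {e : ℤ → ℕ → Bool | limitBranch e 0 = 0} 1)
    (measurable_one.indicator hms) ((integrable_const 1).indicator hms)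
    (fun e e' h => by simp [Set.indicator, limitBranch_congr h])] with e he
  rw [integral_indicator_one hms] at he
  obtain ⟨C, hC⟩ := he _ (half_pos hpos)
  by_contra! hne
  obtain ⟨n, hn⟩ := exists_nat_gt (C / ((envLaw q).real {e | limitBranch e 0 = 0} / 2))
  rw [div_lt_iff₀ (half_pos hpos)] at hn
  have h1 := (hC n).1
  simp only [Set.indicator, Set.mem_ofPred_eq, limitBranch_translate, zero_add, hne, if_false,
    Finset.sum_const_zero] at h1
  linarith

lemma ae_exists_nonpos_limitBranch_eq_zero (hq : ∀ j ≥ M, (q j : ℝ) = 1 / 2)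
    (hq0 : ∀ j, 0 < (q j : ℝ)) {B : ℝ} (hB : ∀ K, branchMean q K ≤ B) :
    ∀ᵐ e ∂envLaw q, ∃ x ≤ (0 : ℤ), limitBranch e x = 0 := by
  set S : ℕ → Set (ℤ → ℕ → Bool) := fun k => {e | ∀ x : ℕ, x ≤ k → limitBranch e x ≠ 0} with hS
  have hSm : ∀ k, MeasurableSet (S k) := fun k => by
    rw [hS]
    simp only [Set.ofPred_forall]
    exact MeasurableSet.iInter fun x => MeasurableSet.iInter fun _ =>
      (measurable_limitBranch x (measurableSet_singleton 0)).compl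
  have hlim := tendsto_measure_iInter_atTop (μ := envLaw q) (fun k => (hSm k).nullMeasurableSet)
    (fun k l hkl e he x hx => he x (hx.trans hkl)) ⟨0, measure_ne_top _ _⟩
  have h0 : envLaw q (⋂ k, S k) = 0 := by
    refine measure_mono_null (fun e he => ?_)
      (ae_iff.1 (ae_exists_nonneg_limitBranch_eq_zero hq hq0 hB))
    rintro ⟨x, hx⟩
    exact Set.mem_iInter.1 he x x le_rfl hx
  rw [h0] at hlim
  rw [ae_iff]
  refine le_antisymm (ge_of_tendsto' hlim fun k => ?_) (zero_le)
  rw [Function.comp_apply,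
    ← (measurePreserving_translate q (-k)).measure_preimage (hSm k).nullMeasurableSet]
  refine measure_mono fun e he x hx h => he ⟨x + -k, by omega, ?_⟩
  rwa [limitBranch_translate] at h

theorem ae_tendsto_pos_div (hq : ∀ j ≥ M, (q j : ℝ) = 1 / 2) (hq0 : ∀ j, 0 < (q j : ℝ))
    (hδ : 2 < ∑ j ∈ Finset.range M, (2 * (q j : ℝ) - 1)) :
    ∃ v > 0, ∀ᵐ e ∂envLaw q, Tendsto (fun t : ℕ => (pos e t : ℝ) / t) atTop (𝓝 v) := by
  obtain ⟨B, hB⟩ := exists_branchMean_le hq hδ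
  have hm : (0 : ℝ) ≤ ∫ e, (limitBranch e 0 : ℝ) ∂envLaw q :=
    integral_nonneg fun e => Nat.cast_nonneg _
  refine ⟨(1 + 2 * ∫ e, (limitBranch e 0 : ℝ) ∂envLaw q)⁻¹, by positivity, ?_⟩
  filter_upwards [ae_good_envLaw hq, ae_forall_bddAbove_branch hq hB, ae_le_branchSum hq,
    ae_exists_nonpos_limitBranch_eq_zero hq hq0 hB, ae_ergodic_average
      ((measurable_of_countable fun n : ℕ => (n : ℝ)).comp (measurable_limitBranch 0))
      (ae_bddAbove_branch hq hB).2
      (fun e e' h => by simp only [Function.comp]; rw [limitBranch_congr h])]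
    with e he hb hlow ⟨x₀, hx₀, h0⟩ hup
  refine tendsto_pos_div he (limitBranch e) (fun x => leftsBefore_limitBranch_le hb) hx₀ h0 hm
    (fun ε hε => ?_) (fun ε hε => ?_)
  · obtain ⟨K, hK⟩ := ((tendsto_branchMean hq hB).eventually
      (lt_mem_nhds (sub_lt_self _ (half_pos hε)))).exists
    obtain ⟨C, hC⟩ := hlow K (ε / 2) (half_pos hε)
    refine ⟨C, fun n => le_trans ?_ (hC n)⟩
    have := mul_le_mul_of_nonneg_right
      (show (∫ e, (limitBranch e 0 : ℝ) ∂envLaw q) - ε ≤ branchMean q K - ε / 2 by linarith)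
      (Nat.cast_nonneg n : (0 : ℝ) ≤ n)
    linarith
  · obtain ⟨C, hC⟩ := hup ε hε
    refine ⟨C, fun n => ?_⟩
    simpa only [Function.comp_def, limitBranch_translate, zero_add] using (hC n).2

end ExcitedWalk

namespace ExcitedWalk

open scoped ENNReal

/-! ### The walk in a random environment is an excited random walk -/

variable {q : ℕ → unitInterval}

lemma stackLaw_inter_eq_true {T : Set (ℕ → Bool)} (hT : MeasurableSet T) {c : ℕ}
    (h : ∀ b ∈ T, ∀ v, Function.update b c v ∈ T) :
    stackLaw q ({b | b c = true} ∩ T) = ENNReal.ofReal (q c) * stackLaw q T := by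
  have hm : MeasurableSet ({b : ℕ → Bool | b c = true} ∩ T) :=
    (measurableSet_eq_fun (measurable_pi_apply c) measurable_const).inter hT
  have hset : (fun u : Bool × (ℕ → Bool) => Function.update u.2 c u.1) ⁻¹'
      ({b | b c = true} ∩ T) = {true} ×ˢ T := by
    ext ⟨v, b⟩
    simp only [Set.mem_preimage, Set.mem_inter_iff, Set.mem_ofPred_eq, Function.update_self,
      Set.mem_prod, Set.mem_singleton_iff]
    refine and_congr_right fun _ => ⟨fun hb => ?_, fun hb => h b hb v⟩
    simpa using h _ hb (b c)
  conv_lhs => rw [stackLaw, ← map_update_infinitePi _ c]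
  rw [Measure.map_apply (measurable_update_fst c) hm, hset, Measure.prod_prod,
    bernoulliMeasure_apply_of_mem_of_notMem _ (measurableSet_singleton _) (by simp) (by simp)]
  exact congrArg (· * _) (congrArg _ (Real.toNNReal_of_nonneg (q c).2.1).symm)

lemma envLaw_inter_eq_true {A : Set (ℤ → ℕ → Bool)} (hA : MeasurableSet A) {x : ℤ} {c : ℕ}
    (h : ∀ e ∈ A, ∀ v, Function.update e x (Function.update (e x) c v) ∈ A) :
    envLaw q ({e | e x c = true} ∩ A) = ENNReal.ofReal (q c) * envLaw q A := by
  have hup := measurable_update_fst (S := ℕ → Bool) x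
  have hm : MeasurableSet ({e : ℤ → ℕ → Bool | e x c = true} ∩ A) :=
    (measurableSet_eq_fun (by fun_prop) measurable_const).inter hA
  rw [← map_update_envLaw q x, Measure.map_apply hup hm, Measure.map_apply hup hA,
    Measure.prod_apply_symm (hup hm), Measure.prod_apply_symm (hup hA),
    ← lintegral_const_mul _ (measurable_measure_prodMk_right (hup hA))]
  refine lintegral_congr fun e => ?_
  rw [← stackLaw_inter_eq_true ((hup hA).preimage measurable_prodMk_right)]
  · congr 1
    ext b
    simp
  · intro b hb v
    have := h _ hb v
    simpa using this

lemma measurable_pos_visits (t : ℕ) :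
    Measurable (fun e => pos e t) ∧ ∀ x, Measurable fun e => visits e t x := by
  induction t with
  | zero => exact ⟨measurable_const, fun x => measurable_const⟩
  | succ t ih =>
    obtain ⟨h1, h2⟩ := ih
    have h3 : Measurable fun e => visits e t (pos e t) :=
      (measurable_from_prod_countable_left (f := fun u : (ℤ → ℕ → Bool) × ℤ => visits u.1 t u.2)
        h2).comp (measurable_id.prodMk h1)
    have h4 : Measurable fun e : ℤ → ℕ → Bool => e (pos e t) (visits e t (pos e t)) :=
      (measurable_from_prod_countable_left
        (f := fun u : (ℤ → ℕ → Bool) × (ℤ × ℕ) => u.1 u.2.1 u.2.2)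
        fun y => (measurable_pi_apply y.2).comp (measurable_pi_apply y.1)).comp
        (measurable_id.prodMk (h1.prodMk h3))
    refine ⟨?_, fun x => ?_⟩
    · simp only [pos_succ]
      exact h1.add (Measurable.ite (h4 (measurableSet_singleton true)) measurable_const
        measurable_const)
    · simp only [visits_succ]
      exact (h2 x).add (Measurable.ite (h1 (measurableSet_singleton x)) measurable_const
        measurable_const)

lemma measurable_pos (t : ℕ) : Measurable fun e => pos e t := (measurable_pos_visits t).1

lemma pos_congr {e e' : ℤ → ℕ → Bool} {n : ℕ}
    (h : ∀ m < n, e' (pos e m) (visits e m (pos e m)) = e (pos e m) (visits e m (pos e m))) :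
    ∀ m ≤ n, pos e' m = pos e m ∧ ∀ x, visits e' m x = visits e m x := by
  intro m
  induction m with
  | zero => intro _; simp
  | succ m ih =>
    intro hm
    obtain ⟨h1, h2⟩ := ih (by omega)
    refine ⟨?_, fun x => by rw [visits_succ, visits_succ, h1, h2]⟩
    rw [pos_succ, pos_succ, h1, h2, h m (by omega)]

/-- The arrow used at time `n` does not influence the path up to time `n`. -/
lemma pos_update (e : ℤ → ℕ → Bool) (n : ℕ) (v : Bool) {m : ℕ} (hm : m ≤ n) :
    pos (Function.update e (pos e n) (Function.update (e (pos e n)) (visits e n (pos e n)) v)) m =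
      pos e m := by
  refine (pos_congr (fun k hk => ?_) m hm).1
  by_cases h : pos e k = pos e n
  · have hlt : visits e k (pos e k) < visits e n (pos e n) := by
      rw [h, visits_eq_count, visits_eq_count]
      exact Nat.count_strict_mono h hk
    rw [h, Function.update_self, Function.update_of_ne]
    rw [← h] at hlt ⊢
    rw [h] at hlt ⊢
    omega
  · rw [Function.update_of_ne h]

lemma card_filter_pos (e : ℤ → ℕ → Bool) (n : ℕ) :
    (Finset.univ.filter fun m : Fin (n + 1) => pos e m = pos e n).card - 1 =
      visits e n (pos e n) := by
  rw [Finset.card_filter, Fin.sum_univ_eq_sum_range (fun m => if pos e m = pos e n then 1 else 0),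
    ← Finset.card_filter, ← Nat.count_eq_card_filter_range, Nat.count_succ, if_pos rfl,
    visits_eq_count]
  rfl

lemma isEARW_pos {M : ℕ} {p : Fin M → ℝ} {p₀ : ℝ} (hq : ∀ j, (q j : ℝ) = cookieSeq M p p₀ j) :
    IsEARW (envLaw q) M p p₀ fun t e => pos e t where
  measurable := measurable_pos
  init _ := rfl
  steps e n := by
    rw [pos_succ]
    split_ifs <;> simp
  cond n w := by
    set A : Set (ℤ → ℕ → Bool) := {e | ∀ m : Fin (n + 1), pos e m = w m} with hA
    have hAm : MeasurableSet A := by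
      rw [hA, Set.ofPred_forall]
      exact MeasurableSet.iInter fun m => measurable_pos m (measurableSet_singleton _)
    set c := (Finset.univ.filter fun m : Fin (n + 1) => w m = w (Fin.last n)).card - 1 with hc
    have hlast : ∀ e ∈ A, pos e n = w (Fin.last n) := fun e he => he (Fin.last n)
    have hvis : ∀ e ∈ A, visits e n (w (Fin.last n)) = c := by
      intro e he
      rw [← hlast e he, ← card_filter_pos, hc]
      simp only [← he _, Fin.val_last]
    have hset : {e | pos e (n + 1) = w (Fin.last n) + 1} ∩ A =
        {e | e (w (Fin.last n)) c = true} ∩ A := by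
      ext e
      refine and_congr_left fun he => ?_
      simp only [Set.mem_ofPred_eq]
      rw [pos_succ, hlast e he, hvis e he, add_right_inj]
      cases e (w (Fin.last n)) c <;> simp
    rw [hset, envLaw_inter_eq_true hAm, hq]
    intro e he v m
    rw [← hvis e he, ← hlast e he, pos_update e n v (Nat.lt_succ_iff.1 m.2)]
    exact he m

end ExcitedWalk

namespace IsEARW

open scoped ENNReal

/-! ### Uniqueness of the law and reflection -/

variable {Ω Ω' : Type*} [MeasurableSpace Ω] [MeasurableSpace Ω'] {P : Measure Ω} {P' : Measure Ω'}
  {M : ℕ} {p : Fin M → ℝ} {p₀ : ℝ} {X : ℕ → Ω → ℤ} {X' : ℕ → Ω' → ℤ}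

lemma measure_left [IsProbabilityMeasure P] (hX : IsEARW P M p p₀ X) (n : ℕ)
    (w : Fin (n + 1) → ℤ) :
    P ({ω | X (n + 1) ω = w (Fin.last n) - 1} ∩ {ω | ∀ m : Fin (n + 1), X m ω = w m}) =
      P {ω | ∀ m : Fin (n + 1), X m ω = w m} -
      P ({ω | X (n + 1) ω = w (Fin.last n) + 1} ∩ {ω | ∀ m : Fin (n + 1), X m ω = w m}) := by
  set A := {ω | ∀ m : Fin (n + 1), X m ω = w m}
  have hA : MeasurableSet A := by
    simp only [A, Set.ofPred_forall]
    exact MeasurableSet.iInter fun m => hX.measurable m (measurableSet_singleton _)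
  have hup : MeasurableSet ({ω | X (n + 1) ω = w (Fin.last n) + 1} ∩ A) :=
    (hX.measurable _ (measurableSet_singleton _)).inter hA
  rw [← measure_sdiff Set.inter_subset_right hup.nullMeasurableSet (measure_ne_top _ _)]
  congr 1
  ext ω
  simp only [Set.mem_inter_iff, Set.mem_sdiff, Set.mem_ofPred_eq, not_and]
  have h1 := hX.steps ω n
  constructor
  · rintro ⟨h, hA⟩
    exact ⟨hA, fun h' => by omega⟩
  · rintro ⟨hA, h⟩
    have h2 : X n ω = w (Fin.last n) := hA (Fin.last n)
    refine ⟨?_, hA⟩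
    rcases (abs_eq zero_le_one).1 h1 with h3 | h3
    · exact absurd hA (h (by omega))
    · omega

lemma measure_path_zero [IsProbabilityMeasure P] (hX : IsEARW P M p p₀ X) (w : Fin 1 → ℤ) :
    P {ω | ∀ m : Fin 1, X m ω = w m} = if w 0 = 0 then 1 else 0 := by
  have h : ∀ ω, (∀ m : Fin 1, X m ω = w m) ↔ w 0 = 0 := fun ω => by
    rw [Fin.forall_fin_one]
    exact ⟨fun h => h.symm.trans (hX.init ω), fun h => (hX.init ω).trans h.symm⟩
  simp only [h]
  split_ifs with h0 <;> simp [h0]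

lemma measure_path_succ [IsProbabilityMeasure P] (hX : IsEARW P M p p₀ X) (n : ℕ)
    (w : Fin (n + 2) → ℤ) (c : ℝ≥0∞)
    (hc : c = ENNReal.ofReal (cookieSeq M p p₀ ((Finset.univ.filter fun m : Fin (n + 1) =>
      Fin.init w m = Fin.init w (Fin.last n)).card - 1))) :
    P {ω | ∀ m : Fin (n + 2), X m ω = w m} =
      if w (Fin.last (n + 1)) = Fin.init w (Fin.last n) + 1 then
        c * P {ω | ∀ m : Fin (n + 1), X m ω = Fin.init w m}
      else if w (Fin.last (n + 1)) = Fin.init w (Fin.last n) - 1 then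
        P {ω | ∀ m : Fin (n + 1), X m ω = Fin.init w m} -
          c * P {ω | ∀ m : Fin (n + 1), X m ω = Fin.init w m}
      else 0 := by
  have hset : {ω | ∀ m : Fin (n + 2), X m ω = w m} =
      {ω | X (n + 1) ω = w (Fin.last (n + 1))} ∩
        {ω | ∀ m : Fin (n + 1), X m ω = Fin.init w m} := by
    ext ω
    simp only [Set.mem_inter_iff, Set.mem_ofPred_eq]
    rw [Fin.forall_fin_succ', and_comm]
    rfl
  rw [hset, hc, ← hX.cond]
  split_ifs with h1 h2
  · rw [h1]
  · rw [h2, hX.measure_left]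
  · refine measure_mono_null (fun ω hω => ?_) measure_empty
    obtain ⟨h3, h4⟩ := hω
    have h3 : X (n + 1) ω = w (Fin.last (n + 1)) := h3
    have h5 : X n ω = Fin.init w (Fin.last n) := h4 (Fin.last n)
    rcases (abs_eq zero_le_one).1 (hX.steps ω n) with h6 | h6 <;> omega

lemma measure_path_eq [IsProbabilityMeasure P] [IsProbabilityMeasure P']
    (hX : IsEARW P M p p₀ X) (hX' : IsEARW P' M p p₀ X') (n : ℕ) (w : Fin (n + 1) → ℤ) :
    P {ω | ∀ m : Fin (n + 1), X m ω = w m} = P' {ω | ∀ m : Fin (n + 1), X' m ω = w m} := by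
  induction n with
  | zero => rw [hX.measure_path_zero, hX'.measure_path_zero]
  | succ n ih =>
    rw [hX.measure_path_succ n w _ rfl, hX'.measure_path_succ n w _ rfl, ih]

lemma measurable_path (hX : IsEARW P M p p₀ X) : Measurable fun ω n => X n ω :=
  measurable_pi_lambda _ hX.measurable

/-- The law of an excited random walk is determined by its parameters. -/
lemma map_path_eq [IsProbabilityMeasure P] [IsProbabilityMeasure P']
    (hX : IsEARW P M p p₀ X) (hX' : IsEARW P' M p p₀ X') :
    P.map (fun ω n => X n ω) = P'.map (fun ω n => X' n ω) := by
  have hfin : ∀ n : ℕ, (P.map fun ω n => X n ω).map (fun (x : ℕ → ℤ) (m : Fin (n + 1)) => x m) =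
      (P'.map fun ω n => X' n ω).map (fun (x : ℕ → ℤ) (m : Fin (n + 1)) => x m) := by
    intro n
    have hm : Measurable fun (x : ℕ → ℤ) (m : Fin (n + 1)) => x m := by fun_prop
    refine Measure.ext_of_singleton fun w => ?_
    rw [Measure.map_apply hm (measurableSet_singleton w),
      Measure.map_apply hm (measurableSet_singleton w),
      Measure.map_apply hX.measurable_path (hm (measurableSet_singleton w)),
      Measure.map_apply hX'.measurable_path (hm (measurableSet_singleton w))]
    convert hX.measure_path_eq hX' n w using 2 <;> ext ω <;> simp [funext_iff]
  have := Measure.isProbabilityMeasure_map (μ := P) hX.measurable_path.aemeasurable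
  have := Measure.isProbabilityMeasure_map (μ := P') hX'.measurable_path.aemeasurable
  refine IsProjectiveLimit.unique (P := fun I => (P'.map fun ω n => X' n ω).map I.restrict)
    (fun I => ?_) fun I => rfl
  obtain ⟨n, hn⟩ := I.exists_nat_subset_range
  have hlt : ∀ i : I, (i : ℕ) < n + 1 := fun i =>
    (Finset.mem_range.1 (hn i.2)).trans (Nat.lt_succ_self n)
  have hcomp : (I.restrict : (ℕ → ℤ) → _) = (fun (y : Fin (n + 1) → ℤ) (i : I) => y ⟨i, hlt i⟩) ∘
      fun (x : ℕ → ℤ) (m : Fin (n + 1)) => x m := rfl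
  rw [hcomp, ← Measure.map_map (by fun_prop) (by fun_prop), hfin,
    Measure.map_map (by fun_prop) (by fun_prop)]
  rfl

lemma ae_of_ae [IsProbabilityMeasure P] [IsProbabilityMeasure P']
    (hX : IsEARW P M p p₀ X) (hX' : IsEARW P' M p p₀ X') {S : Set (ℕ → ℤ)} (hS : MeasurableSet S)
    (h : ∀ᵐ ω ∂P', (fun n => X' n ω) ∈ S) : ∀ᵐ ω ∂P, (fun n => X n ω) ∈ S := by
  refine ae_of_ae_map hX.measurable_path.aemeasurable (p := (· ∈ S)) ?_
  rw [hX.map_path_eq hX']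
  exact (ae_map_iff hX'.measurable_path.aemeasurable hS).2 h

/-- The reflection of an excited random walk is an excited random walk. -/
lemma neg [IsProbabilityMeasure P] (hX : IsEARW P M p (1 / 2) X)
    (hp : ∀ i, p i ∈ Set.Ioo (0 : ℝ) 1) :
    IsEARW P M (fun i => 1 - p i) (1 / 2) fun n ω => -X n ω where
  measurable n := (hX.measurable n).neg
  init ω := by rw [hX.init, neg_zero]
  steps ω n := by rw [← hX.steps ω n, ← abs_neg]; congr 1; ring
  cond n w := by
    have hset : {ω | ∀ m : Fin (n + 1), -X m ω = w m} =
        {ω | ∀ m : Fin (n + 1), X m ω = (-w) m} := by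
      simp only [Pi.neg_apply, neg_eq_iff_eq_neg]
    have hset' : {ω | -X (n + 1) ω = w (Fin.last n) + 1} =
        {ω | X (n + 1) ω = (-w) (Fin.last n) - 1} := by
      ext ω
      simp only [Pi.neg_apply, Set.mem_ofPred_eq]
      omega
    rw [hset, hset', hX.measure_left, hX.cond]
    simp only [Pi.neg_apply, neg_inj]
    set c := (Finset.univ.filter fun m : Fin (n + 1) => w m = w (Fin.last n)).card - 1
    have hc : cookieSeq M (fun i => 1 - p i) (1 / 2) c = 1 - cookieSeq M p (1 / 2) c := by
      unfold cookieSeq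
      split_ifs <;> norm_num
    have hc0 : 0 ≤ cookieSeq M p (1 / 2) c := by
      unfold cookieSeq
      split_ifs
      · exact (hp _).1.le
      · norm_num
    rw [hc, ENNReal.ofReal_sub _ hc0, ENNReal.ofReal_one,
      ENNReal.sub_mul fun _ _ => measure_ne_top _ _, one_mul]

end IsEARW

namespace IsEARW


variable {Ω : Type*} [MeasurableSpace Ω] {P : Measure Ω} {M : ℕ} {p : Fin M → ℝ}
  {X : ℕ → Ω → ℤ}

lemma cookieSeq_mem_Ioo (hp : ∀ i, p i ∈ Set.Ioo (0 : ℝ) 1) (j : ℕ) :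
    cookieSeq M p (1 / 2) j ∈ Set.Ioo (0 : ℝ) 1 := by
  unfold cookieSeq
  split_ifs
  · exact hp _
  · norm_num

lemma sum_range_cookieSeq :
    ∑ j ∈ Finset.range M, (2 * cookieSeq M p (1 / 2) j - 1) = ∑ i, (2 * p i - 1) := by
  rw [Finset.sum_range]
  simp [cookieSeq]

lemma cookieSeq_of_le {p₀ : ℝ} {j : ℕ} (hj : M ≤ j) : cookieSeq M p p₀ j = p₀ :=
  dif_neg (not_lt.2 hj)

/-- The probabilities of an excited random walk as points of the unit interval. -/
noncomputable def cookieProb (hp : ∀ i, p i ∈ Set.Ioo (0 : ℝ) 1) (j : ℕ) : unitInterval :=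
  ⟨cookieSeq M p (1 / 2) j, Set.Ioo_subset_Icc_self (cookieSeq_mem_Ioo hp j)⟩

lemma ae_tendsto_of_two_lt [IsProbabilityMeasure P] (hX : IsEARW P M p (1 / 2) X)
    (hp : ∀ i, p i ∈ Set.Ioo (0 : ℝ) 1) (hδ : 2 < ∑ i, (2 * p i - 1)) :
    ∃ v > 0, ∀ᵐ ω ∂P, Tendsto (fun n : ℕ => (X n ω : ℝ) / n) atTop (𝓝 v) := by
  obtain ⟨v, hv, h⟩ := ExcitedWalk.ae_tendsto_pos_div (q := cookieProb hp) (M := M)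
    (fun j hj => cookieSeq_of_le hj) (fun j => (cookieSeq_mem_Ioo hp j).1)
    (hδ.trans_eq sum_range_cookieSeq.symm)
  refine ⟨v, hv, hX.ae_of_ae (ExcitedWalk.isEARW_pos fun j => rfl)
    (S := {x | Tendsto (fun n : ℕ => (x n : ℝ) / n) atTop (𝓝 v)}) ?_ h⟩
  exact measurableSet_tendsto _ fun n => by fun_prop

lemma ae_eventually_div_le [IsProbabilityMeasure P] (hX : IsEARW P M p (1 / 2) X)
    (hp : ∀ i, p i ∈ Set.Ioo (0 : ℝ) 1) (hδ : ∑ i, (2 * p i - 1) ≤ 2) :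
    ∀ᵐ ω ∂P, ∀ ε > 0, ∀ᶠ n : ℕ in atTop, (X n ω : ℝ) / n ≤ ε := by
  have h := ExcitedWalk.ae_eventually_pos_div_le (q := cookieProb hp) (M := M)
    (fun j hj => cookieSeq_of_le hj) (fun j => (cookieSeq_mem_Ioo hp j).2)
    (sum_range_cookieSeq.trans_le hδ)
  have key : ∀ k : ℕ, ∀ᵐ ω ∂P, ∀ᶠ n : ℕ in atTop, (X n ω : ℝ) / n ≤ 1 / ((k : ℝ) + 1) := by
    intro k
    refine hX.ae_of_ae (ExcitedWalk.isEARW_pos (q := cookieProb hp) fun j => rfl)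
      (S := {x | ∀ᶠ n : ℕ in atTop, (x n : ℝ) / n ≤ 1 / ((k : ℝ) + 1)}) ?_ ?_
    · simp only [eventually_atTop, Set.ofPred_exists, Set.ofPred_forall]
      exact MeasurableSet.iUnion fun a => MeasurableSet.iInter fun n =>
        MeasurableSet.iInter fun _ => measurableSet_le (by fun_prop) measurable_const
    · filter_upwards [h] with e he
      exact he _ (by positivity)
  filter_upwards [ae_all_iff.2 key] with ω hω ε hε
  obtain ⟨k, hk⟩ := exists_nat_one_div_lt hε
  exact (hω k).mono fun n hn => hn.trans hk.le

end IsEARW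

/-- **Speed of a standard excited random walk (qualitative behaviour).**
`Y n / n` converges a.s. to a deterministic constant `v(M,p)`; moreover
`v(M,p) > 0` iff `δ(M,p) > 2`, and `v(M,p) = 0` iff `-2 ≤ δ(M,p) ≤ 2`,
where `δ(M,p) = ∑ i, (2 p i - 1)`. -/
theorem excited_rw_speed_trichotomy
    {Ω : Type*} [MeasurableSpace Ω] (P : Measure Ω) [IsProbabilityMeasure P]
    (M : ℕ) (hM : 1 ≤ M) (p : Fin M → ℝ) (hp : ∀ i, p i ∈ Set.Ioo (0 : ℝ) 1)
    (Y : ℕ → Ω → ℤ) (hY : IsEARW P M p (1 / 2) Y) :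
    ∃ v : ℝ,
      (∀ᵐ ω ∂P, Tendsto (fun n : ℕ => (Y n ω : ℝ) / n) atTop (nhds v))
      ∧ (0 < v ↔ 2 < ∑ i, (2 * p i - 1))
      ∧ (v = 0 ↔ -2 ≤ ∑ i, (2 * p i - 1) ∧ ∑ i, (2 * p i - 1) ≤ 2) := by
  have hp' : ∀ i, 1 - p i ∈ Set.Ioo (0 : ℝ) 1 := fun i =>
    ⟨by linarith [(hp i).2], by linarith [(hp i).1]⟩
  have hsum : ∑ i, (2 * (1 - p i) - 1) = -∑ i, (2 * p i - 1) := by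
    rw [← Finset.sum_neg_distrib]
    exact Finset.sum_congr rfl fun i _ => by ring
  have hY' := hY.neg hp
  rcases lt_or_ge 2 (∑ i, (2 * p i - 1)) with h₁ | h₁
  · obtain ⟨v, hv, h⟩ := hY.ae_tendsto_of_two_lt hp h₁
    exact ⟨v, h, iff_of_true hv h₁, iff_of_false hv.ne' fun h => by linarith [h.2]⟩
  rcases lt_or_ge (∑ i, (2 * p i - 1)) (-2) with h₂ | h₂
  · obtain ⟨v, hv, h⟩ := hY'.ae_tendsto_of_two_lt hp' (by rw [hsum]; linarith)
    refine ⟨-v, ?_, iff_of_false (by linarith) (by linarith),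
      iff_of_false (by linarith) fun h => by linarith [h.1]⟩
    filter_upwards [h] with ω hω
    simpa [neg_div] using hω.neg
  · refine ⟨0, ?_, iff_of_false (lt_irrefl _) h₁.not_gt, iff_of_true rfl ⟨h₂, h₁⟩⟩
    filter_upwards [hY.ae_eventually_div_le hp h₁,
      hY'.ae_eventually_div_le hp' (by rw [hsum]; linarith)] with ω hω hω'
    rw [Metric.tendsto_nhds]
    intro ε hε
    filter_upwards [hω (ε / 2) (half_pos hε), hω' (ε / 2) (half_pos hε)] with n hn hn'
    rw [Int.cast_neg, neg_div] at hn'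
    rw [Real.dist_eq, sub_zero, abs_lt]
    constructor <;> linarith
end

section
/- Let p_1 ∈ (0,1) and p_0 ∈ (1/2,1), and let (X_n)_{n≥0} be an excited asymmetric random walk with one cookie of strength p_1 and bias parameter p_0. Then almost surely lim_{n→∞} X_n / n = (2p_0 − 1) / (2p_0 − 1 + 2(1 − p_1)). -/
open MeasureTheory ProbabilityTheory Filter Topology

/-- The set of sites visited strictly before time `n`. -/
def visited (x : ℕ → ℤ) (n : ℕ) : Finset ℤ := (Finset.range n).image x

lemma visited_succ (x : ℕ → ℤ) (n : ℕ) : visited x (n + 1) = insert (x n) (visited x n) := by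
  simp [visited, Finset.range_add_one]

lemma visited_mono (x : ℕ → ℤ) : Monotone (visited x) := fun _ _ h =>
  Finset.image_subset_image (Finset.range_mono h)

lemma Ico_subset_visited {x : ℕ → ℤ} (h0 : x 0 = 0) (hx : ∀ n, |x (n + 1) - x n| = 1) (n : ℕ) :
    Finset.Ico 0 (x n) ⊆ visited x n := by
  induction n with
  | zero => simp [h0]
  | succ n ih =>
    intro v hv
    rw [visited_succ, Finset.mem_insert]
    rw [Finset.mem_Ico] at hv
    have := (abs_le.1 (hx n).le).2
    rcases eq_or_ne v (x n) with h | h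
    · exact Or.inl h
    · exact Or.inr (ih (Finset.mem_Ico.2 ⟨hv.1, by omega⟩))

lemma abs_sub_le_of_steps {x : ℕ → ℤ} (hx : ∀ n, |x (n + 1) - x n| = 1) {s n : ℕ} (h : s ≤ n) :
    |x n - x s| ≤ (n : ℤ) - s := by
  induction n, h using Nat.le_induction with
  | base => simp
  | succ n _ ih =>
    have := abs_add_le (x (n + 1) - x n) (x n - x s)
    rw [hx n, sub_add_sub_cancel] at this
    push_cast
    linarith

/-- If the position is `c n - 2 a |visited x n|` up to an error `e`, then the walk does not go
further left than a multiple of `e`. -/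
lemma neg_le_of_error_bound {x : ℕ → ℤ} (h0 : x 0 = 0) (hx : ∀ n, |x (n + 1) - x n| = 1)
    {c a e : ℝ} (hc : 0 < c) (ha : 2 * a < c + 1) {n : ℕ}
    (he : ∀ k ≤ n, |(x k : ℝ) - (c * k - 2 * a * (visited x k).card)| ≤ e) {k : ℕ} (hk : k ≤ n) :
    -(x k : ℝ) ≤ (2 * e + 2 * |a|) / min (c + 1) (c + 1 - 2 * a) := by
  have hδ : 0 < min (c + 1) (c + 1 - 2 * a) := lt_min (by linarith) (by linarith)
  have he0 : 0 ≤ e := (abs_nonneg _).trans (he k hk)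
  obtain ⟨l, hl, hmin⟩ := Finset.exists_min_image (Finset.range (n + 1)) x ⟨0, by simp⟩
  have hln : l ≤ n := by simpa [Nat.lt_succ_iff] using hl
  have hkl : x l ≤ x k := hmin k (by simp; omega)
  refine le_trans (b := -(x l : ℝ)) (by exact_mod_cast neg_le_neg hkl) ?_
  rw [le_div_iff₀ hδ]
  by_cases hneg : 0 ≤ x l
  · have : (0 : ℝ) ≤ x l := by exact_mod_cast hneg
    nlinarith [abs_nonneg a]
  obtain ⟨s, hsl, hs0, hsneg⟩ : ∃ s ≤ l, 0 ≤ x s ∧ ∀ j, s < j → j ≤ l → x j < 0 := by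
    refine ⟨Nat.findGreatest (fun j => 0 ≤ x j) l, Nat.findGreatest_le _, ?_, ?_⟩
    · exact Nat.findGreatest_spec (P := fun j => 0 ≤ x j) (Nat.zero_le l) h0.ge
    · intro j h1 h2
      simpa using Nat.findGreatest_is_greatest h1 h2
  have hsub : visited x l ⊆ visited x s ∪ insert (x s) (Finset.Ico (x l) 0) := by
    intro v hv
    obtain ⟨j, hj, rfl⟩ := Finset.mem_image.1 hv
    rw [Finset.mem_range] at hj
    rw [Finset.mem_union, Finset.mem_insert, Finset.mem_Ico]
    rcases lt_trichotomy j s with h | h | h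
    · exact Or.inl (Finset.mem_image_of_mem x (Finset.mem_range.2 h))
    · exact Or.inr (Or.inl (h ▸ rfl))
    · exact Or.inr (Or.inr ⟨hmin j (by simp; omega), hsneg j h hj.le⟩)
  have hcard : ((visited x l).card : ℤ) ≤ (visited x s).card + (-(x l) + 1) := by
    have h1 := (Finset.card_le_card hsub).trans (Finset.card_union_le _ _)
    have h2 := Finset.card_insert_le (x s) (Finset.Ico (x l) 0)
    rw [Int.card_Ico] at h2
    omega
  have hcard' : ((visited x l).card : ℝ) ≤ (visited x s).card + (-(x l) + 1) := by
    exact_mod_cast hcard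
  have hmono : ((visited x s).card : ℝ) ≤ (visited x l).card := by
    exact_mod_cast Finset.card_le_card (visited_mono x hsl)
  have htime : -(x l : ℝ) ≤ l - s := by
    have := (abs_le.1 (abs_sub_le_of_steps hx hsl)).1
    have h3 : -(x l) ≤ (l : ℤ) - s := by linarith
    exact_mod_cast h3
  have h1 := abs_le.1 (he l hln)
  have h2 := abs_le.1 (he s (hsl.trans hln))
  have hs0' : (0 : ℝ) ≤ x s := by exact_mod_cast hs0
  have hl0 : (0 : ℝ) < -(x l) := by
    have : (x l : ℝ) < 0 := by exact_mod_cast not_le.1 hneg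
    linarith
  have hct : c * -(x l : ℝ) ≤ c * (l - s) := mul_le_mul_of_nonneg_left htime hc.le
  rcases le_total a 0 with h | h
  · have hmul := mul_nonneg (neg_nonneg.2 h) (sub_nonneg.2 hmono)
    have := mul_le_mul_of_nonneg_left (min_le_left (c + 1) (c + 1 - 2 * a)) hl0.le
    nlinarith [abs_nonneg a]
  · have hmul := mul_le_mul_of_nonneg_left hcard' h
    have := mul_le_mul_of_nonneg_left (min_le_right (c + 1) (c + 1 - 2 * a)) hl0.le
    rw [abs_of_nonneg h]
    nlinarith

/-- If the position is `c n - 2 a |visited x n|` up to an error `e`, then the range and the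
position differ by at most a multiple of `e`. -/
lemma abs_card_visited_sub_le {x : ℕ → ℤ} (h0 : x 0 = 0) (hx : ∀ n, |x (n + 1) - x n| = 1)
    {c a e B : ℝ} (hc : 0 < c) {n : ℕ}
    (he : ∀ k ≤ n, |(x k : ℝ) - (c * k - 2 * a * (visited x k).card)| ≤ e)
    (hB : ∀ k ≤ n, -(x k : ℝ) ≤ B) :
    |((visited x n).card : ℝ) - x n| ≤ 2 * e + (2 * |a| + 1) * (B + 1) := by
  obtain ⟨s, hs, hmax⟩ := Finset.exists_max_image (Finset.range (n + 1)) x ⟨0, by simp⟩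
  have hsn : s ≤ n := by simpa [Nat.lt_succ_iff] using hs
  have hB0 : 0 ≤ B := by simpa [h0] using hB 0 (Nat.zero_le n)
  have hS : 0 ≤ x s := h0 ▸ hmax 0 (by simp)
  have hlow (k : ℕ) : (x k : ℝ) ≤ (visited x k).card := by
    have := Finset.card_le_card (Ico_subset_visited h0 hx k)
    rw [Int.card_Ico] at this
    have h : x k ≤ (visited x k).card := by omega
    exact_mod_cast h
  have hup : ((visited x n).card : ℝ) ≤ x s + B + 1 := by
    have hsub : visited x n ⊆ Finset.Icc (-⌊B⌋) (x s) := by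
      intro v hv
      obtain ⟨j, hj, rfl⟩ := Finset.mem_image.1 hv
      rw [Finset.mem_range] at hj
      rw [Finset.mem_Icc]
      refine ⟨?_, hmax j (by simp; omega)⟩
      have : -(x j) ≤ ⌊B⌋ := Int.le_floor.2 (by exact_mod_cast hB j hj.le)
      linarith
    have h := Finset.card_le_card hsub
    rw [Int.card_Icc] at h
    have hf : 0 ≤ ⌊B⌋ := Int.floor_nonneg.2 hB0
    have h' : ((visited x n).card : ℤ) ≤ x s + ⌊B⌋ + 1 := by omega
    have h'' : ((visited x n).card : ℝ) ≤ x s + ⌊B⌋ + 1 := by exact_mod_cast h'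
    linarith [Int.floor_le B]
  have hmono : ((visited x s).card : ℝ) ≤ (visited x n).card := by
    exact_mod_cast Finset.card_le_card (visited_mono x hsn)
  have h1 := abs_le.1 (he n le_rfl)
  have h2 := abs_le.1 (he s hsn)
  have hls := hlow s
  have hln := hlow n
  have hct : 0 ≤ c * ((n : ℝ) - s) :=
    mul_nonneg hc.le (sub_nonneg.2 (by exact_mod_cast hsn))
  have hΔ : a * ((visited x n).card - (visited x s).card : ℝ) ≤ |a| * (B + 1) :=
    mul_le_mul (le_abs_self a) (by linarith) (by linarith) (abs_nonneg a)
  rw [abs_of_nonneg (by linarith)]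
  nlinarith

lemma tendsto_div_of_forall_abs_sub_le {u : ℕ → ℝ} {v C D : ℝ}
    (h : ∀ ε > 0, ∃ K, ∀ n : ℕ, |u n - v * n| ≤ C * (ε * n + K) + D) :
    Tendsto (fun n : ℕ => u n / n) atTop (𝓝 v) := by
  rw [Metric.tendsto_atTop]
  intro ε hε
  obtain ⟨K, hK⟩ := h (ε / (2 * (|C| + 1))) (by positivity)
  obtain ⟨N, hN⟩ := exists_nat_gt ((C * K + D) / (ε / 2))
  refine ⟨N + 1, fun n hn => ?_⟩
  have hn0 : (0 : ℝ) < n := by exact_mod_cast (by omega : 0 < n)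
  have hNn : (N : ℝ) ≤ n := by exact_mod_cast (by omega : N ≤ n)
  rw [Real.dist_eq, div_sub' hn0.ne', abs_div, abs_of_pos hn0, div_lt_iff₀ hn0, mul_comm (n : ℝ) v]
  refine (hK n).trans_lt ?_
  have h1 : C * K + D < n * (ε / 2) := (div_lt_iff₀ (by positivity)).1 (hN.trans_le hNn)
  have h2 : C * (ε / (2 * (|C| + 1)) * n) ≤ ε / 2 * n := by
    have : C * (ε / (2 * (|C| + 1))) ≤ ε / 2 := by
      rw [mul_div_assoc', div_le_div_iff₀ (by positivity) (by positivity)]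
      nlinarith [le_abs_self C]
    nlinarith
  linarith

lemma exists_abs_le_of_tendsto_div {u : ℕ → ℝ}
    (h : Tendsto (fun n : ℕ => u n / n) atTop (𝓝 0)) {ε : ℝ} (hε : 0 < ε) :
    ∃ K, ∀ n : ℕ, |u n| ≤ ε * n + K := by
  obtain ⟨N, hN⟩ := (Metric.tendsto_atTop.1 h) ε hε
  refine ⟨∑ i ∈ Finset.range (N + 1), |u i|, fun n => ?_⟩
  have hsum : 0 ≤ ∑ i ∈ Finset.range (N + 1), |u i| := Finset.sum_nonneg fun _ _ => abs_nonneg _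
  rcases le_or_gt n N with hn | hn
  · have := Finset.single_le_sum (f := fun i => |u i|) (fun _ _ => abs_nonneg _)
      (Finset.mem_range.2 (Nat.lt_succ_of_le hn))
    have : 0 ≤ ε * n := by positivity
    linarith
  · have hn0 : (0 : ℝ) < n := by exact_mod_cast (by omega : 0 < n)
    have := hN n hn.le
    rw [Real.dist_eq, sub_zero, abs_div, abs_of_pos hn0, div_lt_iff₀ hn0] at this
    linarith

/-- A nearest-neighbour path whose position is `c n - 2 a |visited x n| + o(n)` has speed
`c / (1 + 2 a)`. -/
theorem tendsto_speed_of_error {x : ℕ → ℤ} (h0 : x 0 = 0) (hx : ∀ n, |x (n + 1) - x n| = 1)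
    {c a : ℝ} (hc : 0 < c) (ha : 2 * a < c + 1) (ha' : 0 < 1 + 2 * a)
    (he : Tendsto (fun n : ℕ => ((x n : ℝ) - (c * n - 2 * a * (visited x n).card)) / n)
      atTop (𝓝 0)) :
    Tendsto (fun n : ℕ => (x n : ℝ) / n) atTop (𝓝 (c / (1 + 2 * a))) := by
  set δ := min (c + 1) (c + 1 - 2 * a) with hδdef
  have hδ : 0 < δ := lt_min (by linarith) (by linarith)
  refine tendsto_div_of_forall_abs_sub_le
    (C := (1 + 2 * |a| * (2 + (2 * |a| + 1) * (2 / δ))) / (1 + 2 * a))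
    (D := 2 * |a| * ((2 * |a| + 1) * (2 * |a| / δ + 1)) / (1 + 2 * a)) fun ε hε => ?_
  obtain ⟨K, hK⟩ := exists_abs_le_of_tendsto_div he hε
  refine ⟨K, fun n => ?_⟩
  have hen : ∀ k ≤ n, |(x k : ℝ) - (c * k - 2 * a * (visited x k).card)| ≤ ε * n + K := by
    intro k hk
    refine (hK k).trans ?_
    have : (k : ℝ) ≤ n := by exact_mod_cast hk
    gcongr
  have hR := abs_card_visited_sub_le h0 hx hc hen
    fun k hk => neg_le_of_error_bound h0 hx hc ha hen hk
  rw [← hδdef] at hR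
  generalize hE : ε * n + K = E at *
  have hn := hen n le_rfl
  generalize hRn : ((visited x n).card : ℝ) = R at *
  have key : (x n : ℝ) - c / (1 + 2 * a) * n
      = ((x n - (c * n - 2 * a * R)) + 2 * a * (x n - R)) / (1 + 2 * a) := by
    field_simp
    ring
  have hbd : |((x n : ℝ) - (c * n - 2 * a * R)) + 2 * a * (x n - R)|
      ≤ E + 2 * |a| * (2 * E + (2 * |a| + 1) * ((2 * E + 2 * |a|) / δ + 1)) := by
    refine (abs_add_le _ _).trans (add_le_add hn ?_)
    rw [abs_mul, abs_mul, abs_two, abs_sub_comm]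
    gcongr
  rw [key, abs_div, abs_of_pos ha']
  refine (div_le_div_of_nonneg_right hbd ha'.le).trans (le_of_eq ?_)
  field_simp
  ring

/-- The increment of the walk minus its conditional mean given the past. -/
noncomputable def centeredStep (p₁ p₀ : ℝ) (x : ℕ → ℤ) (n : ℕ) : ℝ :=
  ((x (n + 1) : ℝ) - x n) - if x n ∈ visited x n then 2 * p₀ - 1 else 2 * p₁ - 1

/-- The martingale part of the walk. -/
noncomputable def walkMartingale (p₁ p₀ : ℝ) (x : ℕ → ℤ) (n : ℕ) : ℝ :=
  ∑ k ∈ Finset.range n, centeredStep p₁ p₀ x k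

lemma walkMartingale_succ (p₁ p₀ : ℝ) (x : ℕ → ℤ) (n : ℕ) :
    walkMartingale p₁ p₀ x (n + 1) = walkMartingale p₁ p₀ x n + centeredStep p₁ p₀ x n :=
  Finset.sum_range_succ _ _

lemma walkMartingale_eq (p₁ p₀ : ℝ) {x : ℕ → ℤ} (h0 : x 0 = 0) (n : ℕ) :
    walkMartingale p₁ p₀ x n
      = x n - ((2 * p₀ - 1) * n - 2 * (p₀ - p₁) * (visited x n).card) := by
  induction n with
  | zero => simp [walkMartingale, visited, h0]
  | succ n ih =>
    rw [walkMartingale_succ, ih, visited_succ, centeredStep]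
    split_ifs with h
    · rw [Finset.insert_eq_of_mem h]
      push_cast
      ring
    · rw [Finset.card_insert_of_notMem h]
      push_cast
      ring

lemma abs_centeredStep_le {p₁ p₀ : ℝ} (hp₁ : p₁ ∈ Set.Ioo (0 : ℝ) 1)
    (hp₀ : p₀ ∈ Set.Ioo (0 : ℝ) 1) {x : ℕ → ℤ} (hx : ∀ n, |x (n + 1) - x n| = 1) (n : ℕ) :
    |centeredStep p₁ p₀ x n| ≤ 2 := by
  have h1 : |(x (n + 1) : ℝ) - x n| = 1 := by exact_mod_cast hx n
  obtain ⟨h2, h3⟩ := hp₁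
  obtain ⟨h4, h5⟩ := hp₀
  have h6 := abs_le.1 h1.le
  rw [centeredStep, abs_le]
  split_ifs <;> constructor <;> linarith

lemma visited_congr {x y : ℕ → ℤ} {n : ℕ} (h : ∀ j < n, x j = y j) : visited x n = visited y n :=
  Finset.image_congr fun j hj => h j (by simpa using hj)

lemma walkMartingale_congr (p₁ p₀ : ℝ) {x y : ℕ → ℤ} {n : ℕ} (h : ∀ j ≤ n, x j = y j) :
    walkMartingale p₁ p₀ x n = walkMartingale p₁ p₀ y n := by
  refine Finset.sum_congr rfl fun k hk => ?_
  rw [Finset.mem_range] at hk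
  rw [centeredStep, centeredStep, h k hk.le, h (k + 1) hk,
    visited_congr fun j hj => h j (hj.le.trans hk.le)]

namespace IsEARW

variable {Ω : Type*} [MeasurableSpace Ω] {P : Measure Ω} {p₁ p₀ : ℝ} {X : ℕ → Ω → ℤ}

lemma measurable_centeredStep (hX : IsEARW P 1 (fun _ => p₁) p₀ X) (n : ℕ) :
    Measurable fun ω => centeredStep p₁ p₀ (X · ω) n := by
  have hcast (k : ℕ) : Measurable fun ω => (X k ω : ℝ) :=
    (measurable_of_countable (fun z : ℤ => (z : ℝ))).comp (hX.measurable k)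
  have hset : MeasurableSet {ω | X n ω ∈ visited (X · ω) n} := by
    have : {ω | X n ω ∈ visited (X · ω) n} = ⋃ j ∈ Finset.range n, {ω | X j ω = X n ω} := by
      ext ω
      simp [visited]
    rw [this]
    exact Finset.measurableSet_biUnion _ fun j _ =>
      measurableSet_eq_fun (hX.measurable j) (hX.measurable n)
  exact ((hcast (n + 1)).sub (hcast n)).sub (Measurable.ite hset measurable_const measurable_const)

lemma measurable_walkMartingale (hX : IsEARW P 1 (fun _ => p₁) p₀ X) (n : ℕ) :
    Measurable fun ω => walkMartingale p₁ p₀ (X · ω) n :=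
  Finset.measurable_fun_sum _ fun k _ => hX.measurable_centeredStep k

lemma abs_walkMartingale_le (hX : IsEARW P 1 (fun _ => p₁) p₀ X) (hp₁ : p₁ ∈ Set.Ioo (0 : ℝ) 1)
    (hp₀ : p₀ ∈ Set.Ioo (0 : ℝ) 1) (n : ℕ) (ω : Ω) :
    |walkMartingale p₁ p₀ (X · ω) n| ≤ n * 2 := by
  refine (Finset.abs_sum_le_sum_abs _ _).trans ?_
  simpa using Finset.sum_le_card_nsmul (Finset.range n) _ 2
    fun k _ => abs_centeredStep_le hp₁ hp₀ (hX.steps ω) k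

lemma measurableSet_path (hX : IsEARW P 1 (fun _ => p₁) p₀ X) (n : ℕ) (w : Fin (n + 1) → ℤ) :
    MeasurableSet {ω | ∀ m : Fin (n + 1), X m ω = w m} := by
  rw [Set.ofPred_forall]
  exact MeasurableSet.iInter fun m => hX.measurable m (measurableSet_singleton (w m))

lemma integrable_centeredStep [IsProbabilityMeasure P] (hX : IsEARW P 1 (fun _ => p₁) p₀ X)
    (hp₁ : p₁ ∈ Set.Ioo (0 : ℝ) 1) (hp₀ : p₀ ∈ Set.Ioo (0 : ℝ) 1) (n : ℕ) :
    Integrable (fun ω => centeredStep p₁ p₀ (X · ω) n) P :=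
  Integrable.of_bound (hX.measurable_centeredStep n).aestronglyMeasurable 2
    (ae_of_all _ fun ω => abs_centeredStep_le hp₁ hp₀ (hX.steps ω) n)

/-- The success probability on a cylinder depends only on whether its endpoint is fresh. -/
lemma cookieSeq_one_eq {n : ℕ} {w : Fin (n + 1) → ℤ} {x : ℕ → ℤ}
    (h : ∀ m : Fin (n + 1), x m = w m) :
    cookieSeq 1 (fun _ => p₁) p₀
        ((Finset.univ.filter fun m : Fin (n + 1) => w m = w (Fin.last n)).card - 1)
      = if x n ∈ visited x n then p₀ else p₁ := by
  have hlast : x n = w (Fin.last n) := by simpa using h (Fin.last n)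
  have hmem : Fin.last n ∈ Finset.univ.filter fun m : Fin (n + 1) => w m = w (Fin.last n) := by
    simp
  unfold cookieSeq
  split_ifs with h1 h2 h2
  · exfalso
    obtain ⟨j, hj, hjn⟩ := Finset.mem_image.1 h2
    rw [Finset.mem_range] at hj
    have hcard : (Finset.univ.filter fun m : Fin (n + 1) => w m = w (Fin.last n)).card ≤ 1 := by
      omega
    have := Finset.card_le_one.1 hcard ⟨j, by omega⟩
      (by simp [← h, hjn]) _ hmem
    have := congrArg Fin.val this
    simp at this
    omega
  · rfl
  · rfl
  · exfalso
    have hcard : 1 < (Finset.univ.filter fun m : Fin (n + 1) => w m = w (Fin.last n)).card := by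
      omega
    obtain ⟨m, hm, hne⟩ := Finset.exists_mem_ne hcard (Fin.last n)
    refine h2 (Finset.mem_image.2 ⟨m, ?_, ?_⟩)
    · exact Finset.mem_range.2 (Fin.val_lt_last hne)
    · rw [h m, hlast]
      exact (Finset.mem_filter.1 hm).2

/-- The centered step has mean zero on every cylinder. -/
lemma setIntegral_centeredStep [IsProbabilityMeasure P] (hX : IsEARW P 1 (fun _ => p₁) p₀ X)
    (hp₁ : p₁ ∈ Set.Ioo (0 : ℝ) 1) (hp₀ : p₀ ∈ Set.Ioo (0 : ℝ) 1) (n : ℕ)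
    (w : Fin (n + 1) → ℤ) :
    ∫ ω in {ω | ∀ m : Fin (n + 1), X m ω = w m}, centeredStep p₁ p₀ (X · ω) n ∂P = 0 := by
  set A := {ω | ∀ m : Fin (n + 1), X m ω = w m} with hA
  have hAm : MeasurableSet A := hX.measurableSet_path n w
  rcases A.eq_empty_or_nonempty with hemp | ⟨ω₀, hω₀⟩
  · simp [hemp]
  set B := {ω | X (n + 1) ω = w (Fin.last n) + 1} with hB
  have hBm : MeasurableSet B := hX.measurable (n + 1) (measurableSet_singleton _)
  set q := if X n ω₀ ∈ visited (X · ω₀) n then p₀ else p₁ with hq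
  have hq0 : 0 ≤ q := by
    rw [hq]; split_ifs
    exacts [hp₀.1.le, hp₁.1.le]
  have hcond : P.real (B ∩ A) = q * P.real A := by
    have := hX.cond n w
    rw [cookieSeq_one_eq (x := (X · ω₀)) hω₀] at this
    rw [Measure.real, this, ENNReal.toReal_mul, ENNReal.toReal_ofReal hq0, Measure.real]
  have hEq : Set.EqOn (fun ω => centeredStep p₁ p₀ (X · ω) n)
      (fun ω => B.indicator (fun _ => (2 : ℝ)) ω - 2 * q) A := by
    intro ω hω
    have hagree : ∀ j ≤ n, X j ω = X j ω₀ := fun j hj => by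
      rw [hω ⟨j, by omega⟩, hω₀ ⟨j, by omega⟩]
    have hv : visited (X · ω) n = visited (X · ω₀) n :=
      visited_congr fun j hj => hagree j hj.le
    have hlast : X n ω = w (Fin.last n) := by simpa using hω (Fin.last n)
    have hd : (if X n ω ∈ visited (X · ω) n then 2 * p₀ - 1 else 2 * p₁ - 1) = 2 * q - 1 := by
      rw [hv, hagree n le_rfl, hq]
      split_ifs <;> rfl
    simp only [centeredStep, hd]
    by_cases hωB : ω ∈ B
    · rw [Set.indicator_of_mem hωB]
      have : X (n + 1) ω = X n ω + 1 := by rw [hlast]; exact hωB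
      rw [this]; push_cast; ring
    · rw [Set.indicator_of_notMem hωB]
      have : X (n + 1) ω = X n ω - 1 := by
        have h1 := hX.steps ω n
        have h2 : X (n + 1) ω ≠ X n ω + 1 := by rw [hlast]; exact hωB
        rcases (abs_eq zero_le_one).1 h1 with h | h <;> omega
      rw [this]; push_cast; ring
  rw [setIntegral_congr_fun hAm hEq, integral_sub
    ((integrable_const _).indicator hBm) (integrable_const _),
    integral_indicator hBm, Measure.restrict_restrict hBm]
  simp only [integral_const, measureReal_restrict_apply_univ, smul_eq_mul, hcond]
  ring

lemma integral_walkMartingale_mul_centeredStep [IsProbabilityMeasure P]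
    (hX : IsEARW P 1 (fun _ => p₁) p₀ X)
    (hp₁ : p₁ ∈ Set.Ioo (0 : ℝ) 1) (hp₀ : p₀ ∈ Set.Ioo (0 : ℝ) 1) (n : ℕ) :
    ∫ ω, walkMartingale p₁ p₀ (X · ω) n * centeredStep p₁ p₀ (X · ω) n ∂P = 0 := by
  have hprod : Integrable
      (fun ω => walkMartingale p₁ p₀ (X · ω) n * centeredStep p₁ p₀ (X · ω) n) P :=
    (hX.integrable_centeredStep hp₁ hp₀ n).bdd_mul
      (hX.measurable_walkMartingale n).aestronglyMeasurable
      (ae_of_all _ fun ω => hX.abs_walkMartingale_le hp₁ hp₀ n ω)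
  have hcover : ⋃ w : Fin (n + 1) → ℤ, {ω | ∀ m : Fin (n + 1), X m ω = w m} = Set.univ :=
    Set.iUnion_eq_univ_iff.2 fun ω => ⟨fun m => X m ω, fun _ => rfl⟩
  rw [← setIntegral_univ, ← hcover, integral_iUnion (fun w => hX.measurableSet_path n w)
    (fun w w' hne => Set.disjoint_left.2 fun ω h h' => hne <|
      funext fun m => (h m).symm.trans (h' m))
    hprod.integrableOn]
  refine (tsum_congr fun w => ?_).trans tsum_zero
  rcases Set.eq_empty_or_nonempty {ω | ∀ m : Fin (n + 1), X m ω = w m} with hemp | ⟨ω₀, hω₀⟩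
  · simp [hemp]
  · rw [setIntegral_congr_fun (g := fun ω =>
      walkMartingale p₁ p₀ (X · ω₀) n * centeredStep p₁ p₀ (X · ω) n) (hX.measurableSet_path n w),
      integral_const_mul, hX.setIntegral_centeredStep hp₁ hp₀ n w, mul_zero]
    intro ω hω
    simp only
    rw [walkMartingale_congr p₁ p₀ (x := (X · ω)) (y := (X · ω₀))]
    intro j hj
    exact (hω ⟨j, by omega⟩).trans (hω₀ ⟨j, by omega⟩).symm

lemma integrable_walkMartingale_sq [IsProbabilityMeasure P]
    (hX : IsEARW P 1 (fun _ => p₁) p₀ X)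
    (hp₁ : p₁ ∈ Set.Ioo (0 : ℝ) 1) (hp₀ : p₀ ∈ Set.Ioo (0 : ℝ) 1) (n : ℕ) :
    Integrable (fun ω => walkMartingale p₁ p₀ (X · ω) n ^ 2) P :=
  Integrable.of_bound ((hX.measurable_walkMartingale n).pow_const 2).aestronglyMeasurable
    ((n * 2 : ℝ) ^ 2) (ae_of_all _ fun ω => by
      rw [Real.norm_eq_abs, abs_pow]
      exact pow_le_pow_left₀ (abs_nonneg _) (hX.abs_walkMartingale_le hp₁ hp₀ n ω) 2)

lemma integral_walkMartingale_sq_le [IsProbabilityMeasure P]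
    (hX : IsEARW P 1 (fun _ => p₁) p₀ X)
    (hp₁ : p₁ ∈ Set.Ioo (0 : ℝ) 1) (hp₀ : p₀ ∈ Set.Ioo (0 : ℝ) 1) (n : ℕ) :
    ∫ ω, walkMartingale p₁ p₀ (X · ω) n ^ 2 ∂P ≤ 4 * n := by
  induction n with
  | zero => simp [walkMartingale]
  | succ n ih =>
    have hprod : Integrable
        (fun ω => walkMartingale p₁ p₀ (X · ω) n * centeredStep p₁ p₀ (X · ω) n) P :=
      (hX.integrable_centeredStep hp₁ hp₀ n).bdd_mul
        (hX.measurable_walkMartingale n).aestronglyMeasurable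
        (ae_of_all _ fun ω => hX.abs_walkMartingale_le hp₁ hp₀ n ω)
    have hsq := hX.integrable_walkMartingale_sq hp₁ hp₀ n
    calc ∫ ω, walkMartingale p₁ p₀ (X · ω) (n + 1) ^ 2 ∂P
        ≤ ∫ ω, (walkMartingale p₁ p₀ (X · ω) n ^ 2
            + 2 * (walkMartingale p₁ p₀ (X · ω) n * centeredStep p₁ p₀ (X · ω) n) + 4) ∂P := by
          refine integral_mono (hX.integrable_walkMartingale_sq hp₁ hp₀ (n + 1))
            ((hsq.add (hprod.const_mul 2)).add (integrable_const 4)) fun ω => ?_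
          have := abs_le.1 (abs_centeredStep_le hp₁ hp₀ (x := (X · ω)) (hX.steps ω) n)
          simp only [walkMartingale_succ]
          nlinarith
      _ = ∫ ω, walkMartingale p₁ p₀ (X · ω) n ^ 2 ∂P + 4 := by
          rw [integral_add (f := fun ω => walkMartingale p₁ p₀ (X · ω) n ^ 2
              + 2 * (walkMartingale p₁ p₀ (X · ω) n * centeredStep p₁ p₀ (X · ω) n))
              (hsq.add (hprod.const_mul 2)) (integrable_const 4),
            integral_add hsq (hprod.const_mul 2), integral_const_mul,
            hX.integral_walkMartingale_mul_centeredStep hp₁ hp₀ n]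
          simp
      _ ≤ 4 * (n + 1 : ℕ) := by push_cast; linarith

lemma ae_tendsto_walkMartingale_sq_index [IsProbabilityMeasure P]
    (hX : IsEARW P 1 (fun _ => p₁) p₀ X)
    (hp₁ : p₁ ∈ Set.Ioo (0 : ℝ) 1) (hp₀ : p₀ ∈ Set.Ioo (0 : ℝ) 1) :
    ∀ᵐ ω ∂P, Tendsto
      (fun k : ℕ => walkMartingale p₁ p₀ (X · ω) (k ^ 2) / (k : ℝ) ^ 2) atTop (𝓝 0) := by
  let f : ℕ → Ω → ℝ := fun k ω => (walkMartingale p₁ p₀ (X · ω) (k ^ 2) / (k : ℝ) ^ 2) ^ 2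
  have hfm (k : ℕ) : Measurable fun ω => ENNReal.ofReal (f k ω) :=
    (((hX.measurable_walkMartingale _).div_const _).pow_const 2).ennreal_ofReal
  have hbound (k : ℕ) : ∫⁻ ω, ENNReal.ofReal (f k ω) ∂P ≤ ENNReal.ofReal (4 / (k : ℝ) ^ 2) := by
    have hfk : f k = fun ω => walkMartingale p₁ p₀ (X · ω) (k ^ 2) ^ 2 / ((k : ℝ) ^ 2) ^ 2 :=
      funext fun ω => div_pow _ _ _
    have hfi : Integrable (f k) P := by
      rw [hfk]
      exact (hX.integrable_walkMartingale_sq hp₁ hp₀ _).div_const _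
    rw [← ofReal_integral_eq_lintegral_ofReal hfi (ae_of_all _ fun ω => sq_nonneg _), hfk,
      integral_div]
    refine ENNReal.ofReal_le_ofReal ?_
    rcases Nat.eq_zero_or_pos k with rfl | hk
    · simp
    have hk' : (0 : ℝ) < k := by exact_mod_cast hk
    have := hX.integral_walkMartingale_sq_le hp₁ hp₀ (k ^ 2)
    push_cast at this
    rw [div_le_div_iff₀ (by positivity) (by positivity)]
    nlinarith [mul_le_mul_of_nonneg_right this (sq_nonneg (k : ℝ))]
  have hsum : Summable fun k : ℕ => 4 / (k : ℝ) ^ 2 := by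
    simpa [div_eq_mul_inv] using (Real.summable_nat_pow_inv.2 one_lt_two).mul_left 4
  have hfin : ∫⁻ ω, ∑' k, ENNReal.ofReal (f k ω) ∂P ≠ ⊤ := by
    rw [lintegral_tsum fun k => (hfm k).aemeasurable]
    refine ne_top_of_le_ne_top ?_ (ENNReal.tsum_le_tsum hbound)
    rw [← ENNReal.ofReal_tsum_of_nonneg (fun k => by positivity) hsum]
    exact ENNReal.ofReal_ne_top
  filter_upwards [ae_lt_top (Measurable.tsum hfm) hfin] with ω hω
  have h1 := ENNReal.tendsto_atTop_zero_of_tsum_ne_top hω.ne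
  have h2 : Tendsto (fun k => f k ω) atTop (𝓝 0) := by
    have := (ENNReal.tendsto_toReal ENNReal.zero_ne_top).comp h1
    simpa [Function.comp_def, ENNReal.toReal_ofReal (sq_nonneg _), f] using this
  have h3 := (Real.continuous_sqrt.tendsto 0).comp h2
  simp only [Function.comp_def, f, Real.sqrt_sq_eq_abs, Real.sqrt_zero] at h3
  exact (tendsto_zero_iff_abs_tendsto_zero _).2 h3

lemma ae_tendsto_walkMartingale_div [IsProbabilityMeasure P]
    (hX : IsEARW P 1 (fun _ => p₁) p₀ X)
    (hp₁ : p₁ ∈ Set.Ioo (0 : ℝ) 1) (hp₀ : p₀ ∈ Set.Ioo (0 : ℝ) 1) :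
    ∀ᵐ ω ∂P, Tendsto (fun n : ℕ => walkMartingale p₁ p₀ (X · ω) n / n) atTop (𝓝 0) := by
  filter_upwards [hX.ae_tendsto_walkMartingale_sq_index hp₁ hp₀] with ω hω
  set M := walkMartingale p₁ p₀ (X · ω) with hM
  have hlip {m n : ℕ} (h : m ≤ n) : |M n - M m| ≤ 2 * (n - m) := by
    induction n, h using Nat.le_induction with
    | base => simp
    | succ n _ ih =>
      have h1 := abs_centeredStep_le hp₁ hp₀ (x := (X · ω)) (hX.steps ω) n
      have h2 := abs_add_le (centeredStep p₁ p₀ (X · ω) n) (M n - M m)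
      rw [hM, walkMartingale_succ, ← hM, add_comm, add_sub_assoc]
      push_cast
      linarith
  have hsqrt : Tendsto Nat.sqrt atTop atTop :=
    tendsto_atTop.2 fun b => by
      filter_upwards [eventually_ge_atTop (b ^ 2)] with n hn
      exact Nat.le_sqrt'.2 hn
  have hupper : Tendsto (fun k : ℕ => |M (k ^ 2) / (k : ℝ) ^ 2| + 4 / (k : ℝ)) atTop (𝓝 0) := by
    simpa using hω.abs.add (tendsto_const_div_atTop_nhds_zero_nat 4)
  refine squeeze_zero_norm' ?_ (hupper.comp hsqrt)
  filter_upwards [eventually_ge_atTop 1] with n hn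
  have hk0 : (0 : ℝ) < n.sqrt := by exact_mod_cast Nat.sqrt_pos.2 hn
  have hn0 : (0 : ℝ) < n := by exact_mod_cast hn
  have hle : n.sqrt ^ 2 ≤ n := Nat.sqrt_le' n
  have hle' : (n.sqrt : ℝ) ^ 2 ≤ n := by exact_mod_cast hle
  have hgap : (n : ℝ) ≤ (n.sqrt : ℝ) ^ 2 + 2 * n.sqrt := by
    have := Nat.lt_succ_sqrt' n
    have h : n ≤ n.sqrt ^ 2 + 2 * n.sqrt := by
      rw [Nat.succ_eq_add_one] at this
      nlinarith
    exact_mod_cast h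
  have hdiff := hlip hle
  push_cast at hdiff
  have hMn : |M n| ≤ |M (n.sqrt ^ 2)| + 4 * n.sqrt := by
    have := abs_sub_abs_le_abs_sub (M n) (M (n.sqrt ^ 2))
    linarith
  simp only [Function.comp_apply]
  rw [Real.norm_eq_abs, abs_div, abs_of_pos hn0, abs_div, abs_of_pos (pow_pos hk0 2)]
  calc |M n| / n ≤ (|M (n.sqrt ^ 2)| + 4 * n.sqrt) / (n.sqrt : ℝ) ^ 2 := by gcongr
    _ = |M (n.sqrt ^ 2)| / (n.sqrt : ℝ) ^ 2 + 4 / n.sqrt := by field_simp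

end IsEARW

/-- **Speed of the one-cookie excited asymmetric random walk.**
For `p₁ ∈ (0,1)` and `p₀ ∈ (1/2,1)`, an excited asymmetric random walk with one
cookie of strength `p₁` and bias parameter `p₀` satisfies, almost surely,
`X n / n → (2p₀ - 1) / (2p₀ - 1 + 2(1 - p₁))`. -/
theorem excited_asymmetric_rw_speed
    {Ω : Type*} [MeasurableSpace Ω] (P : Measure Ω) [IsProbabilityMeasure P]
    (p₁ p₀ : ℝ) (hp₁ : p₁ ∈ Set.Ioo (0 : ℝ) 1) (hp₀ : p₀ ∈ Set.Ioo (1 / 2 : ℝ) 1)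
    (X : ℕ → Ω → ℤ) (hX : IsEARW P 1 (fun _ => p₁) p₀ X) :
    ∀ᵐ ω ∂P,
      Tendsto (fun n : ℕ => (X n ω : ℝ) / n) atTop
        (nhds ((2 * p₀ - 1) / (2 * p₀ - 1 + 2 * (1 - p₁)))) := by
  have hp₀' : p₀ ∈ Set.Ioo (0 : ℝ) 1 := ⟨by linarith [hp₀.1], hp₀.2⟩
  filter_upwards [hX.ae_tendsto_walkMartingale_div hp₁ hp₀'] with ω hω
  simp only [walkMartingale_eq p₁ p₀ (x := (X · ω)) (hX.init ω)] at hω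
  have h := tendsto_speed_of_error (x := (X · ω)) (hX.init ω) (hX.steps ω)
    (c := 2 * p₀ - 1) (a := p₀ - p₁) (by linarith [hp₀.1]) (by linarith [hp₁.1]) (by linarith [hp₀.1, hp₁.2]) hω
  convert h using 2
  ring
end
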